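/- There exist constants c, C > 0 depending only on Ω such that for all k ≥ 2 (with the additional requirement s_max((k−1)δ/k) > s when D = F_0(s)): sup_{θ⋆ ∈ D} P( sup_{λ ∈ [λ_min, λ_max]} | R̂^{k-CV}(λ) − (1/N)‖θ̂_λ − θ⋆‖² − δσ² | ≥ C/√k ) ≤ C k⁶ N^q e^{−cN/k⁶}. -/

import Mathlib

open MeasureTheory ProbabilityTheory
open scoped ENNReal NNReal

noncomputable section

/-- Standard Gaussian density φ. -/
def gphi (x : ℝ) : ℝ := Real.exp (-x ^ 2 / 2) / Real.sqrt (2 * Real.pi)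

/-- Standard Gaussian CDF Φ. -/
def gPhi (x : ℝ) : ℝ := ∫ t in Set.Iic x, gphi t

/-- Soft thresholding η(x; b) = sign(x)(|x| − b)₊. -/
def eta (x b : ℝ) : ℝ := Real.sign x * max (|x| - b) 0

/-- Derivative in x of soft thresholding: η′(x; b) = 1_{|x| > b}. -/
def eta' (x b : ℝ) : ℝ := if b < |x| then 1 else 0

/-- The ℓ_p ball F_p(ξ) = {x : (1/N) ∑ |xᵢ|^p ≤ ξ^p}. -/
def Fball (N : ℕ) (p ξ : ℝ) : Set (Fin N → ℝ) :=
  {x | (1 / (N : ℝ)) * ∑ i, |x i| ^ p ≤ ξ ^ p}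

/-- Number of nonzero entries ‖x‖₀. -/
def l0 {N : ℕ} (x : Fin N → ℝ) : ℕ := (Finset.univ.filter fun i => x i ≠ 0).card

/-- The ℓ₀ ball F_0(s) = {x : ‖x‖₀ ≤ sN}. -/
def F0ball (N : ℕ) (s : ℝ) : Set (Fin N → ℝ) := {x | (l0 x : ℝ) ≤ s * N}

/-- The critical sparsity s_max(δ). -/
def smax (δ : ℝ) : ℝ :=
  δ * sSup ((fun α : ℝ =>
      (1 - (2 / δ) * ((1 + α ^ 2) * gPhi (-α) - α * gphi α)) /
      (1 + α ^ 2 - 2 * ((1 + α ^ 2) * gPhi (-α) - α * gphi α))) '' Set.Ici 0)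

/-- Empirical distribution of the entries of a vector. -/
def empDist {N : ℕ} (θ : Fin N → ℝ) : Measure ℝ :=
  ((N : ℝ≥0∞))⁻¹ • ∑ i : Fin N, Measure.dirac (θ i)

/-- Empirical distribution of pairs of entries of two vectors. -/
def empDist2 {N : ℕ} (u v : Fin N → ℝ) : Measure (ℝ × ℝ) :=
  ((N : ℝ≥0∞))⁻¹ • ∑ i : Fin N, Measure.dirac (u i, v i)

/-- Squared order-2 Wasserstein distance between measures on ℝ². -/
def W2sq (μ ν : Measure (ℝ × ℝ)) : ℝ :=
  sInf {r : ℝ | ∃ γ : Measure ((ℝ × ℝ) × (ℝ × ℝ)),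
    γ.map Prod.fst = μ ∧ γ.map Prod.snd = ν ∧
    r = ∫ q, ((q.1.1 - q.2.1) ^ 2 + (q.1.2 - q.2.2) ^ 2) ∂γ}

/-- Order-2 Wasserstein distance. -/
def W2 (μ ν : Measure (ℝ × ℝ)) : ℝ := Real.sqrt (W2sq μ ν)

/-- Standard Gaussian measure on ℝ. -/
def stdG : Measure ℝ := gaussianReal 0 1

/-- The state-evolution fixed point equations (for (Θ,Z) ∼ μ ⊗ N(0,1)),
together with positivity of (β, τ). -/
def StateEvo (δ σ : ℝ) (μ : Measure ℝ) (lam β τ : ℝ) : Prop :=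
  0 < β ∧ 0 < τ ∧
  τ ^ 2 = σ ^ 2 + (1 / δ) *
    ∫ q : ℝ × ℝ, (eta (q.1 + τ * q.2) (τ * lam / β) - q.1) ^ 2 ∂(μ.prod stdG) ∧
  β = τ * (1 - (1 / δ) *
    ∫ q : ℝ × ℝ, eta' (q.1 + τ * q.2) (τ * lam / β) ∂(μ.prod stdG))

/-- s⋆ = P(|Θ + τZ| ≥ ατ) for (Θ,Z) ∼ μ ⊗ N(0,1). -/
def sStar (μ : Measure ℝ) (τ α : ℝ) : ℝ :=
  ((μ.prod stdG) {q : ℝ × ℝ | α * τ ≤ |q.1 + τ * q.2|}).toReal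

/-- The limit law μ⋆: law of (η(Θ + τZ; ατ), Θ) for (Θ,Z) ∼ μ ⊗ N(0,1). -/
def muStar (μ : Measure ℝ) (τ α : ℝ) : Measure (ℝ × ℝ) :=
  (μ.prod stdG).map (fun q => (eta (q.1 + τ * q.2) (α * τ), q.1))

/-- The limit law for the debiased Lasso: law of (Θ + τZ, Θ). -/
def muStarD (μ : Measure ℝ) (τ : ℝ) : Measure (ℝ × ℝ) :=
  (μ.prod stdG).map (fun q => (q.1 + τ * q.2, q.1))

/-- Law of the design matrix: i.i.d. N(0, 1/n) entries. -/
def PX (n N : ℕ) : Measure (Fin n → Fin N → ℝ) :=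
  Measure.pi fun _ => Measure.pi fun _ => gaussianReal 0 ((n : ℝ≥0))⁻¹

/-- Law of the noise: i.i.d. standard Gaussian entries. -/
def Pz (n : ℕ) : Measure (Fin n → ℝ) :=
  Measure.pi fun _ => gaussianReal 0 1

/-- Joint law of (X, z). -/
def Pmodel (n N : ℕ) : Measure ((Fin n → Fin N → ℝ) × (Fin n → ℝ)) :=
  (PX n N).prod (Pz n)

/-- The response y = Xθ⋆ + σz. -/
def yvec {n N : ℕ} (σ : ℝ) (θstar : Fin N → ℝ) (X : Fin n → Fin N → ℝ)
    (z : Fin n → ℝ) : Fin n → ℝ :=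
  fun i => (∑ j, X i j * θstar j) + σ * z i

/-- The Lasso cost (1/(2n))‖y − Xθ‖² + (λ/n)‖θ‖₁. -/
def lassoCost {n N : ℕ} (X : Fin n → Fin N → ℝ) (y : Fin n → ℝ) (lam : ℝ)
    (θ : Fin N → ℝ) : ℝ :=
  (1 / (2 * (n : ℝ))) * ∑ i, (y i - ∑ j, X i j * θ j) ^ 2
    + (lam / (n : ℝ)) * ∑ j, |θ j|

/-- The uniformity class: D is either an ℓ_p ball F_p(ξ) or an ℓ₀ ball F_0(s) with
s below the critical sparsity, with the corresponding exponent q. -/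
def DFamSpec (δ : ℝ) (Dfam : (M : ℕ) → Set (Fin M → ℝ)) (q : ℝ) : Prop :=
  (∃ p ξ : ℝ, 0 < p ∧ 0 < ξ ∧ (∀ M, Dfam M = Fball M p ξ) ∧ q = max (1 / p - 1) 0) ∨
  (∃ s : ℝ, 0 ≤ s ∧ s < smax δ ∧ (∀ M, Dfam M = F0ball M s) ∧ q = 0)

/-- Response y = Xθ⋆ + σz, for an arbitrary (finite) row index type. -/
def yvecI {ι : Type*} [Fintype ι] {N : ℕ} (σ : ℝ) (θstar : Fin N → ℝ)
    (X : ι → Fin N → ℝ) (z : ι → ℝ) : ι → ℝ :=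
  fun i => (∑ j, X i j * θstar j) + σ * z i

/-- Law of the design matrix for the cross-validation setting: rows indexed by
Fin k × Fin m (k folds of size m each, n = k·m), i.i.d. N(0, 1/n) entries. -/
def PXcv (k m N : ℕ) : Measure ((Fin k × Fin m) → Fin N → ℝ) :=
  Measure.pi fun _ => Measure.pi fun _ => gaussianReal 0 (((k * m : ℕ) : ℝ≥0))⁻¹

/-- Law of the noise in the cross-validation setting. -/
def Pzcv (k m : ℕ) : Measure ((Fin k × Fin m) → ℝ) :=
  Measure.pi fun _ => gaussianReal 0 1

/-- Joint law of (X, z) in the cross-validation setting. -/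
def PmodelCV (k m N : ℕ) :
    Measure (((Fin k × Fin m) → Fin N → ℝ) × ((Fin k × Fin m) → ℝ)) :=
  (PXcv k m N).prod (Pzcv k m)

/-- Full Lasso cost with rows indexed by Fin k × Fin m, n = k·m. -/
def lassoCostCV {k m N : ℕ} (X : (Fin k × Fin m) → Fin N → ℝ)
    (y : (Fin k × Fin m) → ℝ) (lam : ℝ) (θ : Fin N → ℝ) : ℝ :=
  (1 / (2 * ((k * m : ℕ) : ℝ))) * ∑ r, (y r - ∑ j, X r j * θ j) ^ 2
    + (lam / ((k * m : ℕ) : ℝ)) * ∑ j, |θ j|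

/-- Lasso cost for fold i removed: (1/(2n_k))‖y⁽⁻ⁱ⁾ − X⁽⁻ⁱ⁾θ‖² + (λ/n)‖θ‖₁,
with n_k = (k−1)m. -/
def lassoCostFold {k m N : ℕ} (i : Fin k) (X : (Fin k × Fin m) → Fin N → ℝ)
    (y : (Fin k × Fin m) → ℝ) (lam : ℝ) (θ : Fin N → ℝ) : ℝ :=
  (1 / (2 * (((k - 1) * m : ℕ) : ℝ))) *
      ∑ r ∈ Finset.univ.filter (fun r : Fin k × Fin m => r.1 ≠ i),
        (y r - ∑ j, X r j * θ j) ^ 2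
    + (lam / ((k * m : ℕ) : ℝ)) * ∑ j, |θ j|

/-- The standard Gaussian measure on `ι → ℝ`. -/
def gaussPi (ι : Type*) [Fintype ι] : Measure (ι → ℝ) :=
  Measure.pi fun _ => gaussianReal 0 1

instance gaussPi_isProb (ι : Type*) [Fintype ι] : IsProbabilityMeasure (gaussPi ι) := by
  unfold gaussPi; infer_instance

theorem gaussPi_reindex {ι κ : Type*} [Fintype ι] [Fintype κ] (f : κ → ι)
    (hf : Function.Injective f) :
    MeasurePreserving (fun (x : ι → ℝ) (c : κ) => x (f c)) (gaussPi ι) (gaussPi κ) := by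
  classical
  have hm : Measurable (fun (x : ι → ℝ) (c : κ) => x (f c)) :=
    measurable_pi_iff.mpr fun c => measurable_pi_apply _
  refine ⟨hm, ?_⟩
  symm
  refine Measure.pi_eq fun s hs => ?_
  rw [Measure.map_apply hm (MeasurableSet.univ_pi hs)]
  let t : ι → Set ℝ := fun i => ⋂ c : κ, ⋂ _ : f c = i, s c
  have h1 : (fun (x : ι → ℝ) (c : κ) => x (f c)) ⁻¹' Set.univ.pi s = Set.univ.pi t := by
    ext x
    simp only [t, Set.mem_preimage, Set.mem_pi, Set.mem_univ, true_imp_iff, Set.mem_iInter]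
    exact ⟨fun h i c hc => hc ▸ h c, fun h c => h _ c rfl⟩
  have h2 : ∀ c, t (f c) = s c := by
    intro c
    ext x
    simp [t, hf.eq_iff]
  have h3 : ∀ i, i ∉ Set.range f → t i = Set.univ := by
    intro i hi
    ext x
    simp only [t, Set.mem_iInter, Set.mem_univ, iff_true]
    exact fun c hc => absurd ⟨c, hc⟩ hi
  rw [h1, gaussPi, Measure.pi_pi]
  have : ∏ c, (gaussianReal 0 1) (s c) = ∏ i ∈ Finset.univ.image f, (gaussianReal 0 1) (t i) := by
    rw [Finset.prod_image (fun a _ b _ h => hf h)]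
    simp [h2]
  rw [this]
  symm
  refine Finset.prod_subset (Finset.subset_univ _) fun i _ hi => ?_
  rw [h3 i (by simpa using hi)]
  simp

theorem gaussPi_update {ι : Type*} [Fintype ι] [DecidableEq ι] (c : ι) :
    MeasurePreserving (fun p : (ι → ℝ) × ℝ => Function.update p.1 c p.2)
      ((gaussPi ι).prod (gaussianReal 0 1)) (gaussPi ι) := by
  have hm : Measurable (fun p : (ι → ℝ) × ℝ => Function.update p.1 c p.2) := by
    refine measurable_pi_iff.mpr fun i => ?_
    by_cases h : i = c
    · subst h; simpa using measurable_snd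
    · simp only [Function.update_of_ne h]
      exact (measurable_pi_apply i).comp measurable_fst
  refine ⟨hm, ?_⟩
  symm
  refine Measure.pi_eq fun s hs => ?_
  rw [Measure.map_apply hm (MeasurableSet.univ_pi hs)]
  have h1 : (fun p : (ι → ℝ) × ℝ => Function.update p.1 c p.2) ⁻¹' Set.univ.pi s
      = (Set.univ.pi (Function.update s c Set.univ)) ×ˢ s c := by
    ext ⟨x, t⟩
    simp only [Set.mem_preimage, Set.mem_pi, Set.mem_univ, true_imp_iff, Set.mem_prod]
    constructor
    · intro h
      refine ⟨fun i => ?_, by simpa using h c⟩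
      by_cases hi : i = c
      · subst hi; simp
      · simpa [hi] using h i
    · rintro ⟨h, h'⟩ i
      by_cases hi : i = c
      · subst hi; simpa using h'
      · simpa [hi] using h i
  rw [h1, Measure.prod_prod, gaussPi, Measure.pi_pi, ← Finset.mul_prod_erase _ _ (Finset.mem_univ c),
    ← Finset.mul_prod_erase Finset.univ (fun i => (gaussianReal 0 1) (s i)) (Finset.mem_univ c)]
  simp only [Function.update_self, measure_univ, one_mul]
  rw [mul_comm]
  congr 1
  refine Finset.prod_congr rfl fun i hi => ?_
  rw [Function.update_of_ne (Finset.ne_of_mem_erase hi)]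

theorem gaussPi_flip {ι : Type*} [Fintype ι] [DecidableEq ι] (c : ι) :
    MeasurePreserving (fun x : ι → ℝ => fun i => if i = c then - x i else x i)
      (gaussPi ι) (gaussPi ι) := by
  have h : ∀ i : ι, MeasurePreserving (fun t : ℝ => if i = c then - t else t)
      (gaussianReal 0 1) (gaussianReal 0 1) := by
    intro i
    by_cases hi : i = c
    · simp only [hi, if_true]
      refine ⟨measurable_neg, ?_⟩
      have := gaussianReal_map_neg (μ := 0) (v := 1)
      simpa using this
    · simp only [hi, if_false]
      exact MeasurePreserving.id _
  exact measurePreserving_pi (fun _ => gaussianReal 0 1) (fun _ => gaussianReal 0 1) h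

theorem gaussPi_eval {ι : Type*} [Fintype ι] (c : ι) :
    MeasurePreserving (fun x : ι → ℝ => x c) (gaussPi ι) (gaussianReal 0 1) :=
  measurePreserving_eval (fun _ : ι => gaussianReal 0 1) c

theorem integrable_id_stdGaussian : Integrable (fun x : ℝ => x) (gaussianReal 0 1) := by
  have := (memLp_id_gaussianReal (μ := 0) (v := 1) 1)
  exact memLp_one_iff_integrable.1 (by simpa using! this)

theorem integrable_sq_stdGaussian : Integrable (fun x : ℝ => x ^ 2) (gaussianReal 0 1) := by
  have := (memLp_id_gaussianReal (μ := 0) (v := 1) 2)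
  exact (memLp_two_iff_integrable_sq (by fun_prop)).1 (by simpa using! this)

theorem integral_id_mul_stdGaussian (f f' : ℝ → ℝ) (K : ℝ) (hf : ∀ x, |f x| ≤ K)
    (hf' : ∀ x, |f' x| ≤ K) (hd : ∀ x, HasDerivAt f (f' x) x) :
    ∫ x, x * f x ∂(gaussianReal 0 1) = ∫ x, f' x ∂(gaussianReal 0 1) := by
  have hfc : Continuous f := continuous_iff_continuousAt.2 fun x => (hd x).continuousAt
  have hfm : Measurable f' := by
    have : f' = deriv f := by ext x; exact ((hd x).deriv).symm
    rw [this]; exact measurable_deriv f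
  have hpd : ∀ x, HasDerivAt (gaussianPDFReal 0 1) (- x * gaussianPDFReal 0 1 x) x := by
    intro x
    have h : HasDerivAt (fun x : ℝ => (Real.sqrt (2 * Real.pi * (1:ℝ≥0)))⁻¹ * Real.exp (- (x - 0) ^ 2 / (2 * (1:ℝ≥0))))
        ((Real.sqrt (2 * Real.pi * (1:ℝ≥0)))⁻¹ * (Real.exp (- (x - 0) ^ 2 / (2 * (1:ℝ≥0))) * (-x))) x := by
      refine HasDerivAt.const_mul _ (HasDerivAt.exp ?_)
      have := (((hasDerivAt_id x).sub_const 0).pow 2).neg.div_const (2 * ((1:ℝ≥0):ℝ))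
      refine this.congr_deriv ?_
      simp
      ring
    rw [gaussianPDFReal_def]
    refine h.congr_deriv ?_
    ring
  have key : ∀ g : ℝ → ℝ, Integrable g (gaussianReal 0 1) ↔ Integrable (fun x => g x * gaussianPDFReal 0 1 x) := by
    intro g
    rw [gaussianReal_of_var_ne_zero _ one_ne_zero]
    unfold gaussianPDF
    rw [integrable_withDensity_iff_integrable_smul' (by fun_prop) (by simp)]
    refine integrable_congr (Filter.Eventually.of_forall fun x => ?_)
    simp [ENNReal.toReal_ofReal (gaussianPDFReal_nonneg 0 1 x), mul_comm]
  rw [integral_gaussianReal_eq_integral_smul one_ne_zero, integral_gaussianReal_eq_integral_smul one_ne_zero]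
  have i1 : Integrable f' (gaussianReal 0 1) :=
    Integrable.of_bound hfm.aestronglyMeasurable K (Filter.Eventually.of_forall hf')
  have i0 : Integrable f (gaussianReal 0 1) :=
    Integrable.of_bound hfc.measurable.aestronglyMeasurable K (Filter.Eventually.of_forall hf)
  have i2 : Integrable (fun x => x * f x) (gaussianReal 0 1) := by
    have := integrable_id_stdGaussian.bdd_mul hfc.measurable.aestronglyMeasurable (Filter.Eventually.of_forall hf)
    exact this.congr (Filter.Eventually.of_forall fun x => by simp [mul_comm])
  have := integral_mul_deriv_eq_deriv_mul_of_integrable (u := f) (u' := f') (v := gaussianPDFReal 0 1)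
    (v' := fun x => - x * gaussianPDFReal 0 1 x) (fun x _ => hd x) (fun x _ => hpd x)
    (by
      refine (((key _).1 i2).neg).congr (Filter.Eventually.of_forall fun x => ?_)
      simp; ring)
    ((key _).1 i1) ((key _).1 i0)
  simp only [smul_eq_mul]
  have e1 : ∫ x, gaussianPDFReal 0 1 x * f' x = ∫ x, f' x * gaussianPDFReal 0 1 x := by
    congr 1; ext x; ring
  have e2 : ∫ x, gaussianPDFReal 0 1 x * (x * f x) = - ∫ x, f x * (- x * gaussianPDFReal 0 1 x) := by
    rw [← integral_neg]; congr 1; ext x; ring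
  rw [e1, e2, this, neg_neg]

theorem integrable_coord_mul {ι : Type*} [Fintype ι] (c : ι) (f : (ι → ℝ) → ℝ) (K : ℝ)
    (hfm : Measurable f) (hf : ∀ x, |f x| ≤ K) : Integrable (fun x => x c * f x) (gaussPi ι) := by
  have h : Integrable (fun x : ι → ℝ => x c) (gaussPi ι) :=
    (gaussPi_eval c).integrable_comp_of_integrable integrable_id_stdGaussian
  have := h.bdd_mul hfm.aestronglyMeasurable (Filter.Eventually.of_forall hf)
  exact this.congr (Filter.Eventually.of_forall fun x => by simp [mul_comm])

theorem integral_coord_mul_gaussPi {ι : Type*} [Fintype ι] [DecidableEq ι] (c : ι)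
    (f f' : (ι → ℝ) → ℝ) (K : ℝ) (hfm : Measurable f) (hfm' : Measurable f')
    (hf : ∀ x, |f x| ≤ K) (hf' : ∀ x, |f' x| ≤ K)
    (hd : ∀ x t, HasDerivAt (fun t => f (Function.update x c t)) (f' (Function.update x c t)) t) :
    ∫ x, x c * f x ∂(gaussPi ι) = ∫ x, f' x ∂(gaussPi ι) := by
  have hmp := gaussPi_update c
  have i1 : Integrable f' (gaussPi ι) :=
    Integrable.of_bound hfm'.aestronglyMeasurable K (Filter.Eventually.of_forall hf')
  have i2 := integrable_coord_mul c f K hfm hf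
  have key : ∀ g : (ι → ℝ) → ℝ, Measurable g → Integrable g (gaussPi ι) →
      ∫ x, g x ∂(gaussPi ι) = ∫ x, ∫ t, g (Function.update x c t) ∂(gaussianReal 0 1) ∂(gaussPi ι) := by
    intro g hgm hg
    conv_lhs => rw [← hmp.map_eq]
    rw [integral_map hmp.measurable.aemeasurable hgm.aestronglyMeasurable]
    exact integral_prod _ (hmp.integrable_comp_of_integrable hg)
  rw [key f' hfm' i1, key (fun x => x c * f x) ((measurable_pi_apply c).mul hfm) i2]
  congr 1
  ext x
  simp only [Function.update_self]
  exact integral_id_mul_stdGaussian _ _ K (fun t => hf _) (fun t => hf' _) (fun t => hd x t)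

theorem gauss_interpolation {A Γ : Type*} [Fintype A] [Fintype Γ] (L M : A → Γ → ℝ)
    (hLM : ∀ a b, ∑ c, L a c * M b c = 0) (ψ : A → ℝ) (F : (A → ℝ) → ℝ) (D : A → (A → ℝ) → ℝ)
    (D2 : A → A → (A → ℝ) → ℝ) (K : ℝ) (hFm : Measurable F) (hDm : ∀ a, Measurable (D a))
    (hD2m : ∀ a b, Measurable (D2 a b)) (hFb : ∀ x, |F x| ≤ K) (hDb : ∀ a x, |D a x| ≤ K)
    (hD2b : ∀ a b x, |D2 a b x| ≤ K)
    (hF : ∀ (z : ℝ → A → ℝ) (z' : A → ℝ) (t : ℝ), (∀ a, HasDerivAt (fun s => z s a) (z' a) t) →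
      HasDerivAt (fun s => F (z s)) (∑ a, D a (z t) * z' a) t)
    (hD : ∀ (a : A) (z : ℝ → A → ℝ) (z' : A → ℝ) (t : ℝ),
      (∀ a, HasDerivAt (fun s => z s a) (z' a) t) →
      HasDerivAt (fun s => D a (z s)) (∑ b, D2 a b (z t) * z' b) t)
    (hpos : ∀ a b x, 0 ≤ (∑ c, L a c * L b c - ∑ c, M a c * M b c) * D2 a b x) :
    ∫ g, F (fun a => ψ a + ∑ c, M a c * g c) ∂(gaussPi Γ)
      ≤ ∫ g, F (fun a => ψ a + ∑ c, L a c * g c) ∂(gaussPi Γ) := by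
  classical
  let N : ℝ → A → Γ → ℝ := fun θ a c => Real.cos θ * M a c + Real.sin θ * L a c
  let N' : ℝ → A → Γ → ℝ := fun θ a c => - Real.sin θ * M a c + Real.cos θ * L a c
  let Z : ℝ → (Γ → ℝ) → A → ℝ := fun θ g a => ψ a + ∑ c, N θ a c * g c
  let Z' : ℝ → (Γ → ℝ) → A → ℝ := fun θ g a => ∑ c, N' θ a c * g c
  have hZm : ∀ θ, Measurable (Z θ) := fun θ => by
    refine measurable_pi_iff.mpr fun a => ?_
    simp only [Z]
    fun_prop
  have hK : 0 ≤ K := (abs_nonneg _).trans (hFb 0)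
  have hZd : ∀ θ g a, HasDerivAt (fun s => Z s g a) (Z' θ g a) θ := by
    intro θ g a
    refine HasDerivAt.const_add _ (HasDerivAt.fun_sum fun c _ => ?_)
    exact (((Real.hasDerivAt_cos θ).mul_const _).add ((Real.hasDerivAt_sin θ).mul_const _)).mul_const _
  let bd : (Γ → ℝ) → ℝ := fun g => ∑ _a : A, K * ∑ c, (|M _a c| + |L _a c|) * |g c|
  have hbdi : Integrable bd (gaussPi Γ) := by
    refine integrable_finsetSum _ fun a _ => (integrable_finsetSum _ fun c _ => ?_).const_mul _
    refine Integrable.const_mul ?_ _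
    exact ((gaussPi_eval c).integrable_comp_of_integrable integrable_id_stdGaussian).abs
  have hder : ∀ θ, HasDerivAt (fun s => ∫ g, F (Z s g) ∂(gaussPi Γ))
      (∫ g, ∑ a, D a (Z θ g) * Z' θ g a ∂(gaussPi Γ)) θ := by
    intro θ
    refine (hasDerivAt_integral_of_dominated_loc_of_deriv_le (s := Set.univ) (bound := bd)
      (F' := fun θ g => ∑ a, D a (Z θ g) * Z' θ g a)
      Filter.univ_mem ?_ ?_ ?_ ?_ hbdi ?_).2
    · exact Filter.Eventually.of_forall fun s => (hFm.comp (hZm s)).aestronglyMeasurable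
    · exact Integrable.of_bound (hFm.comp (hZm θ)).aestronglyMeasurable K
        (Filter.Eventually.of_forall fun x => hFb _)
    · refine Measurable.aestronglyMeasurable ?_
      refine Finset.measurable_sum _ fun a _ => ((hDm a).comp (hZm θ)).mul ?_
      simp only [Z']
      fun_prop
    · refine Filter.Eventually.of_forall fun g s _ => ?_
      rw [Real.norm_eq_abs]
      refine (Finset.abs_sum_le_sum_abs _ _).trans (Finset.sum_le_sum fun a _ => ?_)
      rw [abs_mul]
      refine mul_le_mul (hDb _ _) ?_ (abs_nonneg _) hK
      refine (Finset.abs_sum_le_sum_abs _ _).trans (Finset.sum_le_sum fun c _ => ?_)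
      rw [abs_mul]
      refine mul_le_mul_of_nonneg_right ?_ (abs_nonneg _)
      refine (abs_add_le _ _).trans (add_le_add ?_ ?_)
      · rw [abs_mul, abs_neg]
        exact mul_le_of_le_one_left (abs_nonneg _) (Real.abs_sin_le_one s)
      · rw [abs_mul]
        exact mul_le_of_le_one_left (abs_nonneg _) (Real.abs_cos_le_one s)
    · exact Filter.Eventually.of_forall fun g s _ => hF _ _ _ (hZd s g)
  have hibp : ∀ θ a c, ∫ g, g c * D a (Z θ g) ∂(gaussPi Γ)
      = ∑ b, N θ b c * ∫ g, D2 a b (Z θ g) ∂(gaussPi Γ) := by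
    intro θ a c
    have hb : ∀ x, |∑ b, D2 a b x * N θ b c| ≤ ∑ b, K * |N θ b c| := by
      intro x
      refine (Finset.abs_sum_le_sum_abs _ _).trans (Finset.sum_le_sum fun b _ => ?_)
      rw [abs_mul]
      exact mul_le_mul_of_nonneg_right (hD2b _ _ _) (abs_nonneg _)
    rw [integral_coord_mul_gaussPi c (fun g => D a (Z θ g))
      (fun g => ∑ b, D2 a b (Z θ g) * N θ b c) (max K (∑ b, K * |N θ b c|))
      ((hDm a).comp (hZm θ))
      (Finset.measurable_sum _ fun b _ => ((hD2m a b).comp (hZm θ)).mul_const _)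
      (fun x => (hDb _ _).trans (le_max_left _ _)) (fun x => (hb _).trans (le_max_right _ _)) ?_]
    · rw [integral_finsetSum]
      · refine Finset.sum_congr rfl fun b _ => ?_
        rw [integral_mul_const, mul_comm]
      · intro b _
        refine Integrable.mul_const ?_ _
        exact Integrable.of_bound ((hD2m a b).comp (hZm θ)).aestronglyMeasurable K
          (Filter.Eventually.of_forall fun x => hD2b _ _ _)
    · intro x t
      refine hD a (fun s => Z θ (Function.update x c s)) (fun b => N θ b c) t fun b => ?_
      refine HasDerivAt.const_add _ ?_
      have : ∀ c', HasDerivAt (fun s => N θ b c' * Function.update x c s c')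
          (if c' = c then N θ b c else 0) t := by
        intro c'
        by_cases h : c' = c
        · subst h
          simp only [Function.update_self, if_true]
          simpa using (hasDerivAt_id t).const_mul (N θ b c')
        · simp only [h, if_false, Function.update_of_ne h]
          exact hasDerivAt_const _ _
      have h2 := HasDerivAt.fun_sum (u := Finset.univ) (fun c' _ => this c')
      simpa using h2
  have hval : ∀ θ, ∫ g, ∑ a, D a (Z θ g) * Z' θ g a ∂(gaussPi Γ)
      = Real.sin θ * Real.cos θ * ∑ a, ∑ b,
        (∑ c, L a c * L b c - ∑ c, M a c * M b c) * ∫ g, D2 a b (Z θ g) ∂(gaussPi Γ) := by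
    intro θ
    have hi : ∀ a c, Integrable (fun g => g c * D a (Z θ g)) (gaussPi Γ) := fun a c =>
      integrable_coord_mul c _ K ((hDm a).comp (hZm θ)) fun x => hDb _ _
    have e1 : ∀ g, ∑ a, D a (Z θ g) * Z' θ g a = ∑ a, ∑ c, N' θ a c * (g c * D a (Z θ g)) := by
      intro g
      refine Finset.sum_congr rfl fun a _ => ?_
      simp only [Z', Finset.mul_sum]
      refine Finset.sum_congr rfl fun c _ => ?_
      ring
    simp only [e1]
    rw [integral_finsetSum _ fun a _ => integrable_finsetSum _ fun c _ => (hi a c).const_mul _]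
    rw [Finset.mul_sum]
    refine Finset.sum_congr rfl fun a _ => ?_
    rw [integral_finsetSum _ fun c _ => (hi a c).const_mul _]
    simp only [integral_const_mul, hibp, Finset.mul_sum]
    rw [Finset.sum_comm]
    refine Finset.sum_congr rfl fun b _ => ?_
    have e2 : ∑ c, N' θ a c * N θ b c
        = Real.sin θ * Real.cos θ * (∑ c, L a c * L b c - ∑ c, M a c * M b c) := by
      have h1 := hLM a b
      have h2 := hLM b a
      have : ∀ c, N' θ a c * N θ b c = Real.cos θ ^ 2 * (L a c * M b c)
          - Real.sin θ ^ 2 * (L b c * M a c)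
          + Real.sin θ * Real.cos θ * (L a c * L b c) - Real.sin θ * Real.cos θ * (M a c * M b c) := by
        intro c; simp only [N, N']; ring
      simp only [this, Finset.sum_add_distrib, Finset.sum_sub_distrib, ← Finset.mul_sum, h1, h2]
      ring
    rw [← mul_assoc, ← e2, Finset.sum_mul]
    refine Finset.sum_congr rfl fun c _ => by ring
  have hmono : MonotoneOn (fun s => ∫ g, F (Z s g) ∂(gaussPi Γ)) (Set.Icc 0 (Real.pi / 2)) := by
    refine monotoneOn_of_deriv_nonneg (convex_Icc _ _) ?_ ?_ ?_
    · exact fun x _ => (hder x).continuousAt.continuousWithinAt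
    · exact fun x _ => (hder x).differentiableAt.differentiableWithinAt
    · intro x hx
      rw [interior_Icc] at hx
      rw [(hder x).deriv, hval]
      refine mul_nonneg (mul_nonneg ?_ ?_) ?_
      · exact Real.sin_nonneg_of_nonneg_of_le_pi hx.1.le (by linarith [hx.2, Real.pi_pos])
      · exact Real.cos_nonneg_of_neg_pi_div_two_le_of_le (by linarith [hx.1, Real.pi_pos]) hx.2.le
      · refine Finset.sum_nonneg fun a _ => Finset.sum_nonneg fun b _ => ?_
        rw [← integral_const_mul]
        exact integral_nonneg fun g => hpos a b _
  have := hmono (Set.left_mem_Icc.2 (by positivity)) (Set.right_mem_Icc.2 (by positivity)) (by positivity)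
  simpa [Z, N] using this

/-- Euclidean norm of a vector given as a function on a finite type. -/
def nrm {ι : Type*} [Fintype ι] (p : ι → ℝ) : ℝ := Real.sqrt (∑ r, p r ^ 2)

theorem nrm_nonneg {ι : Type*} [Fintype ι] (p : ι → ℝ) : 0 ≤ nrm p := Real.sqrt_nonneg _

theorem nrm_sq {ι : Type*} [Fintype ι] (p : ι → ℝ) : nrm p ^ 2 = ∑ r, p r ^ 2 :=
  Real.sq_sqrt (Finset.sum_nonneg fun _ _ => sq_nonneg _)

theorem sum_mul_le_nrm {ι : Type*} [Fintype ι] (p q : ι → ℝ) : ∑ r, p r * q r ≤ nrm p * nrm q :=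
  Real.sum_mul_le_sqrt_mul_sqrt _ _ _

theorem abs_sum_mul_le_nrm {ι : Type*} [Fintype ι] (p q : ι → ℝ) :
    |∑ r, p r * q r| ≤ nrm p * nrm q := by
  rw [abs_le']
  refine ⟨sum_mul_le_nrm p q, ?_⟩
  have := sum_mul_le_nrm (fun r => - p r) q
  have e : nrm (fun r => - p r) = nrm p := by simp [nrm]
  rw [e] at this
  simpa using this

set_option linter.unusedSectionVars false

section SoftMinMax
variable {I J : Type*} [Fintype I] [Fintype J]

/-- Row sums of exponentials. -/
def rowExp (β : ℝ) (x : I × J → ℝ) (i : I) : ℝ := ∑ j, Real.exp (β * x (i, j))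

/-- A smooth surrogate for the indicator of `∀ i, ∃ j, 0 < x (i, j)`. -/
def softInd (β : ℝ) (x : I × J → ℝ) : ℝ := (1 + ∑ i, (rowExp β x i)⁻¹)⁻¹

/-- First partial derivatives of `softInd`. -/
def softIndD (β : ℝ) (a : I × J) (x : I × J → ℝ) : ℝ :=
  β * softInd β x ^ 2 * (Real.exp (β * x a) * (rowExp β x a.1)⁻¹ ^ 2)

open Classical in
/-- Second partial derivatives of `softInd`. -/
def softIndD2 (β : ℝ) (a b : I × J) (x : I × J → ℝ) : ℝ :=
  2 * β * softInd β x * softIndD β b x * (Real.exp (β * x a) * (rowExp β x a.1)⁻¹ ^ 2)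
  + (if a = b then β ^ 2 * softInd β x ^ 2 * (Real.exp (β * x a) * (rowExp β x a.1)⁻¹ ^ 2) else 0)
  + (if a.1 = b.1 then - (2 * β ^ 2) * softInd β x ^ 2 *
      (Real.exp (β * x a) * Real.exp (β * x b) * (rowExp β x a.1)⁻¹ ^ 3) else 0)

variable [Nonempty J]

theorem rowExp_pos (β : ℝ) (x : I × J → ℝ) (i : I) : 0 < rowExp β x i :=
  Finset.sum_pos (fun _ _ => Real.exp_pos _) Finset.univ_nonempty

theorem softInd_den_pos (β : ℝ) (x : I × J → ℝ) : 0 < 1 + ∑ i, (rowExp β x i)⁻¹ := by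
  have : 0 ≤ ∑ i, (rowExp β x i)⁻¹ :=
    Finset.sum_nonneg fun i _ => (inv_pos.2 (rowExp_pos β x i)).le
  linarith

theorem softInd_pos (β : ℝ) (x : I × J → ℝ) : 0 < softInd β x := inv_pos.2 (softInd_den_pos β x)

theorem softInd_le_one (β : ℝ) (x : I × J → ℝ) : softInd β x ≤ 1 := by
  refine inv_le_one_of_one_le₀ ?_
  have : 0 ≤ ∑ i, (rowExp β x i)⁻¹ :=
    Finset.sum_nonneg fun i _ => (inv_pos.2 (rowExp_pos β x i)).le
  linarith

theorem softInd_mul_le_one (β : ℝ) (x : I × J → ℝ) (i : I) :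
    softInd β x * (rowExp β x i)⁻¹ ≤ 1 := by
  have h1 := Finset.single_le_sum (f := fun i => (rowExp β x i)⁻¹)
    (fun i _ => (inv_pos.2 (rowExp_pos β x i)).le) (Finset.mem_univ i)
  rw [softInd, inv_mul_le_iff₀ (softInd_den_pos β x)]
  linarith

theorem exp_mul_inv_rowExp_le (β : ℝ) (x : I × J → ℝ) (a : I × J) :
    Real.exp (β * x a) * (rowExp β x a.1)⁻¹ ≤ 1 := by
  have := Finset.single_le_sum (f := fun j => Real.exp (β * x (a.1, j)))
    (fun j _ => (Real.exp_pos _).le) (Finset.mem_univ a.2)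
  rw [← div_eq_mul_inv, div_le_one (rowExp_pos β x a.1)]
  exact this

theorem softInd_row_bound (β : ℝ) (x : I × J → ℝ) (a : I × J) :
    softInd β x * (Real.exp (β * x a) * (rowExp β x a.1)⁻¹ ^ 2) ≤ 1 := by
  have h1 := softInd_mul_le_one β x a.1
  have h2 := exp_mul_inv_rowExp_le β x a
  have h3 : 0 ≤ Real.exp (β * x a) * (rowExp β x a.1)⁻¹ :=
    mul_nonneg (Real.exp_pos _).le (inv_pos.2 (rowExp_pos β x a.1)).le
  calc _ = (softInd β x * (rowExp β x a.1)⁻¹) * (Real.exp (β * x a) * (rowExp β x a.1)⁻¹) := by ring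
    _ ≤ 1 * 1 := mul_le_mul h1 h2 h3 zero_le_one
    _ = 1 := by ring

theorem row_term_nonneg (β : ℝ) (x : I × J → ℝ) (a : I × J) :
    0 ≤ Real.exp (β * x a) * (rowExp β x a.1)⁻¹ ^ 2 :=
  mul_nonneg (Real.exp_pos _).le (sq_nonneg _)

theorem softIndD_nonneg {β : ℝ} (hβ : 0 ≤ β) (a : I × J) (x : I × J → ℝ) : 0 ≤ softIndD β a x :=
  mul_nonneg (mul_nonneg hβ (sq_nonneg _)) (row_term_nonneg β x a)

theorem softIndD_le {β : ℝ} (hβ : 0 ≤ β) (a : I × J) (x : I × J → ℝ) : softIndD β a x ≤ β := by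
  have h1 := softInd_row_bound β x a
  have h2 := softInd_le_one β x
  have h3 := softInd_pos β x
  have h4 := row_term_nonneg β x a
  calc softIndD β a x = β * (softInd β x * (softInd β x *
        (Real.exp (β * x a) * (rowExp β x a.1)⁻¹ ^ 2))) := by unfold softIndD; ring
    _ ≤ β * (1 * 1) := by
        refine mul_le_mul_of_nonneg_left ?_ hβ
        exact mul_le_mul h2 h1 (mul_nonneg h3.le h4) zero_le_one
    _ = β := by ring

theorem softIndD2_abs_le {β : ℝ} (hβ : 0 ≤ β) (a b : I × J) (x : I × J → ℝ) :
    |softIndD2 β a b x| ≤ 5 * β ^ 2 := by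
  classical
  have h1 := softInd_row_bound β x a
  have h2 := softInd_le_one β x
  have h3 := softInd_pos β x
  have h4 := row_term_nonneg β x a
  have h5 := softIndD_nonneg hβ b x
  have h6 := softIndD_le hβ b x
  have t1 : |2 * β * softInd β x * softIndD β b x *
      (Real.exp (β * x a) * (rowExp β x a.1)⁻¹ ^ 2)| ≤ 2 * β ^ 2 := by
    rw [abs_of_nonneg (by positivity)]
    calc _ = 2 * β * (softIndD β b x *
          (softInd β x * (Real.exp (β * x a) * (rowExp β x a.1)⁻¹ ^ 2))) := by ring
      _ ≤ 2 * β * (β * 1) := by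
        refine mul_le_mul_of_nonneg_left ?_ (by positivity)
        exact mul_le_mul h6 h1 (by positivity) hβ
      _ = _ := by ring
  have t2 : |if a = b then β ^ 2 * softInd β x ^ 2 *
      (Real.exp (β * x a) * (rowExp β x a.1)⁻¹ ^ 2) else 0| ≤ β ^ 2 := by
    split_ifs
    · rw [abs_of_nonneg (by positivity)]
      calc _ = β ^ 2 * (softInd β x *
            (softInd β x * (Real.exp (β * x a) * (rowExp β x a.1)⁻¹ ^ 2))) := by ring
        _ ≤ β ^ 2 * (1 * 1) := by
          refine mul_le_mul_of_nonneg_left ?_ (by positivity)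
          exact mul_le_mul h2 h1 (by positivity) zero_le_one
        _ = _ := by ring
    · simp; positivity
  have t3 : |if a.1 = b.1 then - (2 * β ^ 2) * softInd β x ^ 2 *
      (Real.exp (β * x a) * Real.exp (β * x b) * (rowExp β x a.1)⁻¹ ^ 3) else 0| ≤ 2 * β ^ 2 := by
    split_ifs with h
    · have h7 := exp_mul_inv_rowExp_le β x b
      rw [← h] at h7
      have h8 := (rowExp_pos β x a.1)
      have h9 := (Real.exp_pos (β * x b))
      rw [neg_mul, neg_mul, abs_neg, abs_of_nonneg (by positivity)]
      calc _ = 2 * β ^ 2 * (softInd β x * ((softInd β x *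
            (Real.exp (β * x a) * (rowExp β x a.1)⁻¹ ^ 2)) *
            (Real.exp (β * x b) * (rowExp β x a.1)⁻¹))) := by ring
        _ ≤ 2 * β ^ 2 * (1 * (1 * 1)) := by
          refine mul_le_mul_of_nonneg_left ?_ (by positivity)
          refine mul_le_mul h2 ?_ (by positivity) zero_le_one
          exact mul_le_mul h1 h7 (by positivity) zero_le_one
        _ = _ := by ring
    · simp; positivity
  unfold softIndD2
  refine (abs_add_le _ _).trans ?_
  refine (add_le_add ((abs_add_le _ _).trans (add_le_add t1 t2)) t3).trans ?_
  linarith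

theorem softIndD2_nonneg {β : ℝ} (hβ : 0 ≤ β) (a b : I × J) (hab : a.1 ≠ b.1) (x : I × J → ℝ) :
    0 ≤ softIndD2 β a b x := by
  have h3 := softInd_pos β x
  have h4 := row_term_nonneg β x a
  have h5 := softIndD_nonneg hβ b x
  have hab' : a ≠ b := fun h => hab (by rw [h])
  simp only [softIndD2, hab, hab', if_false, add_zero]
  positivity

theorem hasDerivAt_rowExp (β : ℝ) (z : ℝ → I × J → ℝ) (z' : I × J → ℝ) (t : ℝ)
    (hz : ∀ a, HasDerivAt (fun s => z s a) (z' a) t) (i : I) :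
    HasDerivAt (fun s => rowExp β (z s) i) (∑ j, Real.exp (β * z t (i, j)) * (β * z' (i, j))) t :=
  HasDerivAt.fun_sum fun j _ => ((hz (i, j)).const_mul β).exp

theorem hasDerivAt_softInd (β : ℝ) (z : ℝ → I × J → ℝ) (z' : I × J → ℝ) (t : ℝ)
    (hz : ∀ a, HasDerivAt (fun s => z s a) (z' a) t) :
    HasDerivAt (fun s => softInd β (z s)) (∑ a, softIndD β a (z t) * z' a) t := by
  have h1 : HasDerivAt (fun s => 1 + ∑ i, (rowExp β (z s) i)⁻¹)
      (∑ i, -(∑ j, Real.exp (β * z t (i, j)) * (β * z' (i, j))) / (rowExp β (z t) i) ^ 2) t :=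
    HasDerivAt.const_add _ (HasDerivAt.fun_sum fun i _ =>
      (hasDerivAt_rowExp β z z' t hz i).fun_inv (rowExp_pos β (z t) i).ne')
  refine (h1.fun_inv (softInd_den_pos β (z t)).ne').congr_deriv ?_
  rw [Fintype.sum_prod_type, neg_div, Finset.sum_div, ← Finset.sum_neg_distrib]
  refine Finset.sum_congr rfl fun i _ => ?_
  rw [neg_div, neg_div, neg_neg, Finset.sum_div, Finset.sum_div]
  refine Finset.sum_congr rfl fun j _ => ?_
  simp only [softIndD, softInd, div_eq_mul_inv, inv_pow]
  ring

theorem hasDerivAt_softIndD (β : ℝ) (a : I × J) (z : ℝ → I × J → ℝ) (z' : I × J → ℝ) (t : ℝ)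
    (hz : ∀ a, HasDerivAt (fun s => z s a) (z' a) t) :
    HasDerivAt (fun s => softIndD β a (z s)) (∑ b, softIndD2 β a b (z t) * z' b) t := by
  classical
  have h1 := hasDerivAt_softInd β z z' t hz
  have h2 := ((hz a).const_mul β).exp
  have h3 := ((hasDerivAt_rowExp β z z' t hz a.1).fun_inv (rowExp_pos β (z t) a.1).ne').fun_pow 2
  have h4 := ((h1.fun_pow 2).const_mul β).mul (h2.mul h3)
  refine h4.congr_deriv ?_
  have e1 : ∑ b, (if a = b then β ^ 2 * softInd β (z t) ^ 2 * (Real.exp (β * z t a) *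
      (rowExp β (z t) a.1)⁻¹ ^ 2) else 0) * z' b = β ^ 2 * softInd β (z t) ^ 2 *
      (Real.exp (β * z t a) * (rowExp β (z t) a.1)⁻¹ ^ 2) * z' a := by
    simp [ite_mul]
  have e2 : ∑ b : I × J, (if a.1 = b.1 then - (2 * β ^ 2) * softInd β (z t) ^ 2 *
      (Real.exp (β * z t a) * Real.exp (β * z t b) * (rowExp β (z t) a.1)⁻¹ ^ 3) else 0) * z' b
      = - (2 * β) * softInd β (z t) ^ 2 * Real.exp (β * z t a) * (rowExp β (z t) a.1)⁻¹ ^ 3 *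
        ∑ j, Real.exp (β * z t (a.1, j)) * (β * z' (a.1, j)) := by
    rw [Fintype.sum_prod_type, Finset.sum_eq_single a.1]
    · rw [Finset.mul_sum]
      refine Finset.sum_congr rfl fun j _ => ?_
      simp only [if_true]
      ring
    · intro i _ hi
      simp [Ne.symm hi]
    · simp
  simp only [softIndD2, add_mul, Finset.sum_add_distrib, e1, e2]
  have e3 : ∑ b, 2 * β * softInd β (z t) * softIndD β b (z t) * (Real.exp (β * z t a) *
      (rowExp β (z t) a.1)⁻¹ ^ 2) * z' b = 2 * β * softInd β (z t) * (Real.exp (β * z t a) *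
      (rowExp β (z t) a.1)⁻¹ ^ 2) * ∑ b, softIndD β b (z t) * z' b := by
    rw [Finset.mul_sum]
    exact Finset.sum_congr rfl fun b _ => by ring
  rw [e3]
  simp only [Nat.cast_ofNat, Nat.add_one_sub_one, pow_one, Pi.mul_apply, div_eq_mul_inv, ← inv_pow]
  ring

end SoftMinMax

theorem softInd_tendsto_zero {I J : Type*} [Fintype I] [Fintype J] [Nonempty J] (x : I × J → ℝ)
    (i : I) (hx : ∀ j, x (i, j) < 0) :
    Filter.Tendsto (fun n : ℕ => softInd (n : ℝ) x) Filter.atTop (nhds 0) := by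
  have h0 : Filter.Tendsto (fun n : ℕ => rowExp (n : ℝ) x i) Filter.atTop (nhds 0) := by
    have : Filter.Tendsto (fun n : ℕ => rowExp (n : ℝ) x i) Filter.atTop (nhds (∑ _j : J, (0 : ℝ))) := by
      refine tendsto_finsetSum _ fun j _ => ?_
      exact Real.tendsto_exp_atBot.comp ((tendsto_natCast_atTop_atTop).atTop_mul_const_of_neg (hx j))
    simpa using this
  refine squeeze_zero (fun n => (softInd_pos _ x).le) (fun n => ?_) h0
  have := softInd_mul_le_one (n : ℝ) x i
  rwa [← div_eq_mul_inv, div_le_one (rowExp_pos _ x i)] at this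

theorem softInd_tendsto_one {I J : Type*} [Fintype I] [Fintype J] [Nonempty J] (x : I × J → ℝ)
    (hx : ∀ i, ∃ j, 0 < x (i, j)) :
    Filter.Tendsto (fun n : ℕ => softInd (n : ℝ) x) Filter.atTop (nhds 1) := by
  have h0 : ∀ i, Filter.Tendsto (fun n : ℕ => (rowExp (n : ℝ) x i)⁻¹) Filter.atTop (nhds 0) := by
    intro i
    obtain ⟨j, hj⟩ := hx i
    refine tendsto_inv_atTop_zero.comp ?_
    refine Filter.tendsto_atTop_mono (fun n => ?_)
      (Real.tendsto_exp_atTop.comp ((tendsto_natCast_atTop_atTop).atTop_mul_const hj))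
    exact Finset.single_le_sum (f := fun j => Real.exp ((n : ℝ) * x (i, j)))
      (fun j _ => (Real.exp_pos _).le) (Finset.mem_univ j)
  have h1 : Filter.Tendsto (fun n : ℕ => 1 + ∑ i, (rowExp (n : ℝ) x i)⁻¹) Filter.atTop
      (nhds (1 + ∑ _i : I, (0 : ℝ))) :=
    tendsto_const_nhds.add (tendsto_finsetSum _ fun i _ => h0 i)
  have h2 := h1.inv₀ (by simp)
  simpa [softInd] using h2

theorem measurable_softInd {I J : Type*} [Fintype I] [Fintype J] (β : ℝ) :
    Measurable (softInd β : (I × J → ℝ) → ℝ) := by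
  unfold softInd rowExp; fun_prop

theorem measurable_softIndD {I J : Type*} [Fintype I] [Fintype J] (β : ℝ) (a : I × J) :
    Measurable (softIndD β a : (I × J → ℝ) → ℝ) := by
  have := measurable_softInd (I := I) (J := J) β
  unfold softIndD rowExp; fun_prop

theorem measurable_softIndD2 {I J : Type*} [Fintype I] [Fintype J] (β : ℝ) (a b : I × J) :
    Measurable (softIndD2 β a b : (I × J → ℝ) → ℝ) := by
  have := measurable_softInd (I := I) (J := J) β
  have := measurable_softIndD (I := I) (J := J) β b
  unfold softIndD2 rowExp
  refine (Measurable.add (Measurable.add ?_ ?_) ?_)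
  · fun_prop
  · split_ifs <;> fun_prop
  · split_ifs <;> fun_prop

/-- Gordon's Gaussian min-max comparison for linear images of a standard Gaussian vector. -/
theorem gordon_comparison {I J Γ : Type*} [Fintype I] [Fintype J] [Nonempty J] [Fintype Γ]
    (L M : I × J → Γ → ℝ) (hLM : ∀ a b, ∑ c, L a c * M b c = 0) (ψ : I × J → ℝ)
    (hsame : ∀ a b, a.1 = b.1 → ∑ c, L a c * L b c = ∑ c, M a c * M b c)
    (hdiff : ∀ a b, ∑ c, M a c * M b c ≤ ∑ c, L a c * L b c) :
    (gaussPi Γ) {g | ∃ i, ∀ j, ψ (i, j) + ∑ c, L (i, j) c * g c < 0}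
      ≤ (gaussPi Γ) {g | ∃ i, ∀ j, ψ (i, j) + ∑ c, M (i, j) c * g c ≤ 0} := by
  set EX := {g : Γ → ℝ | ∃ i, ∀ j, ψ (i, j) + ∑ c, L (i, j) c * g c < 0} with hEX
  set EY := {g : Γ → ℝ | ∃ i, ∀ j, ψ (i, j) + ∑ c, M (i, j) c * g c ≤ 0} with hEY
  have mX : MeasurableSet EX := by
    rw [hEX]
    simp only [Set.ofPred_exists, Set.ofPred_forall]
    refine MeasurableSet.iUnion fun i => MeasurableSet.iInter fun j => ?_
    exact measurableSet_lt (by fun_prop) (by fun_prop)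
  have mY : MeasurableSet EY := by
    rw [hEY]
    simp only [Set.ofPred_exists, Set.ofPred_forall]
    refine MeasurableSet.iUnion fun i => MeasurableSet.iInter fun j => ?_
    exact measurableSet_le (by fun_prop) (by fun_prop)
  let X : (Γ → ℝ) → I × J → ℝ := fun g a => ψ a + ∑ c, L a c * g c
  let Y : (Γ → ℝ) → I × J → ℝ := fun g a => ψ a + ∑ c, M a c * g c
  have hXm : Measurable X := measurable_pi_iff.mpr fun a => by simp only [X]; fun_prop
  have hYm : Measurable Y := measurable_pi_iff.mpr fun a => by simp only [Y]; fun_prop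
  have hcmp : ∀ n : ℕ, ∫ g, softInd (n : ℝ) (Y g) ∂(gaussPi Γ)
      ≤ ∫ g, softInd (n : ℝ) (X g) ∂(gaussPi Γ) := by
    intro n
    have hβ : (0 : ℝ) ≤ n := Nat.cast_nonneg n
    refine gauss_interpolation L M hLM ψ (softInd (n : ℝ)) (softIndD (n : ℝ)) (softIndD2 (n : ℝ))
      (1 + n + 5 * (n : ℝ) ^ 2) (measurable_softInd _) (measurable_softIndD _)
      (measurable_softIndD2 _) ?_ ?_ ?_ (hasDerivAt_softInd _) (hasDerivAt_softIndD _) ?_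
    · intro x
      rw [abs_of_pos (softInd_pos _ x)]
      have := softInd_le_one (n : ℝ) x
      nlinarith
    · intro a x
      rw [abs_of_nonneg (softIndD_nonneg hβ a x)]
      have := softIndD_le hβ a x
      nlinarith
    · intro a b x
      have := softIndD2_abs_le hβ a b x
      linarith
    · intro a b x
      by_cases h : a.1 = b.1
      · rw [hsame a b h]; simp
      · exact mul_nonneg (sub_nonneg.2 (hdiff a b)) (softIndD2_nonneg hβ a b h x)
  have hintX : ∀ n : ℕ, Integrable (fun g => softInd (n : ℝ) (X g)) (gaussPi Γ) := fun n =>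
    Integrable.of_bound ((measurable_softInd _).comp hXm).aestronglyMeasurable 1
      (Filter.Eventually.of_forall fun g => by
        rw [Real.norm_eq_abs, abs_of_pos (softInd_pos _ _)]; exact softInd_le_one _ _)
  have hintY : ∀ n : ℕ, Integrable (fun g => softInd (n : ℝ) (Y g)) (gaussPi Γ) := fun n =>
    Integrable.of_bound ((measurable_softInd _).comp hYm).aestronglyMeasurable 1
      (Filter.Eventually.of_forall fun g => by
        rw [Real.norm_eq_abs, abs_of_pos (softInd_pos _ _)]; exact softInd_le_one _ _)
  have lX : Filter.Tendsto (fun n : ℕ => ∫ g in EX, softInd (n : ℝ) (X g) ∂(gaussPi Γ))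
      Filter.atTop (nhds 0) := by
    have := tendsto_integral_of_dominated_convergence (μ := (gaussPi Γ).restrict EX)
      (F := fun n : ℕ => fun g => softInd (n : ℝ) (X g)) (f := fun _ => (0 : ℝ)) (fun _ => (1 : ℝ))
      (fun n => (hintX n).aestronglyMeasurable.restrict) (integrable_const _)
      (fun n => Filter.Eventually.of_forall fun g => by
        rw [Real.norm_eq_abs, abs_of_pos (softInd_pos _ _)]; exact softInd_le_one _ _)
      (by
        rw [ae_restrict_iff' mX]
        refine Filter.Eventually.of_forall fun g hg => ?_
        obtain ⟨i, hi⟩ := hg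
        exact softInd_tendsto_zero (X g) i hi)
    simpa using this
  have lY : Filter.Tendsto (fun n : ℕ => ∫ g in EYᶜ, softInd (n : ℝ) (Y g) ∂(gaussPi Γ))
      Filter.atTop (nhds ((gaussPi Γ).real EYᶜ)) := by
    have := tendsto_integral_of_dominated_convergence (μ := (gaussPi Γ).restrict EYᶜ)
      (F := fun n : ℕ => fun g => softInd (n : ℝ) (Y g)) (f := fun _ => (1 : ℝ)) (fun _ => (1 : ℝ))
      (fun n => (hintY n).aestronglyMeasurable.restrict) (integrable_const _)
      (fun n => Filter.Eventually.of_forall fun g => by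
        rw [Real.norm_eq_abs, abs_of_pos (softInd_pos _ _)]; exact softInd_le_one _ _)
      (by
        rw [ae_restrict_iff' mY.compl]
        refine Filter.Eventually.of_forall fun g hg => ?_
        refine softInd_tendsto_one (Y g) fun i => ?_
        by_contra! h
        exact hg ⟨i, h⟩)
    simpa using this
  have hineq : ∀ n : ℕ, ∫ g in EYᶜ, softInd (n : ℝ) (Y g) ∂(gaussPi Γ)
      ≤ ∫ g in EX, softInd (n : ℝ) (X g) ∂(gaussPi Γ) + (gaussPi Γ).real EXᶜ := by
    intro n
    have h1 : ∫ g in EYᶜ, softInd (n : ℝ) (Y g) ∂(gaussPi Γ)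
        ≤ ∫ g, softInd (n : ℝ) (Y g) ∂(gaussPi Γ) :=
      setIntegral_le_integral (hintY n) (Filter.Eventually.of_forall fun g => (softInd_pos _ _).le)
    have h2 := integral_add_compl mX (hintX n)
    have h3 : ∫ g in EXᶜ, softInd (n : ℝ) (X g) ∂(gaussPi Γ) ≤ (gaussPi Γ).real EXᶜ := by
      have := setIntegral_mono_on (μ := gaussPi Γ) (s := EXᶜ) (hintX n).integrableOn
        (integrable_const (1 : ℝ)).integrableOn mX.compl (fun g _ => softInd_le_one (n : ℝ) (X g))
      simpa using this
    have := hcmp n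
    linarith
  have hfin : (gaussPi Γ).real EYᶜ ≤ 0 + (gaussPi Γ).real EXᶜ :=
    le_of_tendsto_of_tendsto' lY (lX.add tendsto_const_nhds) hineq
  rw [zero_add, probReal_compl_eq_one_sub mX, probReal_compl_eq_one_sub mY] at hfin
  have : (gaussPi Γ).real EX ≤ (gaussPi Γ).real EY := by linarith
  exact (ENNReal.toReal_le_toReal (measure_ne_top _ _) (measure_ne_top _ _)).1 this

theorem sum_prod_bilin {R C : Type*} [Fintype R] [Fintype C] (p p' : R → ℝ) (q q' : C → ℝ) :
    ∑ rc : R × C, p rc.1 * q rc.2 * (p' rc.1 * q' rc.2)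
      = (∑ r, p r * p' r) * ∑ c, q c * q' c := by
  rw [Fintype.sum_prod_type, Finset.sum_mul_sum]
  refine Finset.sum_congr rfl fun r _ => Finset.sum_congr rfl fun c _ => by ring

theorem gordon_bilinear {R C I J : Type*} [Fintype R] [Fintype C] [Fintype I] [Fintype J]
    [Nonempty J] (p : I × J → R → ℝ) (q : I × J → C → ℝ)
    (hpq : ∀ a b, a.1 = b.1 → p a = p b ∨ q a = q b) (ψ : I × J → ℝ) (e : ℝ) (he : e ^ 2 = 1) :
    (gaussPi (R × C)) {G | ∃ i, ∀ j, ψ (i, j) + ∑ rc : R × C, p (i, j) rc.1 * q (i, j) rc.2 * G rc < 0}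
      ≤ 2 * (gaussPi (R ⊕ C)) {g | ∃ i, ∀ j, ψ (i, j) + (nrm (q (i, j)) * ∑ r, p (i, j) r * g (Sum.inl r)
        + e * nrm (p (i, j)) * ∑ c, q (i, j) c * g (Sum.inr c)) ≤ 0} := by
  classical
  let Γ := (R × C) ⊕ (Unit ⊕ (R ⊕ C))
  let L : I × J → Γ → ℝ := fun a => Sum.elim (fun rc => p a rc.1 * q a rc.2)
    (Sum.elim (fun _ => nrm (p a) * nrm (q a)) (fun _ => 0))
  let M : I × J → Γ → ℝ := fun a => Sum.elim (fun _ => 0) (Sum.elim (fun _ => 0)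
    (Sum.elim (fun r => nrm (q a) * p a r) (fun c => e * nrm (p a) * q a c)))
  have hLL : ∀ a b, ∑ c, L a c * L b c = (∑ r, p a r * p b r) * (∑ c, q a c * q b c)
      + nrm (p a) * nrm (q a) * (nrm (p b) * nrm (q b)) := by
    intro a b
    simp [L, Γ, Fintype.sum_sum_type, sum_prod_bilin]
  have hMM : ∀ a b, ∑ c, M a c * M b c = nrm (q a) * nrm (q b) * (∑ r, p a r * p b r)
      + nrm (p a) * nrm (p b) * (∑ c, q a c * q b c) := by
    intro a b
    simp only [M, Γ, Fintype.sum_sum_type, Sum.elim_inl, Sum.elim_inr, mul_zero, Finset.sum_const_zero,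
      zero_add, Finset.mul_sum]
    congr 1
    · exact Finset.sum_congr rfl fun r _ => by ring
    · refine Finset.sum_congr rfl fun c _ => ?_
      linear_combination (nrm (p a) * q a c * (nrm (p b) * q b c)) * he
  have hkey : ∀ a b, ∑ c, L a c * L b c - ∑ c, M a c * M b c
      = (nrm (p a) * nrm (p b) - ∑ r, p a r * p b r) * (nrm (q a) * nrm (q b) - ∑ c, q a c * q b c) := by
    intro a b
    rw [hLL, hMM]; ring
  have hG := gordon_comparison L M
    (fun a b => by simp [L, M, Γ, Fintype.sum_sum_type]) ψ
    (fun a b hab => by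
      have := hkey a b
      rcases hpq a b hab with h | h
      · rw [h] at this
        have h0 : nrm (p b) * nrm (p b) - ∑ r, p b r * p b r = 0 := by
          have := nrm_sq (p b)
          simp only [pow_two] at this
          linarith
        rw [h0] at this
        linarith
      · rw [h] at this
        have h0 : nrm (q b) * nrm (q b) - ∑ r, q b r * q b r = 0 := by
          have := nrm_sq (q b)
          simp only [pow_two] at this
          linarith
        rw [h0] at this
        linarith)
    (fun a b => by
      have := hkey a b
      have h2 := mul_nonneg (sub_nonneg.2 (sum_mul_le_nrm (p a) (p b)))
        (sub_nonneg.2 (sum_mul_le_nrm (q a) (q b)))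
      linarith)
  -- the right-hand event depends only on the last coordinates
  have hR := gaussPi_reindex (ι := Γ) (fun c : R ⊕ C => Sum.inr (Sum.inr c))
    (fun a b h => Sum.inr.inj (Sum.inr.inj h))
  have mR : MeasurableSet {g : R ⊕ C → ℝ | ∃ i, ∀ j, ψ (i, j) + (nrm (q (i, j)) * ∑ r, p (i, j) r * g (Sum.inl r)
        + e * nrm (p (i, j)) * ∑ c, q (i, j) c * g (Sum.inr c)) ≤ 0} := by
    simp only [Set.ofPred_exists, Set.ofPred_forall]
    refine MeasurableSet.iUnion fun i => MeasurableSet.iInter fun j => ?_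
    exact measurableSet_le (by fun_prop) (by fun_prop)
  have hL := gaussPi_reindex (ι := Γ) (fun c : R × C => Sum.inl c)
    (fun a b h => Sum.inl.inj h)
  have mL : MeasurableSet {G : R × C → ℝ | ∃ i, ∀ j, ψ (i, j) + ∑ rc : R × C, p (i, j) rc.1 * q (i, j) rc.2 * G rc < 0} := by
    simp only [Set.ofPred_exists, Set.ofPred_forall]
    refine MeasurableSet.iUnion fun i => MeasurableSet.iInter fun j => ?_
    exact measurableSet_lt (by fun_prop) (by fun_prop)
  rw [← hR.measure_preimage mR.nullMeasurableSet, ← hL.measure_preimage mL.nullMeasurableSet]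
  set E : Set (Γ → ℝ) := (fun (x : Γ → ℝ) (c : R × C) => x (Sum.inl c)) ⁻¹' {G : R × C → ℝ | ∃ i, ∀ j, ψ (i, j) + ∑ rc : R × C, p (i, j) rc.1 * q (i, j) rc.2 * G rc < 0} with hE
  have mE : MeasurableSet E := hL.measurable mL
  let c0 : Γ := Sum.inr (Sum.inl ())
  have hflip := gaussPi_flip (ι := Γ) c0
  have hsub1 : E ⊆ (E ∩ {x | x c0 ≤ 0}) ∪ (fun x : Γ → ℝ => fun i => if i = c0 then - x i else x i) ⁻¹' (E ∩ {x | x c0 ≤ 0}) := by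
    intro x hx
    rcases le_total (x c0) 0 with h | h
    · exact Or.inl ⟨hx, h⟩
    · refine Or.inr ⟨?_, by simpa using h⟩
      simpa [hE, c0] using hx
  have mE0 : MeasurableSet (E ∩ {x | x c0 ≤ 0}) :=
    mE.inter (measurableSet_le (measurable_pi_apply _) measurable_const)
  have h1 : (gaussPi Γ) E ≤ 2 * (gaussPi Γ) (E ∩ {x | x c0 ≤ 0}) := by
    refine (measure_mono hsub1).trans ((measure_union_le _ _).trans ?_)
    rw [hflip.measure_preimage mE0.nullMeasurableSet, two_mul]
  refine h1.trans (mul_le_mul_right ((measure_mono ?_).trans (hG.trans (measure_mono ?_))) _)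
  · rintro x ⟨⟨i, hi⟩, hx⟩
    refine ⟨i, fun j => ?_⟩
    have := hi j
    simp only [L, Γ, Fintype.sum_sum_type, Sum.elim_inl, Sum.elim_inr, Finset.univ_unique,
      Finset.sum_singleton, zero_mul, Finset.sum_const_zero, add_zero]
    have hx' : nrm (p (i, j)) * nrm (q (i, j)) * x (Sum.inr (Sum.inl ())) ≤ 0 :=
      mul_nonpos_of_nonneg_of_nonpos (mul_nonneg (nrm_nonneg _) (nrm_nonneg _)) hx
    simp only at this
    linarith
  · rintro x ⟨i, hi⟩
    refine ⟨i, fun j => ?_⟩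
    have := hi j
    simp only [M, Γ, Fintype.sum_sum_type, Sum.elim_inl, Sum.elim_inr, zero_mul,
      Finset.sum_const_zero, zero_add] at this
    simp only [Finset.mul_sum]
    simpa only [mul_assoc] using this

theorem isOpen_forall_lt {W U : Type*} [TopologicalSpace W] [TopologicalSpace U] [CompactSpace U]
    (f : W × U → ℝ) (hf : Continuous f) : IsOpen {w | ∀ u, f (w, u) < 0} := by
  have h : IsClosed {x : W × U | 0 ≤ f x} := isClosed_le continuous_const hf
  have h2 := isClosedMap_fst_of_compactSpace (X := W) (Y := U) _ h
  have : {w | ∀ u, f (w, u) < 0} = (Prod.fst '' {x : W × U | 0 ≤ f x})ᶜ := by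
    ext w
    simp
  rw [this]
  exact h2.isOpen_compl

theorem gordon_compact {R C W U : Type*} [Fintype R] [Fintype C] [TopologicalSpace W]
    [TopologicalSpace.SeparableSpace W] [TopologicalSpace U] [CompactSpace U]
    [TopologicalSpace.SeparableSpace U] [Nonempty U]
    (p : W × U → R → ℝ) (q : W × U → C → ℝ) (ψ : W × U → ℝ)
    (hp : Continuous p) (hq : Continuous q) (hψ : Continuous ψ)
    (hpq : ∀ a b, a.1 = b.1 → p a = p b ∨ q a = q b) (e : ℝ) (he : e ^ 2 = 1) :
    (gaussPi (R × C)) {G | ∃ w, ∀ u, ψ (w, u) + ∑ rc : R × C, p (w, u) rc.1 * q (w, u) rc.2 * G rc < 0}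
      ≤ 2 * (gaussPi (R ⊕ C)) {g | ∃ w, ∀ u, ψ (w, u) + (nrm (q (w, u)) * ∑ r, p (w, u) r * g (Sum.inl r)
        + e * nrm (p (w, u)) * ∑ c, q (w, u) c * g (Sum.inr c)) ≤ 0} := by
  rcases isEmpty_or_nonempty W with hW | hW
  · simp
  let ws := TopologicalSpace.denseSeq W
  let us := TopologicalSpace.denseSeq U
  have hws : DenseRange ws := TopologicalSpace.denseRange_denseSeq W
  have hus : DenseRange us := TopologicalSpace.denseRange_denseSeq U
  have hp' : ∀ r, Continuous fun x => p x r := fun r => (continuous_apply r).comp hp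
  have hq' : ∀ c, Continuous fun x => q x c := fun c => (continuous_apply c).comp hq
  let E : ℕ → Set (R × C → ℝ) := fun n => {G | ∃ i : Fin (n + 1), ∀ u,
    ψ (ws i, u) + ∑ rc : R × C, p (ws i, u) rc.1 * q (ws i, u) rc.2 * G rc < 0}
  let F : ℕ → ℕ → Set (R ⊕ C → ℝ) := fun n m => {g | ∃ i : Fin (n + 1), ∀ j : Fin (m + 1),
    ψ (ws i, us j) + (nrm (q (ws i, us j)) * ∑ r, p (ws i, us j) r * g (Sum.inl r)
        + e * nrm (p (ws i, us j)) * ∑ c, q (ws i, us j) c * g (Sum.inr c)) ≤ 0}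
  have hEmono : Monotone E := by
    rintro n n' hn G ⟨i, hi⟩
    exact ⟨Fin.castLE (by omega) i, hi⟩
  have hFanti : ∀ n, Antitone (F n) := by
    rintro n m m' hm g ⟨i, hi⟩
    exact ⟨i, fun j => hi (Fin.castLE (by omega) j)⟩
  have hFm : ∀ n m, MeasurableSet (F n m) := by
    intro n m
    simp only [F, Set.ofPred_exists, Set.ofPred_forall]
    refine MeasurableSet.iUnion fun i => MeasurableSet.iInter fun j => ?_
    exact measurableSet_le (by fun_prop) (by fun_prop)
  have hEF : ∀ n m, (gaussPi (R × C)) (E n) ≤ 2 * (gaussPi (R ⊕ C)) (F n m) := by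
    intro n m
    refine le_trans (measure_mono ?_) (gordon_bilinear (I := Fin (n + 1)) (J := Fin (m + 1))
      (fun x => p (ws x.1, us x.2)) (fun x => q (ws x.1, us x.2))
      (fun a b hab => hpq _ _ (by simp only; rw [hab])) (fun x => ψ (ws x.1, us x.2)) e he)
    rintro G ⟨i, hi⟩
    exact ⟨i, fun j => hi _⟩
  set RHS := {g : R ⊕ C → ℝ | ∃ w, ∀ u, ψ (w, u) + (nrm (q (w, u)) * ∑ r, p (w, u) r * g (Sum.inl r)
        + e * nrm (p (w, u)) * ∑ c, q (w, u) c * g (Sum.inr c)) ≤ 0} with hRHS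
  have hE : ∀ n, (gaussPi (R × C)) (E n) ≤ 2 * (gaussPi (R ⊕ C)) RHS := by
    intro n
    have ht := tendsto_measure_iInter_atTop (μ := gaussPi (R ⊕ C))
      (fun m => (hFm n m).nullMeasurableSet) (hFanti n) ⟨0, measure_ne_top _ _⟩
    have ht2 := ENNReal.Tendsto.const_mul (a := 2) ht (Or.inr (by simp))
    refine (ge_of_tendsto' ht2 (hEF n)).trans (mul_le_mul_right (measure_mono ?_) _)
    intro g hg
    have hg' : ∀ m, g ∈ F n m := fun m => Set.mem_iInter.1 hg m
    have : ∃ i : Fin (n + 1), ∀ j : ℕ, ψ (ws i, us j) + (nrm (q (ws i, us j)) *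
        ∑ r, p (ws i, us j) r * g (Sum.inl r)
        + e * nrm (p (ws i, us j)) * ∑ c, q (ws i, us j) c * g (Sum.inr c)) ≤ 0 := by
      by_contra! hcon
      choose jj hjj using hcon
      obtain ⟨i, hi⟩ := hg' (Finset.univ.sup jj)
      have h1 : jj i < Finset.univ.sup jj + 1 :=
        Nat.lt_succ_of_le (Finset.le_sup (f := jj) (Finset.mem_univ i))
      have := hi ⟨jj i, h1⟩
      exact absurd this (not_le.2 (hjj i))
    obtain ⟨i, hi⟩ := this
    refine ⟨ws i, fun u => ?_⟩
    have hcl : IsClosed {u : U | ψ (ws i, u) + (nrm (q (ws i, u)) *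
        ∑ r, p (ws i, u) r * g (Sum.inl r)
        + e * nrm (p (ws i, u)) * ∑ c, q (ws i, u) c * g (Sum.inr c)) ≤ 0} := by
      have hc : Continuous fun u : U => ((ws i, u) : W × U) := by fun_prop
      have hp2 : ∀ r, Continuous fun u => p (ws i, u) r := fun r => (hp' r).comp hc
      have hq2 : ∀ r, Continuous fun u => q (ws i, u) r := fun r => (hq' r).comp hc
      refine isClosed_le ?_ continuous_const
      unfold nrm
      have := hψ.comp hc
      fun_prop
    exact hus.induction_on u hcl hi
  have hsub : {G | ∃ w, ∀ u, ψ (w, u) + ∑ rc : R × C, p (w, u) rc.1 * q (w, u) rc.2 * G rc < 0}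
      ⊆ ⋃ n, E n := by
    rintro G ⟨w, hw⟩
    have ho := isOpen_forall_lt (W := W) (U := U)
      (fun x => ψ x + ∑ rc : R × C, p x rc.1 * q x rc.2 * G rc) (by fun_prop)
    obtain ⟨n, hn⟩ := hws.exists_mem_open ho ⟨w, hw⟩
    exact Set.mem_iUnion.2 ⟨n, ⟨n, by omega⟩, hn⟩
  refine (measure_mono hsub).trans ?_
  rw [hEmono.measure_iUnion]
  exact iSup_le hE

/-- The rescaled design together with the noise, as one array. -/
def modelArray (k m N : ℕ)
    (ω : ((Fin k × Fin m) → Fin N → ℝ) × ((Fin k × Fin m) → ℝ)) :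
    (Fin k × Fin m) × Option (Fin N) → ℝ := fun rc =>
  rc.2.elim (ω.2 rc.1) (fun j => Real.sqrt ((k * m : ℕ) : ℝ) * ω.1 rc.1 j)

theorem modelArray_measurePreserving (k m N : ℕ) (hn : 0 < k * m) :
    MeasurePreserving (modelArray k m N) (PmodelCV k m N)
      (gaussPi ((Fin k × Fin m) × Option (Fin N))) := by
  have hm : Measurable (modelArray k m N) := by
    refine measurable_pi_iff.mpr fun rc => ?_
    rcases rc with ⟨r, _ | j⟩
    · simp only [modelArray, Option.elim]; fun_prop
    · simp only [modelArray, Option.elim]; fun_prop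
  refine ⟨hm, ?_⟩
  symm
  refine Measure.pi_eq fun s hs => ?_
  rw [Measure.map_apply hm (MeasurableSet.univ_pi hs)]
  have h1 : modelArray k m N ⁻¹' Set.univ.pi s =
      (Set.univ.pi fun r => Set.univ.pi fun j =>
        (fun x => Real.sqrt ((k * m : ℕ) : ℝ) * x) ⁻¹' s (r, some j)) ×ˢ
      (Set.univ.pi fun r => s (r, none)) := by
    ext ω
    simp only [Set.mem_preimage, Set.mem_pi, Set.mem_univ, true_imp_iff, Set.mem_prod, Prod.forall,
      Option.forall, modelArray, Option.elim]
    constructor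
    · exact fun h => ⟨fun a b j => (h a b).2 j, fun a b => (h a b).1⟩
    · exact fun h a b => ⟨h.2 a b, fun j => h.1 a b j⟩
  have h2 : ∀ t : Set ℝ, MeasurableSet t →
      (gaussianReal 0 (((k * m : ℕ) : ℝ≥0))⁻¹) ((fun x => Real.sqrt ((k * m : ℕ) : ℝ) * x) ⁻¹' t)
        = gaussianReal 0 1 t := by
    intro t ht
    rw [← Measure.map_apply (by fun_prop) ht, gaussianReal_map_const_mul]
    congr 2
    · simp
    · have hpos : (0 : ℝ) < ((k * m : ℕ) : ℝ) := by exact_mod_cast hn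
      ext
      simp only [NNReal.coe_mul, NNReal.coe_mk, NNReal.coe_inv, NNReal.coe_natCast, NNReal.coe_one]
      rw [Real.sq_sqrt hpos.le, mul_inv_cancel₀ hpos.ne']
  rw [h1, PmodelCV, PXcv, Pzcv, Measure.prod_prod, Measure.pi_pi, Measure.pi_pi]
  simp only [Measure.pi_pi]
  rw [Fintype.prod_prod_type (f := fun rc : (Fin k × Fin m) × Option (Fin N) => (gaussianReal 0 1) (s rc)),
    ← Finset.prod_mul_distrib]
  refine Finset.prod_congr rfl fun r _ => ?_
  rw [Fintype.prod_option, mul_comm]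
  congr 1
  exact Finset.prod_congr rfl fun j _ => h2 _ (hs _)

theorem PmodelCV_le (k m N : ℕ) (hn : 0 < k * m)
    (S : Set (((Fin k × Fin m) → Fin N → ℝ) × ((Fin k × Fin m) → ℝ)))
    (T : Set ((Fin k × Fin m) × Option (Fin N) → ℝ)) (h : ∀ ω ∈ S, modelArray k m N ω ∈ T) :
    PmodelCV k m N S ≤ gaussPi ((Fin k × Fin m) × Option (Fin N)) T := by
  have hp := modelArray_measurePreserving k m N hn
  refine (measure_mono (t := modelArray k m N ⁻¹' T) h).trans ?_
  rw [← hp.map_eq]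
  exact Measure.le_map_apply hp.measurable.aemeasurable T

theorem integrable_stdGaussian_iff (g : ℝ → ℝ) : Integrable g (gaussianReal 0 1) ↔
    Integrable (fun x => g x * gaussianPDFReal 0 1 x) := by
  rw [gaussianReal_of_var_ne_zero _ one_ne_zero]
  unfold gaussianPDF
  rw [integrable_withDensity_iff_integrable_smul' (by fun_prop) (by simp)]
  refine integrable_congr (Filter.Eventually.of_forall fun x => ?_)
  simp [ENNReal.toReal_ofReal (gaussianPDFReal_nonneg 0 1 x), mul_comm]

theorem integrable_exp_sq_stdGaussian :
    Integrable (fun x : ℝ => Real.exp ((3 + x ^ 2) / 4)) (gaussianReal 0 1) := by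
  rw [integrable_stdGaussian_iff]
  have h := (integrable_exp_neg_mul_sq (b := 1 / 4) (by norm_num)).const_mul
    (Real.exp (3 / 4) * (Real.sqrt (2 * Real.pi))⁻¹)
  refine h.congr (Filter.Eventually.of_forall fun x => ?_)
  simp only [gaussianPDFReal, NNReal.coe_one, mul_one, sub_zero]
  have : Real.exp ((3 + x ^ 2) / 4) * ((Real.sqrt (2 * Real.pi))⁻¹ * Real.exp (-x ^ 2 / 2))
    = (Real.sqrt (2 * Real.pi))⁻¹ * (Real.exp ((3 + x ^ 2) / 4) * Real.exp (-x ^ 2 / 2)) := by ring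
  rw [this, ← Real.exp_add]
  have h2 : Real.exp (3 / 4) * (Real.sqrt (2 * Real.pi))⁻¹ * Real.exp (-(1 / 4) * x ^ 2)
    = (Real.sqrt (2 * Real.pi))⁻¹ * (Real.exp (3 / 4) * Real.exp (-(1 / 4) * x ^ 2)) := by ring
  rw [h2, ← Real.exp_add]
  congr 2
  ring

theorem integrable_of_le_one_add_sq {f : ℝ → ℝ} {K : ℝ} (hfm : Measurable f)
    (hf : ∀ x, |f x| ≤ K * (1 + x ^ 2)) : Integrable f (gaussianReal 0 1) :=
  (((integrable_const (1 : ℝ)).add integrable_sq_stdGaussian).const_mul K |>.mono' hfm.aestronglyMeasurable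
    (Filter.Eventually.of_forall hf))

theorem integral_sq_stdGaussian : ∫ x, x ^ 2 ∂(gaussianReal 0 1) = 1 := by
  have h := variance_id_gaussianReal (μ := 0) (v := 1)
  rw [variance_eq_integral (by fun_prop)] at h
  simpa using h

theorem exp_le_quad (x : ℝ) : Real.exp x ≤ 1 + x + x ^ 2 * Real.exp |x| := by
  have h : ∀ y : ℝ, 0 ≤ y → Real.exp y ≤ 1 + y + y ^ 2 * Real.exp y := by
    intro y hy
    have h1 : 1 - y ≤ Real.exp (-y) := by have := Real.add_one_le_exp (-y); linarith
    have h3 : Real.exp (-y) * Real.exp y = 1 := by rw [← Real.exp_add]; simp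
    have h2 : (1 - y) * Real.exp y ≤ 1 := by
      calc (1 - y) * Real.exp y ≤ Real.exp (-y) * Real.exp y :=
            mul_le_mul_of_nonneg_right h1 (Real.exp_pos y).le
        _ = 1 := h3
    nlinarith [Real.exp_pos y]
  rcases le_total 0 x with hx | hx
  · rw [abs_of_nonneg hx]; exact h x hx
  · rw [abs_of_nonpos hx]
    have hy : 0 ≤ -x := by linarith
    have h1 : 1 - x ≤ Real.exp (-x) := by have := Real.add_one_le_exp (-x); linarith
    have h4 : Real.exp x * Real.exp (-x) = 1 := by rw [← Real.exp_add]; simp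
    have h5 : Real.exp x * (1 - x) ≤ 1 := by
      calc Real.exp x * (1 - x) ≤ Real.exp x * Real.exp (-x) :=
            mul_le_mul_of_nonneg_left h1 (Real.exp_pos x).le
        _ = 1 := h4
    have h6 : 1 ≤ Real.exp (-x) := Real.one_le_exp hy
    have h7 : Real.exp x ≤ 1 + x + x ^ 2 := by
      have h8 : (1 + x + x ^ 2) * (1 - x) ≥ 1 := by nlinarith [pow_nonneg hy 3]
      have h9 : 0 < 1 - x := by linarith
      nlinarith
    nlinarith [sq_nonneg x]

/-- Constant for the moment generating function bound. -/
def concB (K : ℝ) : ℝ := K ^ 2 * (128 * ∫ x, Real.exp ((3 + x ^ 2) / 4) ∂(gaussianReal 0 1))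

theorem mgf_stdGaussian_bound {f : ℝ → ℝ} {K s : ℝ} (hK : 0 < K) (hfm : Measurable f)
    (hf : ∀ x, |f x| ≤ K * (1 + x ^ 2)) (hs : 0 ≤ s) (hsK : s * K ≤ 1 / 8) :
    Integrable (fun x => Real.exp (s * (f x - ∫ y, f y ∂(gaussianReal 0 1)))) (gaussianReal 0 1) ∧
    ∫ x, Real.exp (s * (f x - ∫ y, f y ∂(gaussianReal 0 1))) ∂(gaussianReal 0 1)
      ≤ Real.exp (concB K * s ^ 2) := by
  set E := ∫ y, f y ∂(gaussianReal 0 1) with hE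
  have hfi := integrable_of_le_one_add_sq hfm hf
  have hEb : |E| ≤ 2 * K := by
    have h1 : |E| ≤ ∫ x, K * (1 + x ^ 2) ∂(gaussianReal 0 1) := by
      refine (abs_integral_le_integral_abs).trans (integral_mono hfi.abs ?_ hf)
      exact ((integrable_const (1 : ℝ)).add integrable_sq_stdGaussian).const_mul K
    rw [integral_const_mul, integral_add (integrable_const _) integrable_sq_stdGaussian,
      integral_sq_stdGaussian] at h1
    simp at h1
    linarith
  have hY : ∀ x, |f x - E| ≤ K * (3 + x ^ 2) := by
    intro x
    have := abs_sub (f x) E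
    have := hf x
    nlinarith
  have hpt : ∀ x, Real.exp (s * (f x - E)) ≤ 1 + s * (f x - E)
      + s ^ 2 * (K ^ 2 * (128 * Real.exp ((3 + x ^ 2) / 4))) := by
    intro x
    refine (exp_le_quad _).trans ?_
    refine add_le_add le_rfl ?_
    have ha : |s * (f x - E)| ≤ (3 + x ^ 2) / 8 := by
      rw [abs_mul, abs_of_nonneg hs]
      calc s * |f x - E| ≤ s * (K * (3 + x ^ 2)) := mul_le_mul_of_nonneg_left (hY x) hs
        _ = (s * K) * (3 + x ^ 2) := by ring
        _ ≤ 1 / 8 * (3 + x ^ 2) := mul_le_mul_of_nonneg_right hsK (by positivity)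
        _ = _ := by ring
    have hb : (s * (f x - E)) ^ 2 ≤ s ^ 2 * (K ^ 2 * (3 + x ^ 2) ^ 2) := by
      rw [mul_pow, ← mul_pow K]
      refine mul_le_mul_of_nonneg_left ?_ (sq_nonneg s)
      rw [← sq_abs]
      exact pow_le_pow_left₀ (abs_nonneg _) (hY x) 2
    have hc : (3 + x ^ 2) ^ 2 ≤ 128 * Real.exp ((3 + x ^ 2) / 8) := by
      have hpos : 0 ≤ (3 + x ^ 2) / 8 := by positivity
      have := Real.quadratic_le_exp_of_nonneg hpos
      nlinarith
    calc _ ≤ s ^ 2 * (K ^ 2 * (128 * Real.exp ((3 + x ^ 2) / 8))) * Real.exp ((3 + x ^ 2) / 8) := by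
          refine mul_le_mul (hb.trans ?_) (Real.exp_le_exp.2 ha) (Real.exp_pos _).le (by positivity)
          gcongr
      _ = s ^ 2 * (K ^ 2 * (128 * (Real.exp ((3 + x ^ 2) / 8) * Real.exp ((3 + x ^ 2) / 8)))) := by ring
      _ = _ := by
          rw [← Real.exp_add]
          congr 5
          ring
  have hintg : Integrable (fun x => 1 + s * (f x - E)
      + s ^ 2 * (K ^ 2 * (128 * Real.exp ((3 + x ^ 2) / 4)))) (gaussianReal 0 1) :=
    ((integrable_const (1 : ℝ)).add ((hfi.sub (integrable_const E)).const_mul s)).add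
      (((integrable_exp_sq_stdGaussian.const_mul 128).const_mul _).const_mul _)
  have hintg2 : Integrable (fun x => Real.exp (s * (f x - E))) (gaussianReal 0 1) := by
    refine hintg.mono' (by fun_prop) (Filter.Eventually.of_forall fun x => ?_)
    rw [Real.norm_eq_abs, abs_of_pos (Real.exp_pos _)]
    exact hpt x
  refine ⟨hintg2, (integral_mono hintg2 hintg hpt).trans ?_⟩
  rw [integral_add, integral_add, integral_const_mul, integral_sub hfi (integrable_const E),
    integral_const_mul, integral_const_mul, integral_const_mul]
  · have := Real.add_one_le_exp (concB K * s ^ 2)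
    simp only [concB] at this ⊢
    simp [← hE]
    linarith
  · exact integrable_const _
  · exact (hfi.sub (integrable_const E)).const_mul s
  · exact (integrable_const (1 : ℝ)).add ((hfi.sub (integrable_const E)).const_mul s)
  · exact (((integrable_exp_sq_stdGaussian.const_mul 128).const_mul _).const_mul _)

theorem gaussPi_concentration (K : ℝ) (hK : 0 < K) : ∃ c : ℝ, 0 < c ∧
    ∀ (ι : Type) [Fintype ι] (f : ι → ℝ → ℝ) (M ε : ℝ), (∀ j, Measurable (f j)) →
      (∀ j x, |f j x| ≤ K * (1 + x ^ 2)) → (Fintype.card ι : ℝ) ≤ M → 0 ≤ ε → ε ≤ 1 →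
      (gaussPi ι) {h | ε * M ≤ ∑ j, (f j (h j) - ∫ y, f j y ∂(gaussianReal 0 1))}
        ≤ ENNReal.ofReal (Real.exp (- c * M * ε ^ 2)) := by
  have hB : 0 ≤ concB K := by
    unfold concB
    refine mul_nonneg (sq_nonneg _) (mul_nonneg (by norm_num) ?_)
    exact integral_nonneg fun x => (Real.exp_pos _).le
  let s1 : ℝ := min (1 / (8 * K)) (1 / (2 * (concB K + 1)))
  have hs1 : 0 < s1 := lt_min (by positivity) (by positivity)
  refine ⟨s1 / 2, by positivity, fun ι _ f M ε hfm hf hM hε hε1 => ?_⟩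
  set s := s1 * ε with hs
  have hs0 : 0 ≤ s := by positivity
  have hsK : s * K ≤ 1 / 8 := by
    have h1 : s1 ≤ 1 / (8 * K) := min_le_left _ _
    have h2 : s ≤ 1 / (8 * K) := by nlinarith
    calc s * K ≤ 1 / (8 * K) * K := mul_le_mul_of_nonneg_right h2 hK.le
      _ = 1 / 8 := by field_simp
  have hmg := fun j => mgf_stdGaussian_bound hK (hfm j) (hf j) hs0 hsK
  let Y : (ι → ℝ) → ℝ := fun h => ∑ j, (f j (h j) - ∫ y, f j y ∂(gaussianReal 0 1))
  have hexp : ∀ h, Real.exp (s * Y h)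
      = ∏ j, Real.exp (s * (f j (h j) - ∫ y, f j y ∂(gaussianReal 0 1))) := by
    intro h
    rw [← Real.exp_sum, Finset.mul_sum]
  have hi : Integrable (fun h => Real.exp (s * Y h)) (gaussPi ι) := by
    simp only [hexp]
    exact Integrable.fintype_prod (fun j => (hmg j).1)
  have h1 := measure_ge_le_exp_mul_mgf (X := Y) (μ := gaussPi ι) (t := s) (ε * M) hs0 hi
  have h2 : mgf Y (gaussPi ι) s ≤ Real.exp (concB K * s ^ 2 * M) := by
    unfold mgf
    simp only [hexp]
    rw [gaussPi, integral_fintype_prod_eq_prod (μ := fun _ : ι => gaussianReal 0 1)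
      (f := fun j x => Real.exp (s * (f j x - ∫ y, f j y ∂(gaussianReal 0 1))))]
    calc _ ≤ ∏ _j : ι, Real.exp (concB K * s ^ 2) :=
          Finset.prod_le_prod (fun j _ => integral_nonneg fun x => (Real.exp_pos _).le)
            fun j _ => (hmg j).2
      _ = Real.exp (concB K * s ^ 2 * Fintype.card ι) := by
          rw [Finset.prod_const, ← Real.exp_nat_mul, Finset.card_univ, mul_comm]
      _ ≤ _ := Real.exp_le_exp.2 (mul_le_mul_of_nonneg_left hM (by positivity))
  have hM0 : 0 ≤ M := (Nat.cast_nonneg _).trans hM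
  have h3 : (gaussPi ι).real {h | ε * M ≤ Y h} ≤ Real.exp (- (s1 / 2) * M * ε ^ 2) := by
    refine h1.trans ((mul_le_mul_of_nonneg_left h2 (Real.exp_pos _).le).trans ?_)
    rw [← Real.exp_add]
    refine Real.exp_le_exp.2 ?_
    have h4 : concB K * s1 ≤ 1 / 2 := by
      have h5 : s1 ≤ 1 / (2 * (concB K + 1)) := min_le_right _ _
      calc concB K * s1 ≤ concB K * (1 / (2 * (concB K + 1))) := mul_le_mul_of_nonneg_left h5 hB
        _ ≤ 1 / 2 := by
          rw [mul_one_div, div_le_div_iff₀ (by positivity) (by norm_num)]; linarith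
    have h6 : concB K * s ^ 2 * M = (concB K * s1) * (s1 * ε ^ 2 * M) := by rw [hs]; ring
    have h7 : 0 ≤ s1 * ε ^ 2 * M := by positivity
    rw [h6, hs]
    nlinarith
  rw [Measure.real] at h3
  exact (ENNReal.le_ofReal_iff_toReal_le (measure_ne_top _ _) (Real.exp_pos _).le).2 h3

theorem stdGaussian_tail (t : ℝ) (ht : 0 ≤ t) :
    (gaussianReal 0 1) {x | t ≤ |x|} ≤ ENNReal.ofReal (2 * Real.exp (- t ^ 2 / 2)) := by
  have h1 : (gaussianReal 0 1) {x | t ≤ x} ≤ ENNReal.ofReal (Real.exp (- t ^ 2 / 2)) := by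
    have h := measure_ge_le_exp_mul_mgf (X := id) (μ := gaussianReal 0 1) (t := t) t ht
      (by simpa using! integrable_exp_mul_gaussianReal (μ := 0) (v := 1) t)
    rw [mgf_id_gaussianReal, ← Real.exp_add] at h
    refine (ENNReal.le_ofReal_iff_toReal_le (measure_ne_top _ _) (Real.exp_pos _).le).2 ?_
    refine h.trans (Real.exp_le_exp.2 ?_)
    simp
    nlinarith
  have h2 : (gaussianReal 0 1) {x | t ≤ -x} ≤ ENNReal.ofReal (Real.exp (- t ^ 2 / 2)) := by
    have hn := gaussianReal_map_neg (μ := 0) (v := 1)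
    rw [neg_zero] at hn
    have : (gaussianReal 0 1) {x | t ≤ -x} = (gaussianReal 0 1) {x | t ≤ x} := by
      conv_rhs => rw [← hn]
      rw [Measure.map_apply (by fun_prop)
        (measurableSet_le measurable_const measurable_id : MeasurableSet {x : ℝ | t ≤ x})]
      rfl
    rw [this]; exact h1
  have h3 : {x : ℝ | t ≤ |x|} ⊆ {x | t ≤ x} ∪ {x | t ≤ -x} := by
    intro x hx
    rcases le_abs.1 (show t ≤ |x| from hx) with h | h
    · exact Or.inl h
    · exact Or.inr h
  refine (measure_mono h3).trans ((measure_union_le _ _).trans ((add_le_add h1 h2).trans ?_))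
  rw [← ENNReal.ofReal_add (Real.exp_pos _).le (Real.exp_pos _).le, two_mul]

/-- Soft thresholding at level `c`. -/
def softT (c x : ℝ) : ℝ := max (x - c) 0 + min (x + c) 0

theorem softT_cases {c : ℝ} (hc : 0 ≤ c) (x : ℝ) :
    (c ≤ x ∧ softT c x = x - c) ∨ (x ≤ -c ∧ softT c x = x + c) ∨
      (|x| ≤ c ∧ softT c x = 0) := by
  unfold softT
  rcases le_total c x with h | h
  · left
    rw [max_eq_left (by linarith), min_eq_right (by linarith)]
    exact ⟨h, by ring⟩
  · rcases le_total x (-c) with h' | h'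
    · right; left
      rw [max_eq_right (by linarith), min_eq_left (by linarith)]
      exact ⟨h', by ring⟩
    · right; right
      rw [max_eq_right (by linarith), min_eq_right (by linarith), abs_le]
      exact ⟨⟨h', h⟩, by ring⟩

theorem softT_eq_zero {c x : ℝ} (h : |x| ≤ c) : softT c x = 0 := by
  obtain ⟨h1, h2⟩ := abs_le.1 h
  unfold softT
  rw [max_eq_right (by linarith), min_eq_right (by linarith), add_zero]

theorem softT_prox {c : ℝ} (hc : 0 ≤ c) (x y : ℝ) :
    (x - softT c x) * (y - softT c x) ≤ c * (|y| - |softT c x|) := by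
  have hy1 := le_abs_self y
  have hy2 := neg_abs_le y
  rcases softT_cases hc x with ⟨h, e⟩ | ⟨h, e⟩ | ⟨h, e⟩
  · rw [e, abs_of_nonneg (show 0 ≤ x - c by linarith)]
    nlinarith
  · rw [e, abs_of_nonpos (show x + c ≤ 0 by linarith)]
    nlinarith
  · rw [e, abs_zero]
    simp only [sub_zero]
    calc x * y ≤ |x * y| := le_abs_self _
      _ = |x| * |y| := abs_mul _ _
      _ ≤ c * |y| := mul_le_mul_of_nonneg_right h (abs_nonneg _)

theorem abs_softT_sub_le {c : ℝ} (hc : 0 ≤ c) (x : ℝ) : |softT c x - x| ≤ c := by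
  rcases softT_cases hc x with ⟨h, e⟩ | ⟨h, e⟩ | ⟨h, e⟩
  · rw [e, abs_le]; constructor <;> linarith
  · rw [e, abs_le]; constructor <;> linarith
  · rw [e, zero_sub, abs_neg]; exact h

theorem softT_mono (c : ℝ) : Monotone (softT c) := by
  intro x y h
  unfold softT
  gcongr

theorem softT_sub_le {c x y : ℝ} (hc : 0 ≤ c) (h : x ≤ y) : softT c y - softT c x ≤ y - x := by
  have hx := softT_prox hc x (softT c y)
  have hy := softT_prox hc y (softT c x)
  have hm := softT_mono c h
  by_contra hlt
  push Not at hlt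
  nlinarith

theorem continuous_softT (c : ℝ) : Continuous (softT c) := by unfold softT; fun_prop

/-- The minimiser of `w ↦ w²/(2r) + h w + α (|θ + w| - |θ|)`. -/
def optW (α r θ h : ℝ) : ℝ := softT (α * r) (θ - r * h) - θ

theorem continuous_optW (α r θ : ℝ) : Continuous (optW α r θ) := by
  unfold optW
  have := continuous_softT (α * r)
  fun_prop

theorem optW_var {α r : ℝ} (hα : 0 ≤ α) (hr : 0 < r) (θ h w : ℝ) :
    0 ≤ (optW α r θ h / r + h) * (w - optW α r θ h) + α * (|θ + w| - |θ + optW α r θ h|) := by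
  have h1 := softT_prox (mul_nonneg hα hr.le) (θ - r * h) (θ + w)
  have h2 : softT (α * r) (θ - r * h) = θ + optW α r θ h := by unfold optW; ring
  rw [h2] at h1
  set v := optW α r θ h
  have h3 : (v / r + h) * (w - v) + α * (|θ + w| - |θ + v|)
      = (α * r * (|θ + w| - |θ + v|) - (θ - r * h - (θ + v)) * (θ + w - (θ + v))) / r := by
    field_simp; ring
  rw [h3]
  exact div_nonneg (by linarith) hr.le

theorem abs_optW_le {α r : ℝ} (hα : 0 ≤ α) (hr : 0 < r) (θ h : ℝ) :
    |optW α r θ h| ≤ r * (|h| + α) := by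
  have h1 := abs_softT_sub_le (mul_nonneg hα hr.le) (θ - r * h)
  have h2 : softT (α * r) (θ - r * h) - (θ - r * h) = optW α r θ h + r * h := by unfold optW; ring
  rw [h2] at h1
  have h3 : optW α r θ h = (optW α r θ h + r * h) - r * h := by ring
  rw [h3]
  calc _ ≤ |optW α r θ h + r * h| + |r * h| := abs_sub _ _
    _ ≤ α * r + r * |h| := by rw [abs_mul, abs_of_pos hr]; linarith
    _ = _ := by ring

theorem mul_optW_sub {α r : ℝ} (hα : 0 ≤ α) (hr : 0 < r) (θ h : ℝ) :
    h * (optW α r θ h - optW α r θ 0) ≤ 0 ∧ -(r * h ^ 2) ≤ h * (optW α r θ h - optW α r θ 0) := by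
  have hc := mul_nonneg hα hr.le
  have e : optW α r θ h - optW α r θ 0 = softT (α * r) (θ - r * h) - softT (α * r) (θ - r * 0) := by
    unfold optW; ring
  rw [e]
  rcases le_total 0 h with hh | hh
  · have hle : θ - r * h ≤ θ - r * 0 := by nlinarith
    have h1 := softT_mono (α * r) hle
    have h2 := softT_sub_le hc hle
    constructor <;> nlinarith
  · have hle : θ - r * 0 ≤ θ - r * h := by nlinarith
    have h1 := softT_mono (α * r) hle
    have h2 := softT_sub_le hc hle
    constructor <;> nlinarith

/-- Value of the scalar problem `min_w b (w²/(2r) + h w) + Λ (|θ + w| - |θ|)`. -/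
def optM (L b r θ h : ℝ) : ℝ :=
  b * ((optW (L / b) r θ h) ^ 2 / (2 * r) + h * optW (L / b) r θ h)
    + L * (|θ + optW (L / b) r θ h| - |θ|)

theorem continuous_optM (L b r θ : ℝ) : Continuous (optM L b r θ) := by
  unfold optM
  have := continuous_optW (L / b) r θ
  fun_prop

theorem optW_var' {L b r : ℝ} (hL : 0 ≤ L) (hb : 0 < b) (hr : 0 < r) (θ h w : ℝ) :
    0 ≤ b * ((optW (L / b) r θ h / r + h) * (w - optW (L / b) r θ h))
      + L * (|θ + w| - |θ + optW (L / b) r θ h|) := by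
  have h1 := mul_nonneg hb.le (optW_var (div_nonneg hL hb.le) hr θ h w)
  rw [mul_add, ← mul_assoc b (L / b), mul_div_cancel₀ _ hb.ne'] at h1
  exact h1

theorem optM_le {L b r : ℝ} (hL : 0 ≤ L) (hb : 0 < b) (hr : 0 < r) (θ h w : ℝ) :
    optM L b r θ h ≤ b * (w ^ 2 / (2 * r) + h * w) + L * (|θ + w| - |θ|) := by
  have h1 := optW_var' hL hb hr θ h w
  unfold optM
  set v := optW (L / b) r θ h
  have h2 : b * (w ^ 2 / (2 * r) + h * w) + L * (|θ + w| - |θ|)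
      = b * (v ^ 2 / (2 * r) + h * v) + L * (|θ + v| - |θ|)
        + (b * ((v / r + h) * (w - v)) + L * (|θ + w| - |θ + v|)) + b * (w - v) ^ 2 / (2 * r) := by
    field_simp; ring
  rw [h2]
  have : 0 ≤ b * (w - v) ^ 2 / (2 * r) := by positivity
  linarith

theorem optM_nonpos {L b r : ℝ} (hL : 0 ≤ L) (hb : 0 < b) (hr : 0 < r) (θ h : ℝ) :
    optM L b r θ h ≤ 0 := by simpa using optM_le hL hb hr θ h 0

theorem optM_subgrad {L b r s : ℝ} (hL : 0 ≤ L) (hb : 0 < b) (hr : 0 < r) (hs : 0 < s) (θ h : ℝ) :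
    optM L b r θ h - b * (optW (L / b) r θ h) ^ 2 / (2 * r ^ 2) * (s - r) ≤ optM L b s θ h := by
  have h1 := optW_var' hL hb hr θ h (optW (L / b) s θ h)
  unfold optM
  set v := optW (L / b) r θ h
  set w := optW (L / b) s θ h
  have h2 : b * (w ^ 2 / (2 * s) + h * w) + L * (|θ + w| - |θ|)
      = b * (v ^ 2 / (2 * r) + h * v) + L * (|θ + v| - |θ|)
        + (b * ((v / r + h) * (w - v)) + L * (|θ + w| - |θ + v|))
        + b * (w / s - v / r) ^ 2 * s / 2 - b * v ^ 2 / (2 * r ^ 2) * (s - r) := by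
    field_simp; ring
  rw [h2]
  have : 0 ≤ b * (w / s - v / r) ^ 2 * s / 2 := by positivity
  linarith

theorem optM_quad_b {L b c r : ℝ} (hL : 0 ≤ L) (hb : 0 < b) (hc : 0 < c) (hr : 0 < r) (θ h : ℝ) :
    optM L b r θ h + (c - b) * ((optW (L / b) r θ h) ^ 2 / (2 * r) + h * optW (L / b) r θ h)
      - (c - b) ^ 2 * (r * (optW (L / b) r θ h / r + h) ^ 2 / (2 * c)) ≤ optM L c r θ h := by
  have h1 := optW_var' hL hb hr θ h (optW (L / c) r θ h)
  unfold optM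
  set v := optW (L / b) r θ h
  set w := optW (L / c) r θ h
  have h2 : c * (w ^ 2 / (2 * r) + h * w) + L * (|θ + w| - |θ|)
      = b * (v ^ 2 / (2 * r) + h * v) + L * (|θ + v| - |θ|)
        + (b * ((v / r + h) * (w - v)) + L * (|θ + w| - |θ + v|))
        + (c - b) * (v ^ 2 / (2 * r) + h * v) - (c - b) ^ 2 * (r * (v / r + h) ^ 2 / (2 * c))
        + (c * (w - v) + (c - b) * (r * (v / r + h))) ^ 2 / (2 * r * c) := by
    field_simp; ring
  rw [h2]
  have : 0 ≤ (c * (w - v) + (c - b) * (r * (v / r + h))) ^ 2 / (2 * r * c) := by positivity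
  linarith

theorem optM_ge_sgn {L b r : ℝ} (hL : 0 ≤ L) (hb : 0 < b) (hr : 0 < r) (θ : ℝ) :
    ∃ e : ℝ, e ^ 2 = 1 ∧ ∀ h, -(b * r / 2 * (h + L / b * e) ^ 2) ≤ optM L b r θ h := by
  obtain ⟨e, he, hw⟩ : ∃ e : ℝ, e ^ 2 = 1 ∧ ∀ w : ℝ, e * w ≤ |θ + w| - |θ| := by
    rcases le_total 0 θ with h | h
    · exact ⟨1, by norm_num, fun w => by
        rw [abs_of_nonneg h]; linarith [le_abs_self (θ + w)]⟩
    · exact ⟨-1, by norm_num, fun w => by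
        rw [abs_of_nonpos h]; linarith [neg_abs_le (θ + w)]⟩
  refine ⟨e, he, fun h => ?_⟩
  unfold optM
  set w := optW (L / b) r θ h
  have h1 := mul_le_mul_of_nonneg_left (hw w) hL
  have h2 : b * (w ^ 2 / (2 * r) + h * w) + L * (e * w)
      = -(b * r / 2 * (h + L / b * e) ^ 2) + b * (w + r * (h + L / b * e)) ^ 2 / (2 * r) := by
    field_simp; ring
  have : 0 ≤ b * (w + r * (h + L / b * e)) ^ 2 / (2 * r) := by positivity
  linarith

theorem optM_ge_small {L b r K : ℝ} (hL : 0 ≤ L) (hb : 0 < b) (hr : 0 < r) {θ : ℝ} (hθ : |θ| ≤ K)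
    (h : ℝ) : -(b * r / 2 * (max (|h| - L / b) 0) ^ 2) - 2 * L * K ≤ optM L b r θ h := by
  unfold optM
  set w := optW (L / b) r θ h
  have h1 : |w| - 2 * K ≤ |θ + w| - |θ| := by
    have : |w| ≤ |θ + w| + |θ| := by
      have := abs_sub (θ + w) θ
      simpa using this
    linarith
  have h2 := mul_le_mul_of_nonneg_left h1 hL
  have h3 : -(|h| * |w|) ≤ h * w := by rw [← abs_mul]; exact neg_abs_le _
  set y := max (|h| - L / b) 0
  have hy1 : |h| - L / b ≤ y := le_max_left _ _
  have hy0 : 0 ≤ y := le_max_right _ _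
  have h4 : b * (|w| ^ 2 / (2 * r) - |h| * |w|) + L * |w| ≥ b * (|w| ^ 2 / (2 * r) - y * |w|) := by
    have : L = b * (L / b) := by field_simp
    have h6 : b * ((|h| - L / b) * |w|) ≤ b * (y * |w|) := by gcongr
    have h7 : b * (|w| ^ 2 / (2 * r) - |h| * |w|) + L * |w|
      = b * (|w| ^ 2 / (2 * r)) - b * ((|h| - L / b) * |w|) := by
      nth_rewrite 1 [this]; ring
    rw [h7]
    linarith
  have h5 : b * (|w| ^ 2 / (2 * r) - y * |w|)
      = -(b * r / 2 * y ^ 2) + b * (|w| - r * y) ^ 2 / (2 * r) := by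
    field_simp; ring
  have h6 : 0 ≤ b * (|w| - r * y) ^ 2 / (2 * r) := by positivity
  have h8 : b * (w ^ 2 / (2 * r) + h * w) ≥ b * (|w| ^ 2 / (2 * r) - |h| * |w|) := by
    rw [sq_abs]
    exact mul_le_mul_of_nonneg_left (by linarith) hb.le
  nlinarith

theorem abs_optM_le {L b r : ℝ} (hL : 0 ≤ L) (hb : 0 < b) (hr : 0 < r) (θ h : ℝ) :
    |optM L b r θ h| ≤ b * r * (1 + (L / b) ^ 2) * (1 + h ^ 2) := by
  obtain ⟨e, he, hh⟩ := optM_ge_sgn hL hb hr θ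
  rw [abs_of_nonpos (optM_nonpos hL hb hr θ h)]
  have h1 := hh h
  set a := L / b
  have h2 : (h + a * e) ^ 2 ≤ 2 * ((1 + a ^ 2) * (1 + h ^ 2)) := by
    have : (a * e) ^ 2 = a ^ 2 := by rw [mul_pow, he, mul_one]
    nlinarith [sq_nonneg (h - a * e), sq_nonneg (a * h)]
  have h3 : b * r / 2 * (h + a * e) ^ 2 ≤ b * r / 2 * (2 * ((1 + a ^ 2) * (1 + h ^ 2))) :=
    mul_le_mul_of_nonneg_left h2 (by positivity)
  nlinarith

/-- Normalised sum over coordinates of Gaussian expectations. -/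
def avgE {N : ℕ} (n : ℝ) (θ : Fin N → ℝ) (f : ℝ → ℝ → ℝ) : ℝ :=
  (1 / n) * ∑ j, ∫ h, f (θ j) h ∂(gaussianReal 0 1)

theorem avgE_mono {N : ℕ} {n : ℝ} (hn : 0 < n) (θ : Fin N → ℝ) {f g : ℝ → ℝ → ℝ}
    (hf : ∀ t, Integrable (f t) (gaussianReal 0 1)) (hg : ∀ t, Integrable (g t) (gaussianReal 0 1))
    (h : ∀ j x, f (θ j) x ≤ g (θ j) x) : avgE n θ f ≤ avgE n θ g := by
  unfold avgE
  refine mul_le_mul_of_nonneg_left (Finset.sum_le_sum fun j _ => ?_) (by positivity)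
  exact integral_mono (hf _) (hg _) (h j)

theorem avgE_add {N : ℕ} (n : ℝ) (θ : Fin N → ℝ) {f g : ℝ → ℝ → ℝ}
    (hf : ∀ t, Integrable (f t) (gaussianReal 0 1)) (hg : ∀ t, Integrable (g t) (gaussianReal 0 1)) :
    avgE n θ (fun t x => f t x + g t x) = avgE n θ f + avgE n θ g := by
  unfold avgE
  simp only [integral_add (hf _) (hg _), Finset.sum_add_distrib, mul_add]

theorem avgE_const_mul {N : ℕ} (n : ℝ) (θ : Fin N → ℝ) (c : ℝ) (f : ℝ → ℝ → ℝ) :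
    avgE n θ (fun t x => c * f t x) = c * avgE n θ f := by
  unfold avgE
  simp only [integral_const_mul, ← Finset.mul_sum]
  ring

theorem integrable_optM {L b r : ℝ} (hL : 0 ≤ L) (hb : 0 < b) (hr : 0 < r) (θ : ℝ) :
    Integrable (optM L b r θ) (gaussianReal 0 1) :=
  integrable_of_le_one_add_sq (continuous_optM L b r θ).measurable
    (K := b * r * (1 + (L / b) ^ 2)) (abs_optM_le hL hb hr θ)

theorem sq_optW_le {α r : ℝ} (hα : 0 ≤ α) (hr : 0 < r) (θ h : ℝ) :
    (optW α r θ h) ^ 2 ≤ 2 * r ^ 2 * (1 + α ^ 2) * (1 + h ^ 2) := by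
  have h1 := abs_optW_le hα hr θ h
  have h2 : (optW α r θ h) ^ 2 ≤ (r * (|h| + α)) ^ 2 := by
    rw [← sq_abs]; exact pow_le_pow_left₀ (abs_nonneg _) h1 2
  refine h2.trans ?_
  have h3 : (|h| + α) ^ 2 ≤ 2 * ((1 + α ^ 2) * (1 + |h| ^ 2)) := by
    nlinarith [sq_nonneg (|h| - α), sq_nonneg (α * |h|)]
  rw [sq_abs] at h3
  rw [mul_pow]
  nlinarith [mul_le_mul_of_nonneg_left h3 (sq_nonneg r)]

theorem abs_mul_optW_le {α r : ℝ} (hα : 0 ≤ α) (hr : 0 < r) (θ h : ℝ) :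
    |h * optW α r θ h| ≤ r * (1 + α) * (1 + h ^ 2) := by
  have h1 := abs_optW_le hα hr θ h
  rw [abs_mul]
  have h2 : |h| * |optW α r θ h| ≤ |h| * (r * (|h| + α)) :=
    mul_le_mul_of_nonneg_left h1 (abs_nonneg _)
  have h3 : |h| * (|h| + α) ≤ (1 + α) * (1 + |h| ^ 2) := by
    nlinarith [abs_nonneg h, sq_nonneg (|h| - 1), mul_nonneg hα (sq_nonneg (|h| - 1))]
  rw [sq_abs] at h3
  nlinarith

theorem abs_pen_le {α r : ℝ} (hα : 0 ≤ α) (hr : 0 < r) (θ h : ℝ) :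
    abs (|θ + optW α r θ h| - |θ|) ≤ r * (1 + α) * (1 + h ^ 2) := by
  have h1 := abs_optW_le hα hr θ h
  have h2 : abs (|θ + optW α r θ h| - |θ|) ≤ |optW α r θ h| := by
    have := abs_abs_sub_abs_le_abs_sub (θ + optW α r θ h) θ
    simpa using this
  have h3 : |h| + α ≤ (1 + α) * (1 + |h| ^ 2) := by
    nlinarith [abs_nonneg h, sq_nonneg (|h| - 1), mul_nonneg hα (sq_nonneg (|h|))]
  rw [sq_abs] at h3
  nlinarith

theorem integrable_sq_optW {α r : ℝ} (hα : 0 ≤ α) (hr : 0 < r) (θ : ℝ) :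
    Integrable (fun h => (optW α r θ h) ^ 2) (gaussianReal 0 1) :=
  integrable_of_le_one_add_sq (continuous_optW α r θ |>.pow 2).measurable
    (K := 2 * r ^ 2 * (1 + α ^ 2)) fun h => by
      rw [abs_of_nonneg (sq_nonneg _)]; exact sq_optW_le hα hr θ h

theorem integrable_mul_optW {α r : ℝ} (hα : 0 ≤ α) (hr : 0 < r) (θ : ℝ) :
    Integrable (fun h => h * optW α r θ h) (gaussianReal 0 1) :=
  integrable_of_le_one_add_sq (continuous_id.mul (continuous_optW α r θ)).measurable
    (K := r * (1 + α)) fun h => abs_mul_optW_le hα hr θ h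

theorem integrable_pen {α r : ℝ} (hα : 0 ≤ α) (hr : 0 < r) (θ : ℝ) :
    Integrable (fun h => |θ + optW α r θ h| - |θ|) (gaussianReal 0 1) :=
  integrable_of_le_one_add_sq
    (((continuous_const.add (continuous_optW α r θ)).abs).sub continuous_const).measurable
    (K := r * (1 + α)) fun h => abs_pen_le hα hr θ h

/-- The scalarised saddle functional. -/
def Phi {N : ℕ} (σ ν L n : ℝ) (θ : Fin N → ℝ) (b r : ℝ) : ℝ :=
  b * (ν * r / 2 + σ ^ 2 / (2 * r)) - b ^ 2 / 2 + avgE n θ (optM L b r)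

/-- Average squared length of the scalar minimisers. -/
def rho2 {N : ℕ} (L n : ℝ) (θ : Fin N → ℝ) (b r : ℝ) : ℝ :=
  avgE n θ (fun t h => (optW (L / b) r t h) ^ 2)

/-- Average correlation of the scalar minimisers with the Gaussian field. -/
def kap {N : ℕ} (L n : ℝ) (θ : Fin N → ℝ) (b r : ℝ) : ℝ :=
  avgE n θ (fun t h => h * optW (L / b) r t h)

/-- Average penalty increment of the scalar minimisers. -/
def penE {N : ℕ} (L n : ℝ) (θ : Fin N → ℝ) (b r : ℝ) : ℝ :=
  avgE n θ (fun t h => |t + optW (L / b) r t h| - |t|)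

section Touch

variable {N : ℕ} {σ ν L n b r : ℝ} (θ : Fin N → ℝ)

theorem avgE_lin (hL : 0 ≤ L) (hb : 0 < b) (hr : 0 < r) (c1 c2 c3 : ℝ) :
    avgE n θ (fun t h => c1 * (optW (L / b) r t h) ^ 2 + (c2 * (h * optW (L / b) r t h)
      + c3 * (|t + optW (L / b) r t h| - |t|))) =
    c1 * rho2 L n θ b r + (c2 * kap L n θ b r + c3 * penE L n θ b r) := by
  have hα := div_nonneg hL hb.le
  have h1 : ∀ t, Integrable (fun h => c2 * (h * optW (L / b) r t h)
      + c3 * (|t + optW (L / b) r t h| - |t|)) (gaussianReal 0 1) := fun t =>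
    ((integrable_mul_optW hα hr t).const_mul c2).add ((integrable_pen hα hr t).const_mul c3)
  rw [avgE_add n θ (fun t => (integrable_sq_optW hα hr t).const_mul c1) h1,
    avgE_add n θ (fun t => (integrable_mul_optW hα hr t).const_mul c2)
      (fun t => (integrable_pen hα hr t).const_mul c3), avgE_const_mul, avgE_const_mul,
    avgE_const_mul]
  rfl

theorem integrable_lin (hL : 0 ≤ L) (hb : 0 < b) (hr : 0 < r) (c1 c2 c3 t : ℝ) :
    Integrable (fun h => c1 * (optW (L / b) r t h) ^ 2 + (c2 * (h * optW (L / b) r t h)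
      + c3 * (|t + optW (L / b) r t h| - |t|))) (gaussianReal 0 1) :=
  have hα := div_nonneg hL hb.le
  ((integrable_sq_optW hα hr t).const_mul c1).add
    (((integrable_mul_optW hα hr t).const_mul c2).add ((integrable_pen hα hr t).const_mul c3))

theorem rho2_nonneg (hn : 0 < n) : 0 ≤ rho2 L n θ b r :=
  mul_nonneg (by positivity) (Finset.sum_nonneg fun _ _ => integral_nonneg fun _ => sq_nonneg _)

theorem avgE_optM (hL : 0 ≤ L) (hb : 0 < b) (hr : 0 < r) :
    avgE n θ (optM L b r) = b / (2 * r) * rho2 L n θ b r + (b * kap L n θ b r + L * penE L n θ b r) := by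
  rw [← avgE_lin θ hL hb hr]
  unfold avgE optM
  congr 1
  refine Finset.sum_congr rfl fun j _ => integral_congr_ae (Filter.Eventually.of_forall fun h => ?_)
  simp only
  ring

theorem Phi_eq (hL : 0 ≤ L) (hb : 0 < b) (hr : 0 < r) :
    Phi σ ν L n θ b r = b * (ν * r / 2 + (σ ^ 2 + rho2 L n θ b r) / (2 * r) + kap L n θ b r)
      - b ^ 2 / 2 + L * penE L n θ b r := by
  unfold Phi
  rw [avgE_optM θ hL hb hr]
  field_simp
  ring

theorem Phi_le (hn : 0 < n) (hL : 0 ≤ L) (hb : 0 < b) (hr : 0 < r) {c s : ℝ} (hc : 0 < c) (hs : 0 < s) :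
    Phi σ ν L n θ c s ≤ c * (ν * s / 2 + (σ ^ 2 + rho2 L n θ b r) / (2 * s) + kap L n θ b r)
      - c ^ 2 / 2 + L * penE L n θ b r := by
  have h1 : avgE n θ (optM L c s) ≤
      c / (2 * s) * rho2 L n θ b r + (c * kap L n θ b r + L * penE L n θ b r) := by
    rw [← avgE_lin θ hL hb hr]
    refine avgE_mono hn θ (integrable_optM hL hc hs) (integrable_lin hL hb hr _ _ _) fun j x => ?_
    refine (optM_le hL hc hs (θ j) x (optW (L / b) r (θ j) x)).trans (le_of_eq ?_)
    field_simp
    ring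
  unfold Phi
  have h2 : c * (ν * s / 2 + (σ ^ 2 + rho2 L n θ b r) / (2 * s) + kap L n θ b r)
      - c ^ 2 / 2 + L * penE L n θ b r = c * (ν * s / 2 + σ ^ 2 / (2 * s)) - c ^ 2 / 2 +
      (c / (2 * s) * rho2 L n θ b r + (c * kap L n θ b r + L * penE L n θ b r)) := by
    field_simp; ring
  linarith

theorem Phi_ge_r (hn : 0 < n) (hL : 0 ≤ L) (hb : 0 < b) (hr : 0 < r) {s : ℝ} (hs : 0 < s) :
    Phi σ ν L n θ b r + b * ν / 2 * (s - r) + b * (σ ^ 2 / (2 * s) - σ ^ 2 / (2 * r))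
      - b * rho2 L n θ b r / (2 * r ^ 2) * (s - r) ≤ Phi σ ν L n θ b s := by
  have h1 : (b / (2 * r) - b / (2 * r ^ 2) * (s - r)) * rho2 L n θ b r
      + (b * kap L n θ b r + L * penE L n θ b r) ≤ avgE n θ (optM L b s) := by
    rw [← avgE_lin θ hL hb hr]
    refine avgE_mono hn θ (integrable_lin hL hb hr _ _ _) (integrable_optM hL hb hs) fun j x => ?_
    refine (le_of_eq ?_).trans (optM_subgrad hL hb hr hs (θ j) x)
    unfold optM
    field_simp
    ring
  rw [Phi_eq θ hL hb hr]
  unfold Phi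
  have h2 : b * (ν * r / 2 + (σ ^ 2 + rho2 L n θ b r) / (2 * r) + kap L n θ b r) - b ^ 2 / 2
      + L * penE L n θ b r + b * ν / 2 * (s - r) + b * (σ ^ 2 / (2 * s) - σ ^ 2 / (2 * r))
      - b * rho2 L n θ b r / (2 * r ^ 2) * (s - r) =
      b * (ν * s / 2 + σ ^ 2 / (2 * s)) - b ^ 2 / 2 +
      ((b / (2 * r) - b / (2 * r ^ 2) * (s - r)) * rho2 L n θ b r
      + (b * kap L n θ b r + L * penE L n θ b r)) := by
    field_simp; ring
  linarith

theorem Phi_ge_b (hn : 0 < n) (hL : 0 ≤ L) (hb : 0 < b) (hr : 0 < r) : ∃ Q, 0 ≤ Q ∧ ∀ c, 0 < c →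
    Phi σ ν L n θ b r + (c - b) * (ν * r / 2 + (σ ^ 2 + rho2 L n θ b r) / (2 * r) + kap L n θ b r)
      - (c ^ 2 - b ^ 2) / 2 - (c - b) ^ 2 * Q / c ≤ Phi σ ν L n θ c r := by
  have hα := div_nonneg hL hb.le
  let q : ℝ → ℝ → ℝ := fun t h => r * (optW (L / b) r t h / r + h) ^ 2 / 2
  have hq : ∀ t, Integrable (q t) (gaussianReal 0 1) := fun t => by
    have h1 := ((integrable_sq_optW hα hr t).const_mul (1 / (2 * r))).add
      ((integrable_mul_optW hα hr t).add (integrable_sq_stdGaussian.const_mul (r / 2)))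
    refine h1.congr (Filter.Eventually.of_forall fun h => ?_)
    simp only [q, Pi.add_apply]
    field_simp; ring
  refine ⟨avgE n θ q, mul_nonneg (by positivity) (Finset.sum_nonneg fun _ _ =>
    integral_nonneg fun _ => by positivity), fun c hc => ?_⟩
  have h1 : (c / (2 * r)) * rho2 L n θ b r
      + (c * kap L n θ b r + L * penE L n θ b r) + (-((c - b) ^ 2 / c)) * avgE n θ q
      ≤ avgE n θ (optM L c r) := by
    rw [← avgE_lin θ hL hb hr, ← avgE_const_mul, ← avgE_add n θ (integrable_lin hL hb hr _ _ _)
      (fun t => (hq t).const_mul _)]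
    refine avgE_mono hn θ (fun t => (integrable_lin hL hb hr _ _ _ t).add ((hq t).const_mul _))
      (integrable_optM hL hc hr) fun j x => ?_
    refine (le_of_eq ?_).trans (optM_quad_b hL hb hc hr (θ j) x)
    simp only [optM, q]
    field_simp
    ring
  rw [Phi_eq θ hL hb hr]
  unfold Phi
  have h2 : b * (ν * r / 2 + (σ ^ 2 + rho2 L n θ b r) / (2 * r) + kap L n θ b r) - b ^ 2 / 2
      + L * penE L n θ b r
      + (c - b) * (ν * r / 2 + (σ ^ 2 + rho2 L n θ b r) / (2 * r) + kap L n θ b r)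
      - (c ^ 2 - b ^ 2) / 2 - (c - b) ^ 2 * avgE n θ q / c =
      c * (ν * r / 2 + σ ^ 2 / (2 * r)) - c ^ 2 / 2 +
      ((c / (2 * r)) * rho2 L n θ b r
      + (c * kap L n θ b r + L * penE L n θ b r) + (-((c - b) ^ 2 / c)) * avgE n θ q) := by
    field_simp; ring
  linarith

end Touch

theorem convexOn_of_subgrad {S : Set ℝ} (hS : Convex ℝ S) {f : ℝ → ℝ}
    (h : ∀ y ∈ S, ∃ c, ∀ x ∈ S, f y + c * (x - y) ≤ f x) : ConvexOn ℝ S f := by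
  refine ⟨hS, fun x hx y hy a b ha hb hab => ?_⟩
  obtain ⟨c, hc⟩ := h _ (hS hx hy ha hb hab)
  have h1 := hc x hx
  have h2 := hc y hy
  simp only [smul_eq_mul] at *
  have h3 := mul_le_mul_of_nonneg_left h1 ha
  have h4 := mul_le_mul_of_nonneg_left h2 hb
  have h5 : a * (f (a * x + b * y) + c * (x - (a * x + b * y)))
    + b * (f (a * x + b * y) + c * (y - (a * x + b * y))) = f (a * x + b * y) := by
    have : b = 1 - a := by linarith
    subst this; ring
  linarith

theorem Phi_convex {N : ℕ} {σ ν L n b : ℝ} (θ : Fin N → ℝ) (hn : 0 < n) (hL : 0 ≤ L) (hb : 0 < b) :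
    ConvexOn ℝ (Set.Ioi 0) (fun r => Phi σ ν L n θ b r) := by
  refine convexOn_of_subgrad (convex_Ioi 0) fun r hr => ?_
  have hr' : 0 < r := hr
  refine ⟨b * ν / 2 - b * σ ^ 2 / (2 * r ^ 2) - b * rho2 L n θ b r / (2 * r ^ 2), fun s hs => ?_⟩
  have hs' : 0 < s := hs
  refine le_trans ?_ (Phi_ge_r θ hn hL hb hr' hs')
  have h1 : b * (σ ^ 2 / (2 * s) - σ ^ 2 / (2 * r)) = - (b * σ ^ 2 / (2 * r ^ 2)) * (s - r)
      + b * σ ^ 2 * (s - r) ^ 2 / (2 * s * r ^ 2) := by field_simp; ring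
  rw [h1]
  have : 0 ≤ b * σ ^ 2 * (s - r) ^ 2 / (2 * s * r ^ 2) := by positivity
  linarith

theorem Phi_concave {N : ℕ} {σ ν L n r : ℝ} (θ : Fin N → ℝ) (hn : 0 < n) (hL : 0 ≤ L) (hr : 0 < r) :
    ConcaveOn ℝ (Set.Ioi 0) (fun b => Phi σ ν L n θ b r) := by
  rw [← neg_convexOn_iff]
  refine convexOn_of_subgrad (convex_Ioi 0) fun b hb => ?_
  have hb' : 0 < b := hb
  refine ⟨b - (ν * r / 2 + (σ ^ 2 + rho2 L n θ b r) / (2 * r) + kap L n θ b r), fun c hc => ?_⟩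
  have hc' : 0 < c := hc
  have h1 := Phi_le (σ := σ) (ν := ν) θ hn hL hb' hr hc' hr
  simp only [Pi.neg_apply]
  rw [Phi_eq θ hL hb' hr]
  nlinarith [sq_nonneg (c - b)]

/-- Second moment of the soft-thresholded standard Gaussian. -/
def softMoment (α : ℝ) : ℝ := ∫ h, (max (|h| - α) 0) ^ 2 ∂(gaussianReal 0 1)

theorem softMoment_integrable {α : ℝ} (hα : 0 ≤ α) :
    Integrable (fun h : ℝ => (max (|h| - α) 0) ^ 2) (gaussianReal 0 1) := by
  refine integrable_of_le_one_add_sq (K := 1) (by fun_prop) fun h => ?_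
  rw [abs_of_nonneg (sq_nonneg _)]
  rcases le_total (|h| - α) 0 with h1 | h1
  · rw [max_eq_right h1]; nlinarith [sq_nonneg h]
  · rw [max_eq_left h1, ← sq_abs h]; nlinarith [abs_nonneg h]

theorem softMoment_nonneg (α : ℝ) : 0 ≤ softMoment α := integral_nonneg fun _ => sq_nonneg _

theorem softMoment_le_one {α : ℝ} (hα : 0 ≤ α) : softMoment α ≤ 1 := by
  rw [← integral_sq_stdGaussian]
  refine integral_mono (softMoment_integrable hα) integrable_sq_stdGaussian fun h => ?_
  simp only
  rcases le_total (|h| - α) 0 with h1 | h1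
  · rw [max_eq_right h1]; nlinarith [sq_nonneg h]
  · rw [max_eq_left h1, ← sq_abs h]; nlinarith [abs_nonneg h]

/-- Most coordinates of `θ` are bounded by `K`, quantitatively below the phase transition at
threshold `α`. -/
structure BelowThreshold {N : ℕ} (δ ν K s α κ : ℝ) (θ : Fin N → ℝ) : Prop where
  card_le : ((Finset.univ.filter (fun j => K < |θ j|)).card : ℝ) ≤ s * N
  gap : s * (1 + α ^ 2) + (1 - s) * softMoment α ≤ ν * δ - κ

theorem sum_le_of_card {N : ℕ} {K s A B : ℝ} (θ f : Fin N → ℝ)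
    (hc : ((Finset.univ.filter (fun j => K < |θ j|)).card : ℝ) ≤ s * N) (hBA : B ≤ A)
    (hA : ∀ j, f j ≤ A) (hB : ∀ j, |θ j| ≤ K → f j ≤ B) :
    ∑ j, f j ≤ N * (s * A + (1 - s) * B) := by
  have h1 : ∀ j, f j ≤ B + (if K < |θ j| then A - B else 0) := by
    intro j
    split_ifs with h
    · linarith [hA j]
    · linarith [hB j (not_lt.1 h)]
  refine (Finset.sum_le_sum fun j _ => h1 j).trans ?_
  rw [Finset.sum_add_distrib, ← Finset.sum_filter, Finset.sum_const, Finset.sum_const]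
  simp only [nsmul_eq_mul, Finset.card_univ, Fintype.card_fin]
  nlinarith [mul_le_mul_of_nonneg_right hc (sub_nonneg.2 hBA)]

theorem integral_stdGaussian_id : ∫ h, h ∂(gaussianReal 0 1) = 0 := by
  simp

theorem neg_integral_optM_le {L b r : ℝ} (hL : 0 ≤ L) (hb : 0 < b) (hr : 0 < r) (θ : ℝ) :
    -∫ h, optM L b r θ h ∂(gaussianReal 0 1) ≤ b * r / 2 * (1 + (L / b) ^ 2) := by
  obtain ⟨e, he, hh⟩ := optM_ge_sgn hL hb hr θ
  have hi1 : Integrable (fun h : ℝ => h ^ 2 + 2 * (L / b * e) * h) (gaussianReal 0 1) :=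
    integrable_sq_stdGaussian.add (integrable_id_stdGaussian.const_mul _)
  have hi : Integrable (fun h : ℝ => b * r / 2 * (h ^ 2 + 2 * (L / b * e) * h + (L / b) ^ 2))
      (gaussianReal 0 1) := (hi1.add (integrable_const _)).const_mul _
  have h1 : ∫ h, b * r / 2 * (h ^ 2 + 2 * (L / b * e) * h + (L / b) ^ 2) ∂(gaussianReal 0 1)
      = b * r / 2 * (1 + (L / b) ^ 2) := by
    rw [integral_const_mul, integral_add hi1 (integrable_const _), integral_add
      integrable_sq_stdGaussian (integrable_id_stdGaussian.const_mul _), integral_const_mul,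
      integral_sq_stdGaussian]
    have := integral_stdGaussian_id
    simp [this]
  rw [← h1, ← integral_neg]
  refine integral_mono (integrable_optM hL hb hr θ).neg hi fun h => ?_
  have := hh h
  have e2 : (h + L / b * e) ^ 2 = h ^ 2 + 2 * (L / b * e) * h + (L / b) ^ 2 := by
    have : (h + L / b * e) ^ 2 = h ^ 2 + 2 * (L / b * e) * h + (L / b) ^ 2 * e ^ 2 := by ring
    rw [this, he, mul_one]
  rw [e2] at this
  simp only
  linarith

theorem neg_integral_optM_le_small {L b r K : ℝ} (hL : 0 ≤ L) (hb : 0 < b) (hr : 0 < r) {θ : ℝ}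
    (hθ : |θ| ≤ K) :
    -∫ h, optM L b r θ h ∂(gaussianReal 0 1) ≤ b * r / 2 * softMoment (L / b) + 2 * L * K := by
  have hα := div_nonneg hL hb.le
  have h1 : ∫ h, (b * r / 2 * (max (|h| - L / b) 0) ^ 2 + 2 * L * K) ∂(gaussianReal 0 1)
      = b * r / 2 * softMoment (L / b) + 2 * L * K := by
    rw [integral_add ((softMoment_integrable hα).const_mul _) (integrable_const _),
      integral_const_mul]
    simp [softMoment]
  rw [← h1, ← integral_neg]
  refine integral_mono (integrable_optM hL hb hr θ).neg
    (((softMoment_integrable hα).const_mul _).add (integrable_const _)) fun h => ?_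
  have := optM_ge_small hL hb hr hθ h
  simp only
  linarith

theorem Phi_coercive {N : ℕ} {σ δ ν L n K s α κ r : ℝ} {θ : Fin N → ℝ} (hN : 0 < N) (hδ : 0 < δ)
    (hn : n = δ * N) (hL : 0 < L) (hα : 0 < α) (hr : 0 < r) (hK : 0 ≤ K)
    (hθ : BelowThreshold δ ν K s α κ θ) :
    L / α * (κ / (2 * δ)) * r - (L / α) ^ 2 / 2 - 2 * L * K / δ ≤ Phi σ ν L n θ (L / α) r := by
  have hN' : (0 : ℝ) < N := by exact_mod_cast hN
  have hb : 0 < L / α := by positivity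
  have hLb : L / (L / α) = α := by field_simp
  set b := L / α with hbdef
  have hsm1 := softMoment_le_one hα.le
  have h1 : ∑ j, (-∫ h, optM L b r (θ j) h ∂(gaussianReal 0 1)) ≤
      N * (s * (b * r / 2 * (1 + α ^ 2) + 2 * L * K) + (1 - s) * (b * r / 2 * softMoment α + 2 * L * K)) := by
    refine sum_le_of_card θ _ hθ.card_le ?_ (fun j => ?_) (fun j hj => ?_)
    · have : b * r / 2 * softMoment α ≤ b * r / 2 * (1 + α ^ 2) :=
        mul_le_mul_of_nonneg_left (by nlinarith) (by positivity)
      linarith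
    · have := neg_integral_optM_le hL.le hb hr (θ j)
      rw [hLb] at this
      have h2 : 0 ≤ 2 * L * K := by positivity
      linarith
    · have := neg_integral_optM_le_small hL.le hb hr hj
      rwa [hLb] at this
  have h2 : N * (s * (b * r / 2 * (1 + α ^ 2) + 2 * L * K)
      + (1 - s) * (b * r / 2 * softMoment α + 2 * L * K)) ≤ N * (b * r / 2 * (ν * δ - κ) + 2 * L * K) := by
    refine mul_le_mul_of_nonneg_left ?_ hN'.le
    have := mul_le_mul_of_nonneg_left hθ.gap (show 0 ≤ b * r / 2 by positivity)
    nlinarith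
  rw [Finset.sum_neg_distrib] at h1
  have h3 : -(b * r / 2 * (ν * δ - κ) + 2 * L * K) / δ ≤ avgE n θ (optM L b r) := by
    unfold avgE
    rw [hn, div_le_iff₀ hδ]
    have h4 : 1 / (δ * N) * (∑ j, ∫ h, optM L b r (θ j) h ∂(gaussianReal 0 1)) * δ
      = (∑ j, ∫ h, optM L b r (θ j) h ∂(gaussianReal 0 1)) / N := by field_simp
    rw [h4, le_div_iff₀ hN']
    nlinarith
  have h5 : 0 ≤ b * (σ ^ 2 / (2 * r)) := by positivity
  unfold Phi
  have h6 : -(b * r / 2 * (ν * δ - κ) + 2 * L * K) / δ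
    = -(b * (ν * r / 2)) + b * (κ / (2 * δ)) * r - 2 * L * K / δ := by field_simp; ring
  rw [h6] at h3
  nlinarith

theorem kap_nonpos_term {α r : ℝ} (hα : 0 ≤ α) (hr : 0 < r) (θ : ℝ) :
    (∫ h, h * optW α r θ h ∂(gaussianReal 0 1))
      = ∫ h, h * (optW α r θ h - optW α r θ 0) ∂(gaussianReal 0 1) := by
  have h1 := integrable_mul_optW hα hr θ
  have h2 : Integrable (fun h : ℝ => h * optW α r θ 0) (gaussianReal 0 1) :=
    integrable_id_stdGaussian.mul_const _
  simp only [mul_sub]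
  rw [integral_sub h1 h2, integral_mul_const, integral_stdGaussian_id]
  simp

theorem kap_nonpos {N : ℕ} {L n b r : ℝ} (θ : Fin N → ℝ) (hn : 0 < n) (hL : 0 ≤ L) (hb : 0 < b)
    (hr : 0 < r) : kap L n θ b r ≤ 0 := by
  have hα := div_nonneg hL hb.le
  unfold kap avgE
  refine mul_nonpos_of_nonneg_of_nonpos (by positivity) (Finset.sum_nonpos fun j _ => ?_)
  rw [kap_nonpos_term hα hr]
  exact integral_nonpos fun h => (mul_optW_sub hα hr _ h).1

theorem neg_kap_le {N : ℕ} {δ ν L n K s α κ b r η : ℝ} {θ : Fin N → ℝ} (hN : 0 < N) (hδ : 0 < δ)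
    (hn : n = δ * N) (hL : 0 ≤ L) (hb : 0 < b) (hα : 0 < α) (hr : 0 < r)
    (hη : 0 < η) (hθ : BelowThreshold δ ν K s α κ θ)
    (hbig : 2 * (1 + η) * α / η ≤ L / b - K / r) :
    -kap L n θ b r ≤ r / δ * ((1 + η) * (ν * δ - κ)) := by
  have hN' : (0 : ℝ) < N := by exact_mod_cast hN
  have ha := div_nonneg hL hb.le
  set a := L / b
  have hintg : ∀ t, Integrable (fun h => h * (optW a r t h - optW a r t 0)) (gaussianReal 0 1) := by
    intro t
    simp only [mul_sub]
    exact (integrable_mul_optW ha hr t).sub (integrable_id_stdGaussian.mul_const _)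
  have hsm1 := softMoment_le_one hα.le
  have h1 : ∑ j, (-∫ h, h * optW a r (θ j) h ∂(gaussianReal 0 1)) ≤
      N * (s * (r * (1 + η) * (1 + α ^ 2)) + (1 - s) * (r * (1 + η) * softMoment α)) := by
    refine sum_le_of_card θ _ hθ.card_le ?_ (fun j => ?_) (fun j hj => ?_)
    · exact mul_le_mul_of_nonneg_left (by nlinarith) (by positivity)
    · rw [kap_nonpos_term ha hr, ← integral_neg]
      have h2 : ∫ h, -(h * (optW a r (θ j) h - optW a r (θ j) 0)) ∂(gaussianReal 0 1)
          ≤ ∫ h, r * h ^ 2 ∂(gaussianReal 0 1) := by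
        refine integral_mono (hintg _).neg (integrable_sq_stdGaussian.const_mul r) fun h => ?_
        have := (mul_optW_sub ha hr (θ j) h).2
        simp only
        linarith
      rw [integral_const_mul, integral_sq_stdGaussian] at h2
      have h3 : 1 ≤ (1 + η) * (1 + α ^ 2) := by nlinarith [sq_nonneg α]
      nlinarith
    · rw [kap_nonpos_term ha hr, ← integral_neg]
      have h2 : ∫ h, -(h * (optW a r (θ j) h - optW a r (θ j) 0)) ∂(gaussianReal 0 1)
          ≤ ∫ h, r * (1 + η) * (max (|h| - α) 0) ^ 2 ∂(gaussianReal 0 1) := by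
        refine integral_mono (hintg _).neg ((softMoment_integrable hα.le).const_mul _) fun h => ?_
        simp only
        rcases le_total (|h|) (a - K / r) with hh | hh
        · have hKr : K / r * r = K := by field_simp
          have e1 : optW a r (θ j) h = -θ j := by
            unfold optW
            rw [softT_eq_zero, zero_sub]
            calc |θ j - r * h| ≤ |θ j| + |r * h| := abs_sub _ _
              _ ≤ K + r * (a - K / r) := by
                rw [abs_mul, abs_of_pos hr]
                exact add_le_add hj (mul_le_mul_of_nonneg_left hh hr.le)
              _ = a * r := by linarith
          have e2 : optW a r (θ j) 0 = -θ j := by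
            unfold optW
            rw [softT_eq_zero, zero_sub]
            rw [mul_zero, sub_zero]
            have : 0 ≤ a - K / r := (abs_nonneg h).trans hh
            nlinarith
          rw [e1, e2]
          simp only [sub_self, mul_zero, neg_zero]
          positivity
        · have h3 : 2 * (1 + η) * α / η ≤ |h| := hbig.trans hh
          rw [div_le_iff₀ hη] at h3
          have h4 : |h| ^ 2 ≤ (1 + η) * (max (|h| - α) 0) ^ 2 := by
            have h5 : α ≤ |h| := by nlinarith [abs_nonneg h]
            rw [max_eq_left (by linarith)]
            have h6 : 0 ≤ (1 + η) * α ^ 2 := by positivity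
            nlinarith [mul_nonneg (abs_nonneg h) (sub_nonneg.2 h3)]
          rw [sq_abs] at h4
          have := (mul_optW_sub ha hr (θ j) h).2
          nlinarith
      rwa [integral_const_mul] at h2
  have h2 : N * (s * (r * (1 + η) * (1 + α ^ 2)) + (1 - s) * (r * (1 + η) * softMoment α))
      ≤ N * (r * (1 + η) * (ν * δ - κ)) := by
    refine mul_le_mul_of_nonneg_left ?_ hN'.le
    have := mul_le_mul_of_nonneg_left hθ.gap (show 0 ≤ r * (1 + η) by positivity)
    nlinarith
  rw [Finset.sum_neg_distrib] at h1
  unfold kap avgE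
  rw [hn]
  have h4 : -(1 / (δ * N) * (∑ j, ∫ h, h * optW a r (θ j) h ∂(gaussianReal 0 1)))
      = (-(∑ j, ∫ h, h * optW a r (θ j) h ∂(gaussianReal 0 1))) / (N * δ) := by field_simp
  rw [h4, div_le_iff₀ (by positivity)]
  have h5 : r / δ * ((1 + η) * (ν * δ - κ)) * (N * δ) = N * (r * (1 + η) * (ν * δ - κ)) := by
    field_simp
  rw [h5]
  linarith

theorem slope_sign_of_touch {b0 b1 b S Q : ℝ} {f : ℝ → ℝ} (hQ : 0 ≤ Q) (h0 : b0 ≤ b) (h1 : b ≤ b1)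
    (hlow : ∀ c ∈ Set.Icc b0 b1, f b + S * (c - b) - Q * (c - b) ^ 2 ≤ f c)
    (hmax : ∀ c ∈ Set.Icc b0 b1, f c ≤ f b) : (b < b1 → S ≤ 0) ∧ (b0 < b → 0 ≤ S) := by
  constructor
  · intro hb
    by_contra hS
    push Not at hS
    set e := min (b1 - b) (S / (2 * (Q + 1))) with he
    have he0 : 0 < e := lt_min (by linarith) (by positivity)
    have he1 : e ≤ b1 - b := min_le_left _ _
    have he2 : e ≤ S / (2 * (Q + 1)) := min_le_right _ _
    rw [le_div_iff₀ (by positivity)] at he2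
    have hm : b + e ∈ Set.Icc b0 b1 := ⟨by linarith, by linarith⟩
    have := hlow _ hm
    have := hmax _ hm
    simp only [add_sub_cancel_left] at *
    have h3 : S * e ≤ Q * e * e := by nlinarith
    have h4 := le_of_mul_le_mul_right h3 he0
    nlinarith
  · intro hb
    by_contra hS
    push Not at hS
    set e := min (b - b0) (-S / (2 * (Q + 1))) with he
    have he0 : 0 < e := lt_min (by linarith) (div_pos (by linarith) (by positivity))
    have he1 : e ≤ b - b0 := min_le_left _ _
    have he2 : e ≤ -S / (2 * (Q + 1)) := min_le_right _ _
    rw [le_div_iff₀ (by positivity)] at he2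
    have hm : b - e ∈ Set.Icc b0 b1 := ⟨by linarith, by linarith⟩
    have h5 := hlow _ hm
    have := hmax _ hm
    have e1 : b - e - b = -e := by ring
    rw [e1] at h5
    have h3 : -S * e ≤ Q * e * e := by nlinarith
    have h4 := le_of_mul_le_mul_right h3 he0
    nlinarith

/-- Optimality conditions of the saddle point, with quadratic growth in `r`. -/
structure IsSaddle {N : ℕ} (σ ν L n : ℝ) (θ : Fin N → ℝ) (b r : ℝ) : Prop where
  radius : ν * r ^ 2 = σ ^ 2 + rho2 L n θ b r
  slope : b = ν * r + kap L n θ b r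

theorem IsSaddle.growth {N : ℕ} {σ ν L n b r s : ℝ} {θ : Fin N → ℝ} (h : IsSaddle σ ν L n θ b r)
    (hn : 0 < n) (hL : 0 ≤ L) (hb : 0 < b) (hr : 0 < r) (hs : 0 < s) :
    Phi σ ν L n θ b r + b * σ ^ 2 * (s - r) ^ 2 / (2 * s * r ^ 2) ≤ Phi σ ν L n θ b s := by
  refine le_trans (le_of_eq ?_) (Phi_ge_r θ hn hL hb hr hs)
  have h1 : rho2 L n θ b r = ν * r ^ 2 - σ ^ 2 := by linarith [h.radius]
  rw [h1]
  field_simp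
  ring

theorem IsSaddle.value {N : ℕ} {σ ν L n b r : ℝ} {θ : Fin N → ℝ} (h : IsSaddle σ ν L n θ b r)
    (hL : 0 ≤ L) (hb : 0 < b) (hr : 0 < r) :
    Phi σ ν L n θ b r = b ^ 2 / 2 + L * penE L n θ b r := by
  rw [Phi_eq θ hL hb hr, ← h.radius]
  have h1 : kap L n θ b r = b - ν * r := by linarith [h.slope]
  rw [h1]
  field_simp
  ring

/-- First order condition for the minimum of `x ↦ ν x / 2 + t / (2 x)` on `[σ / 2, R]`. -/
theorem radius_of_touch {σ ν R r t2 : ℝ} (hσ : 0 < σ) (hν0 : 0 < ν) (hν1 : ν ≤ 1)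
    (hr : r ∈ Set.Icc (σ / 2) R) (hrR : r < R) (ht2 : σ ^ 2 ≤ t2)
    (hq : ∀ x ∈ Set.Icc (σ / 2) R, ν * r / 2 + t2 / (2 * r) ≤ ν * x / 2 + t2 / (2 * x)) :
    ν * r ^ 2 = t2 := by
  have hr0 : 0 < r := by linarith [hr.1]
  have hq' : ∀ x ∈ Set.Icc (σ / 2) R, 0 ≤ (x - r) * (ν * (x * r) - t2) := by
    intro x hx
    have hx0 : 0 < x := by linarith [hx.1]
    have h1 := hq x hx
    have h2 : (ν * x / 2 + t2 / (2 * x)) - (ν * r / 2 + t2 / (2 * r))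
      = (x - r) * (ν * (x * r) - t2) / (2 * (x * r)) := by field_simp; ring
    have h3 : 0 ≤ (x - r) * (ν * (x * r) - t2) / (2 * (x * r)) := by linarith
    have h4 : 0 < 2 * (x * r) := by positivity
    rw [le_div_iff₀ h4] at h3
    linarith
  by_contra hne
  rcases lt_or_gt_of_ne hne with hlt | hgt
  · -- move the radius up
    have hm : 0 < t2 - ν * r ^ 2 := by linarith
    set e := min (R - r) ((t2 - ν * r ^ 2) / (2 * (ν * r))) with he
    have he0 : 0 < e := lt_min (by linarith) (by positivity)
    have he1 : e ≤ R - r := min_le_left _ _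
    have he2 : e ≤ (t2 - ν * r ^ 2) / (2 * (ν * r)) := min_le_right _ _
    rw [le_div_iff₀ (by positivity)] at he2
    have h1 := hq' (r + e) ⟨by linarith [hr.1], by linarith⟩
    have h2 : 0 ≤ e * (ν * ((r + e) * r) - t2) := by
      have : r + e - r = e := by ring
      rwa [this] at h1
    have h3 : 0 ≤ ν * ((r + e) * r) - t2 := by
      by_contra h; push Not at h; nlinarith
    nlinarith
  · have hrσ : σ / 2 < r := by
      by_contra h
      push Not at h
      have : ν * r ^ 2 ≤ 1 * (σ / 2) ^ 2 := by gcongr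
      nlinarith
    have hm : 0 < ν * r ^ 2 - t2 := by linarith
    set e := min (r - σ / 2) ((ν * r ^ 2 - t2) / (2 * (ν * r))) with he
    have he0 : 0 < e := lt_min (by linarith) (by positivity)
    have he1 : e ≤ r - σ / 2 := min_le_left _ _
    have he2 : e ≤ (ν * r ^ 2 - t2) / (2 * (ν * r)) := min_le_right _ _
    rw [le_div_iff₀ (by positivity)] at he2
    have h1 := hq' (r - e) ⟨by linarith, by linarith⟩
    have h2 : e * (ν * ((r - e) * r) - t2) ≤ 0 := by
      have : r - e - r = -e := by ring
      rw [this] at h1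
      linarith
    have h3 : ν * ((r - e) * r) - t2 ≤ 0 := by
      by_contra h; push Not at h; nlinarith
    nlinarith

set_option maxHeartbeats 1000000 in
theorem exists_isSaddle {σ δ K α κ Lmin Lmax s : ℝ} (hσ : 0 < σ) (hδ : 0 < δ) (hK : 0 ≤ K)
    (hα : 0 < α) (hκ : 0 < κ) (hL : 0 < Lmin) (hLL : Lmin ≤ Lmax) :
    ∃ R b0 b1 : ℝ, σ < R ∧ 0 < b0 ∧ b0 ≤ b1 ∧
      ∀ (N : ℕ) (n ν L : ℝ) (θ : Fin N → ℝ), 0 < N → n = δ * N → 1 / 2 ≤ ν → ν ≤ 1 →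
        Lmin ≤ L → L ≤ Lmax → BelowThreshold δ ν K s α κ θ →
        ∃ b r, b0 ≤ b ∧ b ≤ b1 ∧ σ ≤ r ∧ r ≤ R ∧ IsSaddle σ ν L n θ b r := by
  have hLmax : 0 < Lmax := hL.trans_le hLL
  set η := κ / (2 * δ) with hη
  have hηpos : 0 < η := by positivity
  -- threshold on the radius from coercivity
  set c1 := Lmin / α * (κ / (2 * δ)) with hc1
  have hc1pos : 0 < c1 := by positivity
  set C0 := (Lmax / α) ^ 2 / 2 + 2 * Lmax * K / δ with hC0
  have hC0pos : 0 < C0 := by positivity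
  set R := (C0 + σ ^ 2 / 2) / c1 + 2 * σ with hR
  have hR0 : σ < R := by have : 0 < (C0 + σ ^ 2 / 2) / c1 := by positivity
                         linarith
  set A := 2 * (1 + η) * α / η + 2 * K / σ with hA
  have hApos : 0 < A := by positivity
  set b0 := min (min (Lmin / A) (Lmin / α)) (σ * κ / (8 * δ)) with hb0
  have hb0pos : 0 < b0 := lt_min (lt_min (by positivity) (by positivity)) (by positivity)
  have hb0A : b0 ≤ Lmin / A := (min_le_left _ _).trans (min_le_left _ _)
  have hb0α : b0 ≤ Lmin / α := (min_le_left _ _).trans (min_le_right _ _)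
  have hb0κ : b0 ≤ σ * κ / (8 * δ) := min_le_right _ _
  set b1 := Lmax / α + R + 1 with hb1
  have hRpos : 0 < R := hσ.trans hR0
  have hb1α : Lmax / α ≤ b1 := by linarith
  have hmm : Lmin / α ≤ Lmax / α := by gcongr
  refine ⟨R, b0, b1, hR0, hb0pos, by linarith, ?_⟩
  intro N n ν L θ hN hn hν hν1 hL1 hL2 hθ
  have hN' : (0 : ℝ) < N := by exact_mod_cast hN
  have hn0 : 0 < n := by rw [hn]; positivity
  have hL0 : 0 < L := hL.trans_le hL1
  have hb01 : b0 ≤ b1 := by linarith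
  obtain ⟨r, hr, b, hb, hsad⟩ := Sion.exists_isSaddlePointOn (X := Set.Icc (σ / 2) R)
    (Y := Set.Icc b0 b1) (f := fun r b => Phi σ ν L n θ b r)
    ⟨σ, by linarith, hR0.le⟩ (convex_Icc _ _) isCompact_Icc
    (fun b hb => ContinuousOn.lowerSemicontinuousOn
      ((Phi_convex θ hn0 hL0.le (hb0pos.trans_le hb.1)).continuousOn isOpen_Ioi |>.mono
        fun x hx => show (0 : ℝ) < x by linarith [hx.1]))
    (fun b hb => ((Phi_convex θ hn0 hL0.le (hb0pos.trans_le hb.1)).subset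
      (fun x hx => show (0 : ℝ) < x by linarith [hx.1]) (convex_Icc _ _)).quasiconvexOn)
    (convex_Icc _ _) ⟨b0, le_rfl, hb01⟩ isCompact_Icc
    (fun r hr => ContinuousOn.upperSemicontinuousOn
      ((Phi_concave θ hn0 hL0.le (show 0 < r by linarith [hr.1])).continuousOn isOpen_Ioi |>.mono
        fun x hx => show (0 : ℝ) < x by linarith [hx.1]))
    (fun r hr => ((Phi_concave θ hn0 hL0.le (show 0 < r by linarith [hr.1])).subset
      (fun x hx => show (0 : ℝ) < x by linarith [hx.1]) (convex_Icc _ _)).quasiconcaveOn)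
  have hr0 : 0 < r := by linarith [hr.1]
  have hbp : 0 < b := hb0pos.trans_le hb.1
  have hmin : ∀ x ∈ Set.Icc (σ / 2) R, Phi σ ν L n θ b r ≤ Phi σ ν L n θ b x :=
    fun x hx => hsad x hx b hb
  have hmax : ∀ y ∈ Set.Icc b0 b1, Phi σ ν L n θ y r ≤ Phi σ ν L n θ b r :=
    fun y hy => hsad r hr y hy
  have hρ := rho2_nonneg (L := L) (b := b) (r := r) θ hn0
  have hν0 : 0 < ν := by linarith
  -- the radius is interior
  have hrR : r < R := by
    have h1 := Phi_coercive (σ := σ) hN hδ hn hL0 hα hr0 hK hθ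
    have hbar : L / α ∈ Set.Icc b0 b1 :=
      ⟨hb0α.trans (by gcongr), le_trans (by gcongr) hb1α⟩
    have h2 := hmax _ hbar
    have h3 := hmin σ ⟨by linarith, hR0.le⟩
    have h4 : Phi σ ν L n θ b σ ≤ σ ^ 2 / 2 := by
      unfold Phi
      have h5 : avgE n θ (optM L b σ) ≤ 0 := by
        unfold avgE
        exact mul_nonpos_of_nonneg_of_nonpos (by positivity) (Finset.sum_nonpos fun j _ =>
          integral_nonpos fun h => optM_nonpos hL0.le hbp hσ _ _)
      have h6 : b * (ν * σ / 2 + σ ^ 2 / (2 * σ)) ≤ b * σ := by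
        refine mul_le_mul_of_nonneg_left ?_ hbp.le
        have : σ ^ 2 / (2 * σ) = σ / 2 := by field_simp
        rw [this]
        have : ν * σ ≤ 1 * σ := mul_le_mul_of_nonneg_right hν1 hσ.le
        linarith
      linarith [sq_nonneg (b - σ)]
    have h5 : c1 * r ≤ C0 + σ ^ 2 / 2 := by
      have h6 : c1 * r ≤ L / α * (κ / (2 * δ)) * r := by rw [hc1]; gcongr
      have h7 : (L / α) ^ 2 / 2 + 2 * L * K / δ ≤ C0 := by rw [hC0]; gcongr
      linarith
    have h6 : r ≤ (C0 + σ ^ 2 / 2) / c1 := by rw [le_div_iff₀ hc1pos]; linarith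
    linarith
  -- stationarity in the radius
  have hrad : ν * r ^ 2 = σ ^ 2 + rho2 L n θ b r := by
    set t2 := σ ^ 2 + rho2 L n θ b r with ht2
    have ht2pos : 0 < t2 := by positivity
    have hq : ∀ x ∈ Set.Icc (σ / 2) R, ν * r / 2 + t2 / (2 * r) ≤ ν * x / 2 + t2 / (2 * x) := by
      intro x hx
      have hx0 : 0 < x := by linarith [hx.1]
      have h1 := hmin x hx
      have h2 := Phi_le (σ := σ) (ν := ν) θ hn0 hL0.le hbp hr0 hbp hx0
      rw [Phi_eq θ hL0.le hbp hr0] at h1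
      have h3 : b * (ν * r / 2 + t2 / (2 * r)) ≤ b * (ν * x / 2 + t2 / (2 * x)) := by linarith
      exact le_of_mul_le_mul_left h3 hbp
    exact radius_of_touch hσ hν0 hν1 hr hrR (by linarith) hq
  have hrσ : σ ≤ r := by
    by_contra h
    push Not at h
    have : ν * r ^ 2 < 1 * σ ^ 2 := by
      calc ν * r ^ 2 ≤ 1 * r ^ 2 := by gcongr
        _ < 1 * σ ^ 2 := by gcongr
    linarith
  -- stationarity in the slope
  obtain ⟨Q, hQ, hQb⟩ := Phi_ge_b (σ := σ) (ν := ν) θ hn0 hL0.le hbp hr0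
  have hS : ν * r / 2 + (σ ^ 2 + rho2 L n θ b r) / (2 * r) + kap L n θ b r - b
      = ν * r + kap L n θ b r - b := by
    rw [← hrad]; field_simp; ring
  have htouch := slope_sign_of_touch (f := fun c => Phi σ ν L n θ c r) (b := b)
    (S := ν * r + kap L n θ b r - b) (Q := Q / b0 + 1 / 2) (by positivity) hb.1 hb.2
    (fun c hc => by
      have hc0 : 0 < c := hb0pos.trans_le hc.1
      refine le_trans ?_ (hQb c hc0)
      rw [← hS]
      have h1 : (c - b) ^ 2 * Q / c ≤ (c - b) ^ 2 * Q / b0 := by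
        gcongr
        exact hc.1
      have h2 : (Q / b0 + 1 / 2) * (c - b) ^ 2 = (c - b) ^ 2 * Q / b0 + (c - b) ^ 2 / 2 := by ring
      rw [h2]
      linarith) hmax
  have hk0 := kap_nonpos θ hn0 hL0.le hbp hr0
  have hbb1 : b < b1 := by
    by_contra h
    push Not at h
    have h1 := htouch.2 (by have : 0 < Lmin / α := by positivity
                            linarith)
    have h2 : ν * r ≤ 1 * R := by gcongr
    have : 0 < Lmax / α := by positivity
    linarith
  have hbb0 : b0 < b := by
    by_contra h
    push Not at h
    have hbe : b = b0 := le_antisymm h hb.1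
    have h1 := htouch.1 hbb1
    have h2 := neg_kap_le (η := η) (b := b) (r := r) hN hδ hn hL0.le hbp hα hr0 hηpos hθ (by
      have h3 : A ≤ L / b := by
        rw [le_div_iff₀ hbp, hbe]
        rw [le_div_iff₀ hApos] at hb0A
        linarith
      have h4 : K / r ≤ 2 * K / σ := by
        rw [div_le_div_iff₀ hr0 hσ]
        have := mul_le_mul_of_nonneg_left (show σ ≤ 2 * r by linarith) hK
        linarith
      linarith)
    have h3 : (1 + η) * (ν * δ - κ) ≤ ν * δ - κ / 2 := by
      have h4 : η * (2 * δ) = κ := by rw [hη]; field_simp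
      have h5 := mul_pos hηpos hκ
      have h6 := mul_le_mul_of_nonneg_left hν1 (mul_pos hηpos hδ).le
      linarith
    have h4 : r / δ * ((1 + η) * (ν * δ - κ)) ≤ r / δ * (ν * δ - κ / 2) := by gcongr
    have h5 : r / δ * (ν * δ - κ / 2) = ν * r - r * κ / (2 * δ) := by field_simp
    have h6 : σ * κ / (8 * δ) < r * κ / (2 * δ) := by
      rw [div_lt_div_iff₀ (by positivity) (by positivity)]
      have : 0 < κ * δ := by positivity
      have := mul_lt_mul_of_pos_right (show σ < 4 * r by linarith) this
      linarith
    linarith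
  have hs1 := htouch.1 hbb1
  have hs2 := htouch.2 hbb0
  exact ⟨b, r, hb.1, hb.2, hrσ, hr.2, hrad, by linarith⟩

theorem concentration_marginal {K A : ℝ} (hK : 0 < K) (hA : 0 ≤ A) : ∃ c : ℝ, 0 < c ∧
    ∀ (ι κ : Type) [Fintype ι] [Fintype κ] (f : ι → κ) (_ : Function.Injective f)
      (F : ι → ℝ → ℝ) (n ε : ℝ), (∀ j, Continuous (F j)) →
      (∀ j x, |F j x| ≤ K * (1 + x ^ 2)) → (Fintype.card ι : ℝ) ≤ A * n → 0 ≤ n → 0 ≤ ε → ε ≤ 1 →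
      (gaussPi κ) {g | ¬ |∑ j, (F j (g (f j)) - ∫ y, F j y ∂(gaussianReal 0 1))| ≤ ε * n}
        ≤ ENNReal.ofReal (2 * Real.exp (- c * n * ε ^ 2)) := by
  obtain ⟨c, hc, h⟩ := gaussPi_concentration K hK
  refine ⟨c / (A + 1), by positivity, ?_⟩
  intro ι κ _ _ f hf F n ε hF hb hcard hn hε hε1
  have hA1 : (0 : ℝ) < A + 1 := by linarith
  have hcard' : (Fintype.card ι : ℝ) ≤ (A + 1) * n := by linarith
  have hε' : ε / (A + 1) ≤ 1 := by rw [div_le_one hA1]; linarith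
  have e1 : ε / (A + 1) * ((A + 1) * n) = ε * n := by field_simp
  have e2 : -c * ((A + 1) * n) * (ε / (A + 1)) ^ 2 = -(c / (A + 1)) * n * ε ^ 2 := by field_simp
  have h1 := h ι F ((A + 1) * n) (ε / (A + 1)) (fun j => (hF j).measurable) hb hcard'
    (by positivity) hε'
  have h2 := h ι (fun j x => - F j x) ((A + 1) * n) (ε / (A + 1)) (fun j => (hF j).neg.measurable)
    (fun j x => by rw [abs_neg]; exact hb j x) hcard' (by positivity) hε'
  rw [e1, e2] at h1 h2
  have hp := gaussPi_reindex f hf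
  have hsub : {g : κ → ℝ | ¬ |∑ j, (F j (g (f j)) - ∫ y, F j y ∂(gaussianReal 0 1))| ≤ ε * n} ⊆
      (fun (x : κ → ℝ) (c : ι) => x (f c)) ⁻¹'
        ({h | ε * n ≤ ∑ j, (F j (h j) - ∫ y, F j y ∂(gaussianReal 0 1))} ∪
          {h | ε * n ≤ ∑ j, (- F j (h j) - ∫ y, - F j y ∂(gaussianReal 0 1))}) := by
    intro g hg
    have hg' : ε * n < |∑ j, (F j (g (f j)) - ∫ y, F j y ∂(gaussianReal 0 1))| := not_le.1 hg
    rcases lt_abs.1 hg' with h | h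
    · exact Or.inl h.le
    · refine Or.inr (h.le.trans (le_of_eq ?_))
      rw [← Finset.sum_neg_distrib]
      refine Finset.sum_congr rfl fun j _ => ?_
      rw [integral_neg]; ring
  refine (measure_mono hsub).trans ?_
  refine (Measure.le_map_apply hp.measurable.aemeasurable _).trans ?_
  rw [hp.map_eq]
  refine (measure_union_le _ _).trans ((add_le_add h1 h2).trans ?_)
  rw [← ENNReal.ofReal_add (Real.exp_pos _).le (Real.exp_pos _).le]
  exact ENNReal.ofReal_le_ofReal (by linarith)

/-- Residual of a row at displacement `w`, for the standardised Gaussian array `G`. -/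
def resid {R : Type*} {N : ℕ} (σ n : ℝ) (G : R × Option (Fin N) → ℝ) (w : Fin N → ℝ) (r : R) : ℝ :=
  (∑ j, w j * G (r, some j)) / √n - σ * G (r, none)

/-- Effective noise level of a displacement. -/
def tau {N : ℕ} (σ n : ℝ) (w : Fin N → ℝ) : ℝ := √(σ ^ 2 + (∑ j, w j ^ 2) / n)

/-- Increment of the `ℓ¹` norm. -/
def pen {N : ℕ} (θ w : Fin N → ℝ) : ℝ := ∑ j, (|θ j + w j| - |θ j|)

/-- Outer vector of the bilinear form. -/
def aug {N : ℕ} (σ n : ℝ) (w : Fin N → ℝ) (c : Option (Fin N)) : ℝ := c.elim (-σ * √n) w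

theorem tau_sq {N : ℕ} {σ n : ℝ} (hn : 0 < n) (w : Fin N → ℝ) :
    tau σ n w ^ 2 = σ ^ 2 + (∑ j, w j ^ 2) / n := by
  unfold tau
  rw [Real.sq_sqrt]
  have : 0 ≤ ∑ j, w j ^ 2 := Finset.sum_nonneg fun _ _ => sq_nonneg _
  positivity

theorem tau_nonneg {N : ℕ} (σ n : ℝ) (w : Fin N → ℝ) : 0 ≤ tau σ n w := Real.sqrt_nonneg _

theorem le_tau {N : ℕ} {σ n : ℝ} (hn : 0 < n) (w : Fin N → ℝ) : σ ≤ tau σ n w := by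
  have h := tau_sq (σ := σ) hn w
  have h1 : 0 ≤ (∑ j, w j ^ 2) / n :=
    div_nonneg (Finset.sum_nonneg fun _ _ => sq_nonneg _) hn.le
  exact le_of_sq_le_sq (by linarith) (tau_nonneg _ _ _)

theorem continuous_tau {N : ℕ} (σ n : ℝ) : Continuous (tau (N := N) σ n) := by
  unfold tau; fun_prop

theorem continuous_pen {N : ℕ} (θ : Fin N → ℝ) : Continuous (pen θ) := by
  unfold pen; fun_prop

theorem nrm_aug {N : ℕ} {σ n : ℝ} (hn : 0 < n) (w : Fin N → ℝ) :
    nrm (aug σ n w) = √n * tau σ n w := by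
  unfold nrm tau
  rw [← Real.sqrt_mul hn.le, Fintype.sum_option]
  congr 1
  simp only [aug, Option.elim]
  rw [mul_pow, Real.sq_sqrt hn.le]
  field_simp

theorem sum_aug_row {R : Type*} {N : ℕ} {σ n : ℝ} (hn : 0 < n) (G : R × Option (Fin N) → ℝ)
    (w : Fin N → ℝ) (r : R) : ∑ c, aug σ n w c * G (r, c) = √n * resid σ n G w r := by
  rw [Fintype.sum_option]
  simp only [aug, Option.elim, resid]
  have : √n ≠ 0 := (Real.sqrt_pos.2 hn).ne'
  field_simp
  ring

theorem sum_aug {N : ℕ} {σ n : ℝ} (h : Option (Fin N) → ℝ) (w : Fin N → ℝ) :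
    ∑ c, aug σ n w c * h c = ∑ j, w j * h (some j) - σ * √n * h none := by
  rw [Fintype.sum_option]
  simp only [aug, Option.elim]
  ring

theorem sum_bilin {R : Type*} [Fintype R] {N : ℕ} {σ n : ℝ} (hn : 0 < n) (p : R → ℝ)
    (G : R × Option (Fin N) → ℝ) (w : Fin N → ℝ) :
    ∑ rc : R × Option (Fin N), p rc.1 * aug σ n w rc.2 * G rc
      = √n * ∑ r, p r * resid σ n G w r := by
  rw [Fintype.sum_prod_type, Finset.mul_sum]
  refine Finset.sum_congr rfl fun r _ => ?_
  have : ∑ c, p r * aug σ n w c * G (r, c) = p r * ∑ c, aug σ n w c * G (r, c) := by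
    rw [Finset.mul_sum]; exact Finset.sum_congr rfl fun c _ => by ring
  rw [this, sum_aug_row hn]
  ring

theorem abs_sub_sqrt_le {x a n ε : ℝ} (hn : 0 < n) (hx : 0 ≤ x) (ha : 0 < a)
    (h : |x ^ 2 - a ^ 2 * n| ≤ ε * n) : |x / √n - a| ≤ ε / a := by
  have hs : 0 < √n := Real.sqrt_pos.2 hn
  have hs2 : √n ^ 2 = n := Real.sq_sqrt hn.le
  have h1 : x ^ 2 - a ^ 2 * n = (x / √n - a) * (x / √n + a) * n := by
    have hu : x = x / √n * √n := by field_simp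
    have hx2 : x ^ 2 = (x / √n) ^ 2 * n := by
      nth_rewrite 1 [hu]
      rw [mul_pow, hs2]
    rw [hx2]; ring
  have h2 : 0 ≤ x / √n := by positivity
  rw [h1, abs_mul, abs_mul, abs_of_pos hn, abs_of_nonneg (show 0 ≤ x / √n + a by linarith)] at h
  have h3 := le_of_mul_le_mul_right h hn
  rw [le_div_iff₀ ha]
  refine le_trans ?_ h3
  gcongr
  linarith

/-- Typical behaviour of the Gaussian vectors in the decoupled problem. -/
structure GoodDraw {R1 R2 : Type} [Fintype R1] [Fintype R2] {N : ℕ} (n ν a L b r ε : ℝ)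
    (θ : Fin N → ℝ) (g : (R1 ⊕ R2) ⊕ Option (Fin N) → ℝ) : Prop where
  train : |nrm (fun i : R1 => g (Sum.inl (Sum.inl i))) ^ 2 - ν * n| ≤ ε * n
  fold : |nrm (fun i : R2 => g (Sum.inl (Sum.inr i))) ^ 2 - a ^ 2 * n| ≤ ε * n
  field : ∑ j, g (Sum.inr (some j)) ^ 2 ≤ N + n
  noise : |g (Sum.inr none)| ≤ ε * √n
  envelope : |∑ j, optM L b r (θ j) (g (Sum.inr (some j))) - n * avgE n θ (optM L b r)| ≤ ε * n
  radius : |∑ j, optW (L / b) r (θ j) (g (Sum.inr (some j))) ^ 2 - n * rho2 L n θ b r| ≤ ε * n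
  corr : |∑ j, g (Sum.inr (some j)) * optW (L / b) r (θ j) (g (Sum.inr (some j)))
    - n * kap L n θ b r| ≤ ε * n
  penalty : |∑ j, (|θ j + optW (L / b) r (θ j) (g (Sum.inr (some j)))| - |θ j|)
    - n * penE L n θ b r| ≤ ε * n

set_option maxHeartbeats 1000000 in
theorem prob_not_goodDraw {δ b0 b1 r0 r1 Lmax : ℝ} (hδ : 0 < δ) (hb0 : 0 < b0) (hb01 : b0 ≤ b1)
    (hr0 : 0 < r0) (hr01 : r0 ≤ r1) (hLmax : 0 ≤ Lmax) :
    ∃ c : ℝ, 0 < c ∧ ∀ (R1 R2 : Type) [Fintype R1] [Fintype R2] (N : ℕ) (n ν a L b r ε : ℝ)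
      (θ : Fin N → ℝ), 0 < N → n = δ * N → 0 ≤ ν → ν ≤ 1 → 0 ≤ a → a ≤ 1 →
      (Fintype.card R1 : ℝ) = ν * n → (Fintype.card R2 : ℝ) = a ^ 2 * n → 0 ≤ L → L ≤ Lmax →
      b0 ≤ b → b ≤ b1 → r0 ≤ r → r ≤ r1 → 0 < ε → ε ≤ 1 →
      gaussPi ((R1 ⊕ R2) ⊕ Option (Fin N)) {g | ¬ GoodDraw n ν a L b r ε θ g}
        ≤ ENNReal.ofReal (16 * Real.exp (- c * n * ε ^ 2)) := by
  set α := Lmax / b0 with hα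
  have hα0 : 0 ≤ α := by positivity
  have hr1 : 0 < r1 := hr0.trans_le hr01
  have hb1 : 0 < b1 := hb0.trans_le hb01
  obtain ⟨c, hc, H⟩ := concentration_marginal
    (K := 1 + b1 * r1 * (1 + α ^ 2) + 2 * r1 ^ 2 * (1 + α ^ 2) + r1 * (1 + α)) (A := 1 + 1 / δ)
    (by positivity) (by positivity)
  refine ⟨min c (1 / 2), by positivity, ?_⟩
  intro R1 R2 _ _ N n ν a L b r ε θ hN hn hν hν1 ha ha1 hR1 hR2 hL hL1 hb hb' hr hr' hε hε1
  have hN' : (0 : ℝ) < N := by exact_mod_cast hN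
  have hn0 : 0 < n := by rw [hn]; positivity
  have hbp : 0 < b := hb0.trans_le hb
  have hrp : 0 < r := hr0.trans_le hr
  have hα' : 0 ≤ L / b := by positivity
  have hαα : L / b ≤ α := by rw [hα]; gcongr
  have hNA : (N : ℝ) ≤ (1 + 1 / δ) * n := by
    have : (1 + 1 / δ) * n = n + N := by rw [hn]; field_simp
    linarith
  have hnA : n ≤ (1 + 1 / δ) * n := by
    have : 0 ≤ 1 / δ * n := by positivity
    linarith
  set K := 1 + b1 * r1 * (1 + α ^ 2) + 2 * r1 ^ 2 * (1 + α ^ 2) + r1 * (1 + α) with hKdef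
  have hK1 : 1 ≤ K := by
    have : 0 ≤ b1 * r1 * (1 + α ^ 2) + 2 * r1 ^ 2 * (1 + α ^ 2) + r1 * (1 + α) := by positivity
    linarith
  have hp1 : 0 ≤ b1 * r1 * (1 + α ^ 2) := by positivity
  have hp2 : 0 ≤ 2 * r1 ^ 2 * (1 + α ^ 2) := by positivity
  have hp3 : 0 ≤ r1 * (1 + α) := by positivity
  have sqb : ∀ x : ℝ, |x ^ 2| ≤ K * (1 + x ^ 2) := fun x => by
    rw [abs_of_nonneg (sq_nonneg x)]
    nlinarith [sq_nonneg x]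
  have b1' : ∀ θ x : ℝ, |optM L b r θ x| ≤ K * (1 + x ^ 2) := fun θ x => by
    refine (abs_optM_le hL hbp hrp θ x).trans ?_
    have h1 : b * r * (1 + (L / b) ^ 2) ≤ b1 * r1 * (1 + α ^ 2) := by gcongr
    gcongr; linarith
  have b2' : ∀ θ x : ℝ, |optW (L / b) r θ x ^ 2| ≤ K * (1 + x ^ 2) := fun θ x => by
    rw [abs_of_nonneg (sq_nonneg _)]
    refine (sq_optW_le hα' hrp θ x).trans ?_
    have h1 : 2 * r ^ 2 * (1 + (L / b) ^ 2) ≤ 2 * r1 ^ 2 * (1 + α ^ 2) := by gcongr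
    gcongr; linarith
  have b3' : ∀ θ x : ℝ, |x * optW (L / b) r θ x| ≤ K * (1 + x ^ 2) := fun θ x => by
    refine (abs_mul_optW_le hα' hrp θ x).trans ?_
    have h1 : r * (1 + L / b) ≤ r1 * (1 + α) := by gcongr
    gcongr; linarith
  have b4' : ∀ θ x : ℝ, abs (|θ + optW (L / b) r θ x| - |θ|) ≤ K * (1 + x ^ 2) := fun θ x => by
    refine (abs_pen_le hα' hrp θ x).trans ?_
    have h1 : r * (1 + L / b) ≤ r1 * (1 + α) := by gcongr
    gcongr; linarith
  let κ := (R1 ⊕ R2) ⊕ Option (Fin N)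
  have iR1 : Function.Injective fun i : R1 => (Sum.inl (Sum.inl i) : κ) := fun _ _ h => by simpa using h
  have iR2 : Function.Injective fun i : R2 => (Sum.inl (Sum.inr i) : κ) := fun _ _ h => by simpa using h
  have iN : Function.Injective fun j : Fin N => (Sum.inr (some j) : κ) := fun _ _ h => by simpa using h
  have E1 := H R1 κ _ iR1 (fun _ x => x ^ 2) n ε (fun _ => by fun_prop) (fun _ => sqb)
    (by rw [hR1]; nlinarith) hn0.le hε.le hε1
  have E2 := H R2 κ _ iR2 (fun _ x => x ^ 2) n ε (fun _ => by fun_prop) (fun _ => sqb)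
    (by rw [hR2]; nlinarith [sq_nonneg a, mul_nonneg ha hn0.le, mul_le_mul_of_nonneg_right ha1 ha]) hn0.le hε.le hε1
  have E3 := H (Fin N) κ _ iN (fun _ x => x ^ 2) n ε (fun _ => by fun_prop) (fun _ => sqb)
    (by simpa using hNA) hn0.le hε.le hε1
  have E4 := H (Fin N) κ _ iN (fun j => optM L b r (θ j)) n ε (fun j => continuous_optM _ _ _ _)
    (fun j => b1' _) (by simpa using hNA) hn0.le hε.le hε1
  have E5 := H (Fin N) κ _ iN (fun j x => optW (L / b) r (θ j) x ^ 2) n ε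
    (fun j => (continuous_optW _ _ _).pow 2)
    (fun j => b2' _) (by simpa using hNA) hn0.le hε.le hε1
  have E6 := H (Fin N) κ _ iN (fun j x => x * optW (L / b) r (θ j) x) n ε
    (fun j => continuous_id.mul (continuous_optW _ _ _))
    (fun j => b3' _) (by simpa using hNA) hn0.le hε.le hε1
  have E7 := H (Fin N) κ _ iN (fun j x => |θ j + optW (L / b) r (θ j) x| - |θ j|) n ε
    (fun j => ((continuous_const.add (continuous_optW _ _ _)).abs).sub continuous_const)
    (fun j => b4' _) (by simpa using hNA) hn0.le hε.le hε1
  have E8 : gaussPi κ {g | ¬ |g (Sum.inr none)| ≤ ε * √n} ≤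
      ENNReal.ofReal (2 * Real.exp (- (1 / 2) * n * ε ^ 2)) := by
    have hp := gaussPi_eval (ι := κ) (Sum.inr none)
    have h1 : {g : κ → ℝ | ¬ |g (Sum.inr none)| ≤ ε * √n} ⊆
        (fun g : κ → ℝ => g (Sum.inr none)) ⁻¹' {x | ε * √n ≤ |x|} := fun g hg => (not_le.1 hg).le
    refine (measure_mono h1).trans ((Measure.le_map_apply hp.measurable.aemeasurable _).trans ?_)
    rw [hp.map_eq]
    refine (stdGaussian_tail _ (by positivity)).trans (le_of_eq ?_)
    rw [mul_pow, Real.sq_sqrt hn0.le]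
    congr 3; ring
  have hmc : ∀ c', min c (1 / 2) ≤ c' → ENNReal.ofReal (2 * Real.exp (- c' * n * ε ^ 2)) ≤
      ENNReal.ofReal (2 * Real.exp (- min c (1 / 2) * n * ε ^ 2)) := fun c' h => by
    refine ENNReal.ofReal_le_ofReal ?_
    gcongr 2 * Real.exp ?_
    have : 0 ≤ n * ε ^ 2 := by positivity
    nlinarith
  have hm1 := hmc c (min_le_left _ _)
  have hm2 := hmc (1 / 2) (min_le_right _ _)
  have hinv : ∀ f : ℝ → ℝ → ℝ, n * avgE n θ f = ∑ j, ∫ y, f (θ j) y ∂(gaussianReal 0 1) := fun f => by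
    unfold avgE; field_simp
  refine (measure_mono (t := {g : κ → ℝ | ¬ _} ∪ ({g : κ → ℝ | ¬ _} ∪ ({g : κ → ℝ | ¬ _} ∪
    ({g : κ → ℝ | ¬ _} ∪ ({g : κ → ℝ | ¬ _} ∪ ({g : κ → ℝ | ¬ _} ∪ ({g : κ → ℝ | ¬ _}
      ∪ {g : κ → ℝ | ¬ _}))))))) ?_).trans
    ((measure_union_le _ _).trans (add_le_add (E1.trans hm1)
    ((measure_union_le _ _).trans (add_le_add (E2.trans hm1)
    ((measure_union_le _ _).trans (add_le_add (E3.trans hm1)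
    ((measure_union_le _ _).trans (add_le_add (E4.trans hm1)
    ((measure_union_le _ _).trans (add_le_add (E5.trans hm1)
    ((measure_union_le _ _).trans (add_le_add (E6.trans hm1)
    ((measure_union_le _ _).trans (add_le_add (E7.trans hm1) (E8.trans hm2)))))))))))))) |>.trans ?_)
  · intro g hg
    by_contra hcon
    simp only [Set.mem_union, Set.mem_ofPred_eq, not_or, not_not] at hcon
    obtain ⟨h1, h2, h3, h4, h5, h6, h7, h8⟩ := hcon
    simp only [Finset.sum_sub_distrib, integral_sq_stdGaussian, Finset.sum_const, Finset.card_univ,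
      hR1, hR2, nsmul_eq_mul, mul_one, Fintype.card_fin, ← nrm_sq] at h1 h2 h3
    refine hg ⟨h1, h2, ?_, h8, ?_, ?_, ?_, ?_⟩
    · have := (abs_le.1 h3).2
      rw [nrm_sq] at this
      have : ε * n ≤ 1 * n := by gcongr
      linarith
    · rw [hinv, ← Finset.sum_sub_distrib]; exact h4
    · rw [rho2, hinv, ← Finset.sum_sub_distrib]; exact h5
    · rw [kap, hinv, ← Finset.sum_sub_distrib]; exact h6
    · rw [penE, hinv, ← Finset.sum_sub_distrib]; exact h7
  · have h0 := Real.exp_pos (- min c (1 / 2) * n * ε ^ 2)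
    rw [← ENNReal.ofReal_add (by positivity) (by positivity), ← ENNReal.ofReal_add (by positivity) (by positivity),
      ← ENNReal.ofReal_add (by positivity) (by positivity), ← ENNReal.ofReal_add (by positivity) (by positivity),
      ← ENNReal.ofReal_add (by positivity) (by positivity), ← ENNReal.ofReal_add (by positivity) (by positivity),
      ← ENNReal.ofReal_add (by positivity) (by positivity)]
    exact ENNReal.ofReal_le_ofReal (by linarith)

theorem sum_optM_le {N : ℕ} {L b r : ℝ} (hL : 0 ≤ L) (hb : 0 < b) (hr : 0 < r) (θ w h : Fin N → ℝ) :
    ∑ j, optM L b r (θ j) (h j) ≤ b / (2 * r) * ∑ j, w j ^ 2 + b * ∑ j, w j * h j + L * pen θ w := by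
  unfold pen
  rw [Finset.mul_sum, Finset.mul_sum, Finset.mul_sum, ← Finset.sum_add_distrib,
    ← Finset.sum_add_distrib]
  refine Finset.sum_le_sum fun j _ => (optM_le hL hb hr (θ j) (h j) (w j)).trans (le_of_eq ?_)
  field_simp

theorem nrm_le_of_tau_le {N : ℕ} {σ n τ1 : ℝ} (hn : 0 < n) {w : Fin N → ℝ} (h : tau σ n w ≤ τ1) :
    nrm w ≤ √n * τ1 := by
  have h0 := tau_nonneg σ n w
  have h1 : nrm w ^ 2 ≤ (√n * τ1) ^ 2 := by
    rw [nrm_sq, mul_pow, Real.sq_sqrt hn.le]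
    have h2 := tau_sq (σ := σ) hn w
    have h3 : tau σ n w ^ 2 ≤ τ1 ^ 2 := by gcongr
    have h4 : (∑ j, w j ^ 2) / n ≤ τ1 ^ 2 := by nlinarith [sq_nonneg σ]
    rw [div_le_iff₀ hn] at h4
    linarith
  exact le_of_sq_le_sq h1 (mul_nonneg (Real.sqrt_nonneg _) (h0.trans h))

theorem sqrt_add_sq_le {b y : ℝ} (hb : 0 < b) : √(b ^ 2 + y ^ 2) ≤ b + y ^ 2 / (2 * b) := by
  rw [Real.sqrt_le_left (by positivity)]
  have : (b + y ^ 2 / (2 * b)) ^ 2 = b ^ 2 + y ^ 2 + (y ^ 2 / (2 * b)) ^ 2 := by field_simp; ring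
  rw [this]
  nlinarith [sq_nonneg (y ^ 2 / (2 * b))]

theorem GoodDraw.lower {R1 R2 : Type} [Fintype R1] [Fintype R2] {N : ℕ}
    {σ δ n ν a L b r ε y e τ1 : ℝ} {θ : Fin N → ℝ} {g : (R1 ⊕ R2) ⊕ Option (Fin N) → ℝ}
    (hg : GoodDraw n ν a L b r ε θ g) (hN : 0 < N) (hδ : 0 < δ) (hσ : 0 < σ) (hn : n = δ * N)
    (hν : 1 / 2 ≤ ν) (hν1 : ν ≤ 1) (ha : 0 < a) (hL : 0 ≤ L) (hb : 0 < b) (hr : 0 < r)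
    (hε : 0 < ε) (hε1 : ε ≤ 1) (hy : 0 ≤ y) (hya : y ≤ a) (he : e = 1 ∨ e = -1)
    (w : Fin N → ℝ) (hw : tau σ n w ≤ τ1) :
    n * (Phi σ ν L n θ b r - b / (2 * r) * (tau σ n w - r * √ν) ^ 2 + e * y * a * tau σ n w
        - (√(1 + 1 / δ) * τ1 + σ) / (2 * b) * y ^ 2 - (2 * b * τ1 + τ1 + b * σ + 1) * ε) ≤
      -(b ^ 2 * n / 2) + L * pen θ w + √n * tau σ n w * (b * nrm (fun i : R1 => g (Sum.inl (Sum.inl i)))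
        + e * y * nrm (fun i : R2 => g (Sum.inl (Sum.inr i))))
      + √(b ^ 2 + y ^ 2) * (∑ j, w j * g (Sum.inr (some j)) - σ * √n * g (Sum.inr none)) := by
  have hN' : (0 : ℝ) < N := by exact_mod_cast hN
  have hn0 : 0 < n := by rw [hn]; positivity
  have hs : 0 < √n := Real.sqrt_pos.2 hn0
  have hs2 : √n * √n = n := Real.mul_self_sqrt hn0.le
  have hν0 : 0 < ν := by linarith
  have hsν : 0 < √ν := Real.sqrt_pos.2 hν0
  have hsν2 : √ν ^ 2 = ν := Real.sq_sqrt hν0.le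
  have hsν' : 1 / 2 ≤ √ν := by
    have : 1 / 2 ≤ √ν ^ 2 := by rw [hsν2]; exact hν
    have h1 : √ν ≤ 1 := Real.sqrt_le_one.2 hν1
    nlinarith
  set τ := tau σ n w with hτ
  have hτ0 : 0 ≤ τ := tau_nonneg _ _ _
  have hτ10 : 0 ≤ τ1 := hτ0.trans hw
  set A1 := nrm (fun i : R1 => g (Sum.inl (Sum.inl i))) / √n with hA1
  set A2 := nrm (fun i : R2 => g (Sum.inl (Sum.inr i))) / √n with hA2
  have e1 : nrm (fun i : R1 => g (Sum.inl (Sum.inl i))) = A1 * √n := by rw [hA1]; field_simp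
  have e2 : nrm (fun i : R2 => g (Sum.inl (Sum.inr i))) = A2 * √n := by rw [hA2]; field_simp
  have h1 : |A1 - √ν| ≤ ε / √ν := abs_sub_sqrt_le hn0 (nrm_nonneg _) hsν (by rw [hsν2]; exact hg.train)
  have h2 : |A2 - a| ≤ ε / a := abs_sub_sqrt_le hn0 (nrm_nonneg _) ha hg.fold
  have h1' : √ν - 2 * ε ≤ A1 := by
    have h3 : ε / √ν ≤ 2 * ε := by rw [div_le_iff₀ hsν]; nlinarith
    linarith [(abs_le.1 h1).1]
  have h2' : |e * y * (A2 - a)| ≤ ε := by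
    rw [abs_mul, abs_mul, abs_of_nonneg hy]
    have h3 : |e| = 1 := by rcases he with h | h <;> simp [h]
    rw [h3, one_mul]
    calc y * |A2 - a| ≤ a * (ε / a) := by gcongr
      _ = ε := by field_simp
  rw [e1, e2]
  set H := ∑ j, w j * g (Sum.inr (some j)) with hH
  set h0 := g (Sum.inr none) with hh0
  have hH1 : |H| ≤ n * (√(1 + 1 / δ) * τ1) := by
    refine (abs_sum_mul_le_nrm w (fun j => g (Sum.inr (some j)))).trans ?_
    have h3 := nrm_le_of_tau_le hn0 hw
    have h4 : nrm (fun j => g (Sum.inr (some j))) ≤ √n * √(1 + 1 / δ) := by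
      rw [← Real.sqrt_mul hn0.le]
      refine Real.sqrt_le_sqrt (hg.field.trans (le_of_eq ?_))
      rw [hn]; field_simp; ring
    calc nrm w * nrm (fun j => g (Sum.inr (some j))) ≤ (√n * τ1) * (√n * √(1 + 1 / δ)) :=
          mul_le_mul h3 h4 (nrm_nonneg _) (by positivity)
      _ = (√n * √n) * (√(1 + 1 / δ) * τ1) := by ring
      _ = _ := by rw [hs2]
  have hz : |√n * h0| ≤ n * ε := by
    rw [abs_mul, abs_of_pos hs]
    calc √n * |h0| ≤ √n * (ε * √n) := by gcongr; exact hg.noise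
      _ = (√n * √n) * ε := by ring
      _ = n * ε := by rw [hs2]
  have hz1 : |σ * √n * h0| ≤ n * (σ * ε) := by
    rw [mul_assoc, abs_mul, abs_of_pos hσ]
    calc σ * |√n * h0| ≤ σ * (n * ε) := by gcongr
      _ = _ := by ring
  have hβ := sqrt_add_sq_le (y := y) hb
  have hβ0 : b ≤ √(b ^ 2 + y ^ 2) := Real.le_sqrt_of_sq_le (by nlinarith [sq_nonneg y])
  set β := √(b ^ 2 + y ^ 2) with hβd
  have hX : |H - σ * √n * h0| ≤ n * (√(1 + 1 / δ) * τ1 + σ) := by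
    refine (abs_sub _ _).trans ?_
    have : n * (σ * ε) ≤ n * (σ * 1) := by gcongr
    linarith
  have hfield : b * (H - σ * √n * h0) - n * ((√(1 + 1 / δ) * τ1 + σ) / (2 * b) * y ^ 2)
      ≤ β * (H - σ * √n * h0) := by
    have h5 : (β - b) * |H - σ * √n * h0| ≤ (y ^ 2 / (2 * b)) * (n * (√(1 + 1 / δ) * τ1 + σ)) :=
      mul_le_mul (by linarith) hX (abs_nonneg _) (by positivity)
    have h6 : -((β - b) * |H - σ * √n * h0|) ≤ (β - b) * (H - σ * √n * h0) := by
      rw [← mul_neg]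
      exact mul_le_mul_of_nonneg_left (neg_abs_le _) (by linarith)
    have h7 : (y ^ 2 / (2 * b)) * (n * (√(1 + 1 / δ) * τ1 + σ))
      = n * ((√(1 + 1 / δ) * τ1 + σ) / (2 * b) * y ^ 2) := by ring
    linarith
  have hM := sum_optM_le hL hb hr θ w (fun j => g (Sum.inr (some j)))
  have henv := (abs_le.1 hg.envelope).1
  have hw2 : ∑ j, w j ^ 2 = n * (τ ^ 2 - σ ^ 2) := by
    rw [hτ, tau_sq hn0]; field_simp; ring
  rw [hw2] at hM
  have hbσ : b * (σ * √n * h0) ≤ n * (b * σ * ε) := by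
    have := mul_le_mul_of_nonneg_left ((le_abs_self _).trans hz1) hb.le
    linarith
  have h8 : √n * τ * (b * (A1 * √n) + e * y * (A2 * √n))
      = n * (τ * (b * A1 + e * y * A2)) := by
    have : √n * τ * (b * (A1 * √n) + e * y * (A2 * √n))
      = (√n * √n) * (τ * (b * A1 + e * y * A2)) := by ring
    rw [this, hs2]
  have h9 : τ * (b * √ν) - 2 * b * τ1 * ε ≤ τ * (b * A1) := by
    have h10 : b * (√ν - 2 * ε) ≤ b * A1 := by gcongr
    have h11 := mul_le_mul_of_nonneg_left h10 hτ0
    have h12 : τ * (2 * b * ε) ≤ τ1 * (2 * b * ε) := by gcongr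
    linarith
  have h10 : e * y * a * τ - τ1 * ε ≤ τ * (e * y * A2) := by
    have h11 := mul_le_mul_of_nonneg_left (abs_le.1 h2').1 hτ0
    have h12 : τ * ε ≤ τ1 * ε := by gcongr
    linarith
  have h11 : n * (τ * (b * √ν) - 2 * b * τ1 * ε + (e * y * a * τ - τ1 * ε)) ≤
      n * (τ * (b * A1 + e * y * A2)) := by
    refine mul_le_mul_of_nonneg_left ?_ hn0.le
    linarith
  have h12 : Phi σ ν L n θ b r - b / (2 * r) * (τ - r * √ν) ^ 2
      = τ * (b * √ν) - b / (2 * r) * (τ ^ 2 - σ ^ 2) - b ^ 2 / 2 + avgE n θ (optM L b r) := by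
    unfold Phi
    have : (τ - r * √ν) ^ 2 = τ ^ 2 - 2 * τ * r * √ν + r ^ 2 * √ν ^ 2 := by ring
    rw [this, hsν2]
    field_simp
    ring
  rw [h12, h8]
  linarith

/-- Uniform lower bound for the training objective plus or minus a multiple of the fold residual
norm. -/
theorem base_lower {δ σ b0 b1 r0 r1 Lmax τ1 : ℝ} (hδ : 0 < δ) (hσ : 0 < σ) (hb0 : 0 < b0)
    (hb01 : b0 ≤ b1) (hr0 : 0 < r0) (hr01 : r0 ≤ r1) (hLmax : 0 ≤ Lmax) (hτ1 : 0 ≤ τ1) :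
    ∃ c C1 : ℝ, 0 < c ∧ 0 < C1 ∧ ∀ (R1 R2 : Type) [Fintype R1] [Fintype R2] [Nonempty R1] [Nonempty R2]
      (N : ℕ) (n ν a L b r ε y e : ℝ)
      (θ : Fin N → ℝ), 0 < N → n = δ * N → 1 / 2 ≤ ν → ν ≤ 1 → 0 < a → a ≤ 1 →
      (Fintype.card R1 : ℝ) = ν * n → (Fintype.card R2 : ℝ) = a ^ 2 * n → 0 ≤ L → L ≤ Lmax →
      b0 ≤ b → b ≤ b1 → r0 ≤ r → r ≤ r1 → 0 < ε → ε ≤ 1 → 0 ≤ y → y ≤ a → (e = 1 ∨ e = -1) →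
      gaussPi ((R1 ⊕ R2) × Option (Fin N)) {G | ∃ w, tau σ n w ≤ τ1 ∧
          nrm (fun i : R1 => resid σ n G w (Sum.inl i)) ^ 2 / 2 + L * pen θ w
            + e * y * √n * nrm (fun i : R2 => resid σ n G w (Sum.inr i))
          < n * (Phi σ ν L n θ b r - C1 * (tau σ n w - r * √ν) ^ 2 + e * y * a * tau σ n w
            - C1 * y ^ 2 - ε)}
        ≤ ENNReal.ofReal (32 * Real.exp (- c * n * ε ^ 2)) := by
  obtain ⟨c, hc, H⟩ := prob_not_goodDraw hδ hb0 hb01 hr0 hr01 hLmax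
  have hb1 : 0 < b1 := hb0.trans_le hb01
  set C2 := 2 * b1 * τ1 + τ1 + b1 * σ + 1 with hC2
  have hC2pos : 1 ≤ C2 := by
    have : 0 ≤ 2 * b1 * τ1 + τ1 + b1 * σ := by positivity
    linarith
  set C1 := b1 / (2 * r0) + (√(1 + 1 / δ) * τ1 + σ) / (2 * b0) with hC1
  refine ⟨c / (4 * C2 ^ 2), C1, by positivity, by positivity, ?_⟩
  intro R1 R2 _ _ _ _ N n ν a L b r ε y e θ hN hn hν hν1 ha ha1 hR1 hR2 hL hL1 hb hb' hr hr' hε hε1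
    hy hya he
  have hN' : (0 : ℝ) < N := by exact_mod_cast hN
  have hn0 : 0 < n := by rw [hn]; positivity
  have hs : 0 < √n := Real.sqrt_pos.2 hn0
  have hbp : 0 < b := hb0.trans_le hb
  have hrp : 0 < r := hr0.trans_le hr
  let ε' := ε / (2 * C2)
  have hε' : 0 < ε' := by positivity
  have hε'1 : ε' ≤ 1 := by
    change ε / (2 * C2) ≤ 1
    rw [div_le_one (by positivity)]; linarith
  let target : (Fin N → ℝ) → ℝ := fun w => n * (Phi σ ν L n θ b r - C1 * (tau σ n w - r * √ν) ^ 2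
    + e * y * a * tau σ n w - C1 * y ^ 2 - ε)
  have htc : Continuous target := by
    have := continuous_tau (N := N) σ n
    fun_prop
  let V := Metric.sphere (0 : EuclideanSpace ℝ R2) 1
  let U := Metric.sphere (0 : EuclideanSpace ℝ R1) 1
  have : Nonempty V := (NormedSpace.sphere_nonempty.2 zero_le_one).to_subtype
  have : Nonempty U := (NormedSpace.sphere_nonempty.2 zero_le_one).to_subtype
  let W0 : Type := {w : Fin N → ℝ // tau σ n w ≤ τ1}
  have hVn : ∀ v : V, ∑ i, (v : EuclideanSpace ℝ R2) i ^ 2 = 1 := fun v => by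
    have := v.2
    rw [mem_sphere_zero_iff_norm, EuclideanSpace.norm_eq, Real.sqrt_eq_one] at this
    simpa using this
  have hUn : ∀ v : U, ∑ i, (v : EuclideanSpace ℝ R1) i ^ 2 = 1 := fun v => by
    have := v.2
    rw [mem_sphere_zero_iff_norm, EuclideanSpace.norm_eq, Real.sqrt_eq_one] at this
    simpa using this
  -- a unit vector aligned with a given vector
  have halignV : ∀ x : R2 → ℝ, ∃ v : V, ∑ i, (v : EuclideanSpace ℝ R2) i * x i = nrm x := by
    intro x
    by_cases hx : nrm x = 0
    · obtain ⟨v⟩ := ‹Nonempty V›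
      refine ⟨v, ?_⟩
      have h1 : ∑ i, x i ^ 2 = 0 := by rw [← nrm_sq, hx]; norm_num
      have h2 : ∀ i, x i = 0 := fun i => by
        have := (Finset.sum_eq_zero_iff_of_nonneg fun i _ => sq_nonneg (x i)).1 h1 i (Finset.mem_univ i)
        exact pow_eq_zero_iff (two_ne_zero) |>.1 this
      rw [hx]; simp [h2]
    · refine ⟨⟨WithLp.toLp 2 fun i => x i / nrm x, ?_⟩, ?_⟩
      · rw [mem_sphere_zero_iff_norm, EuclideanSpace.norm_eq, Real.sqrt_eq_one]
        simp only [Real.norm_eq_abs, sq_abs, div_pow, ← Finset.sum_div]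
        rw [← nrm_sq]; field_simp
      · simp only [div_mul_eq_mul_div, ← pow_two, ← Finset.sum_div]
        rw [← nrm_sq]; field_simp
  have halignU : ∀ x : R1 → ℝ, ∃ v : U, ∑ i, (v : EuclideanSpace ℝ R1) i * x i = nrm x := by
    intro x
    by_cases hx : nrm x = 0
    · obtain ⟨v⟩ := ‹Nonempty U›
      refine ⟨v, ?_⟩
      have h1 : ∑ i, x i ^ 2 = 0 := by rw [← nrm_sq, hx]; norm_num
      have h2 : ∀ i, x i = 0 := fun i => by
        have := (Finset.sum_eq_zero_iff_of_nonneg fun i _ => sq_nonneg (x i)).1 h1 i (Finset.mem_univ i)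
        exact pow_eq_zero_iff (two_ne_zero) |>.1 this
      rw [hx]; simp [h2]
    · refine ⟨⟨WithLp.toLp 2 fun i => x i / nrm x, ?_⟩, ?_⟩
      · rw [mem_sphere_zero_iff_norm, EuclideanSpace.norm_eq, Real.sqrt_eq_one]
        simp only [Real.norm_eq_abs, sq_abs, div_pow, ← Finset.sum_div]
        rw [← nrm_sq]; field_simp
      · simp only [div_mul_eq_mul_div, ← pow_two, ← Finset.sum_div]
        rw [← nrm_sq]; field_simp
  let vsel : (W0 × V) × (U × V) → V := fun x => if e = 1 then x.2.2 else x.1.2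
  have hvsel : Continuous vsel := by
    by_cases h : e = 1
    · simp only [vsel, if_pos h]; fun_prop
    · simp only [vsel, if_neg h]; fun_prop
  let p : (W0 × V) × (U × V) → R1 ⊕ R2 → ℝ := fun x => Sum.elim
    (fun i => b * (x.2.1 : EuclideanSpace ℝ R1) i) (fun i => e * y * (vsel x : EuclideanSpace ℝ R2) i)
  let q : (W0 × V) × (U × V) → Option (Fin N) → ℝ := fun x => aug σ n x.1.1.1
  let ψ : (W0 × V) × (U × V) → ℝ := fun x => -(b ^ 2 * n / 2) + L * pen θ x.1.1.1 - target x.1.1.1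
  have hwc : Continuous fun x : ({w : Fin N → ℝ // tau σ n w ≤ τ1} × V) × (U × V) => x.1.1.1 :=
    (continuous_subtype_val (p := fun w => tau σ n w ≤ τ1)).comp
      (continuous_fst.comp continuous_fst)
  have hp : Continuous p := by
    refine continuous_pi fun r => ?_
    rcases r with i | i
    · simp only [p, Sum.elim_inl]
      fun_prop
    · simp only [p, Sum.elim_inr]
      fun_prop
  have hq : Continuous q := by
    refine continuous_pi fun r => ?_
    rcases r with _ | j
    · simp only [q, aug, Option.elim]; fun_prop
    · simp only [q, aug, Option.elim]
      exact (continuous_apply j).comp hwc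
  have hψ : Continuous ψ :=
    (continuous_const.add (continuous_const.mul ((continuous_pen θ).comp hwc))).sub (htc.comp hwc)
  have hpn : ∀ x, nrm (p x) = √(b ^ 2 + y ^ 2) := fun x => by
    unfold nrm
    rw [Fintype.sum_sum_type]
    simp only [p, Sum.elim_inl, Sum.elim_inr, mul_pow, ← Finset.mul_sum, hUn, hVn]
    rcases he with h | h <;> simp [h]
  have hpsum : ∀ x (F : R1 ⊕ R2 → ℝ), ∑ r, p x r * F r =
      b * ∑ i, (x.2.1 : EuclideanSpace ℝ R1) i * F (Sum.inl i)
        + e * y * ∑ i, (vsel x : EuclideanSpace ℝ R2) i * F (Sum.inr i) := fun x F => by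
    rw [Fintype.sum_sum_type]
    simp only [p, Sum.elim_inl, Sum.elim_inr, Finset.mul_sum, mul_assoc]
  have hcs : ∀ (v : U) (x : R1 → ℝ), ∑ i, (v : EuclideanSpace ℝ R1) i * x i ≤ nrm x := fun v x => by
    refine (sum_mul_le_nrm _ _).trans (le_of_eq ?_)
    rw [nrm, hUn]; simp
  have hcsV : ∀ (v : V) (x : R2 → ℝ), ∑ i, (v : EuclideanSpace ℝ R2) i * x i ≤ nrm x := fun v x => by
    refine (sum_mul_le_nrm _ _).trans (le_of_eq ?_)
    rw [nrm, hVn]; simp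
  have hG := gordon_compact p q ψ hp hq hψ (fun a b hab => Or.inr (by simp only [q, hab])) 1 (by norm_num)
  refine (measure_mono ?_).trans (hG.trans ?_)
  · rintro G ⟨w, hw, hlt⟩
    obtain ⟨v0, hv0⟩ := halignV (fun i : R2 => resid σ n G w (Sum.inr i))
    refine ⟨(⟨w, hw⟩, v0), fun u => ?_⟩
    have h1 : ∑ rc : (R1 ⊕ R2) × Option (Fin N), p ((⟨w, hw⟩, v0), u) rc.1
        * q ((⟨w, hw⟩, v0), u) rc.2 * G rc = √n * ∑ r, p ((⟨w, hw⟩, v0), u) r * resid σ n G w r :=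
      sum_bilin hn0 _ G w
    rw [h1, hpsum]
    have h2 := hcs u.1 (fun i => resid σ n G w (Sum.inl i))
    have h3 : e * y * ∑ i, (vsel ((⟨w, hw⟩, v0), u) : EuclideanSpace ℝ R2) i * resid σ n G w (Sum.inr i)
        ≤ e * y * nrm (fun i : R2 => resid σ n G w (Sum.inr i)) := by
      rcases he with h | h
      · rw [h, one_mul]
        exact mul_le_mul_of_nonneg_left (hcsV _ _) hy
      · have : vsel ((⟨w, hw⟩, v0), u) = v0 := by
          simp only [vsel]; rw [if_neg]; rw [h]; norm_num
        rw [this, hv0]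
    set B := nrm (fun i : R1 => resid σ n G w (Sum.inl i)) with hB
    have h4 : b * (√n * B) - b ^ 2 * n / 2 ≤ B ^ 2 / 2 := by
      have h5 := sq_nonneg (B - b * √n)
      have h6 : √n ^ 2 = n := Real.sq_sqrt hn0.le
      have h7 : (B - b * √n) ^ 2 = B ^ 2 - 2 * (b * (√n * B)) + b ^ 2 * √n ^ 2 := by ring
      rw [h7, h6] at h5
      linarith
    have h5 := mul_le_mul_of_nonneg_left (mul_le_mul_of_nonneg_left h2 hbp.le) hs.le
    have h6 := mul_le_mul_of_nonneg_left h3 hs.le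
    change -(b ^ 2 * n / 2) + L * pen θ w - target w + _ < 0
    have h7 : nrm (fun i : R1 => resid σ n G w (Sum.inl i)) ^ 2 / 2 + L * pen θ w
            + e * y * √n * nrm (fun i : R2 => resid σ n G w (Sum.inr i)) < target w := hlt
    linarith
  · have hsub : {g : (R1 ⊕ R2) ⊕ Option (Fin N) → ℝ | ∃ w, ∀ u, ψ (w, u) + (nrm (q (w, u))
        * ∑ r, p (w, u) r * g (Sum.inl r)
        + 1 * nrm (p (w, u)) * ∑ c, q (w, u) c * g (Sum.inr c)) ≤ 0} ⊆
        {g | ¬ GoodDraw n ν a L b r ε' θ g} := by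
      rintro g ⟨⟨w, v0⟩, hle⟩ hgood
      obtain ⟨u1, hu1⟩ := halignU (fun i => g (Sum.inl (Sum.inl i)))
      obtain ⟨v1, hv1⟩ := halignV (fun i => g (Sum.inl (Sum.inr i)))
      have h1 := hle (u1, v1)
      have h2 := hgood.lower hN hδ hσ hn hν hν1 ha hL hbp hrp hε' hε'1 hy hya he w.1 w.2
      rw [hpn, hpsum] at h1
      have hqa : nrm (q ((w, v0), u1, v1)) = √n * tau σ n w.1 := nrm_aug hn0 _
      have hqs : ∑ c, q ((w, v0), u1, v1) c * g (Sum.inr c)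
        = ∑ j, w.1 j * g (Sum.inr (some j)) - σ * √n * g (Sum.inr none) :=
        sum_aug (fun c => g (Sum.inr c)) w.1
      rw [hqa, hqs] at h1
      simp only at h1
      rw [hu1] at h1
      have h3 : e * y * nrm (fun i : R2 => g (Sum.inl (Sum.inr i))) ≤ e * y *
          ∑ i, (vsel ((w, v0), u1, v1) : EuclideanSpace ℝ R2) i * g (Sum.inl (Sum.inr i)) := by
        rcases he with h | h
        · have : vsel ((w, v0), u1, v1) = v1 := by
            simp only [vsel]; rw [if_pos h]
          rw [this, hv1]
        · rw [h]
          have := mul_le_mul_of_nonneg_left (hcsV (vsel ((w, v0), u1, v1))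
            (fun i => g (Sum.inl (Sum.inr i)))) hy
          linarith
      have h4 := mul_le_mul_of_nonneg_left h3 (mul_nonneg hs.le (tau_nonneg σ n w.1))
      have h5 : b / (2 * r) * (tau σ n w.1 - r * √ν) ^ 2 ≤ C1 * (tau σ n w.1 - r * √ν) ^ 2 := by
        refine mul_le_mul_of_nonneg_right ?_ (sq_nonneg _)
        have h6 : b / (2 * r) ≤ b1 / (2 * r0) := by gcongr
        have h7 : 0 ≤ (√(1 + 1 / δ) * τ1 + σ) / (2 * b0) := by positivity
        linarith
      have h6 : (√(1 + 1 / δ) * τ1 + σ) / (2 * b) * y ^ 2 ≤ C1 * y ^ 2 := by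
        refine mul_le_mul_of_nonneg_right ?_ (sq_nonneg _)
        have h6 : (√(1 + 1 / δ) * τ1 + σ) / (2 * b) ≤ (√(1 + 1 / δ) * τ1 + σ) / (2 * b0) := by gcongr
        have h7 : 0 ≤ b1 / (2 * r0) := by positivity
        linarith
      have h7 : (2 * b * τ1 + τ1 + b * σ + 1) * ε' ≤ ε / 2 := by
        have h8 : 2 * b * τ1 + τ1 + b * σ + 1 ≤ C2 := by rw [hC2]; gcongr
        calc (2 * b * τ1 + τ1 + b * σ + 1) * ε' ≤ C2 * (ε / (2 * C2)) := by gcongr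
          _ = ε / 2 := by field_simp
      have h8 : ψ ((w, v0), u1, v1) = -(b ^ 2 * n / 2) + L * pen θ w.1 - n * (Phi σ ν L n θ b r
        - C1 * (tau σ n w.1 - r * √ν) ^ 2 + e * y * a * tau σ n w.1 - C1 * y ^ 2 - ε) := rfl
      rw [h8] at h1
      have h9 : n * (Phi σ ν L n θ b r - C1 * (tau σ n w.1 - r * √ν) ^ 2 + e * y * a * tau σ n w.1
          - C1 * y ^ 2 - ε) < n * (Phi σ ν L n θ b r - b / (2 * r) * (tau σ n w.1 - r * √ν) ^ 2
            + e * y * a * tau σ n w.1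
        - (√(1 + 1 / δ) * τ1 + σ) / (2 * b) * y ^ 2 - (2 * b * τ1 + τ1 + b * σ + 1) * ε') := by
        refine mul_lt_mul_of_pos_left ?_ hn0
        linarith
      linarith
    refine (mul_le_mul_right (measure_mono hsub) 2).trans ((mul_le_mul_right (H R1 R2 N n ν a L b r ε' θ hN hn
      (by linarith) hν1 ha.le ha1 hR1 hR2 hL hL1 hb hb' hr hr' hε' hε'1) 2).trans (le_of_eq ?_))
    rw [show (2 : ℝ≥0∞) = ENNReal.ofReal 2 by simp, ← ENNReal.ofReal_mul (by norm_num)]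
    congr 1
    have : -c * n * ε' ^ 2 = -(c / (4 * C2 ^ 2)) * n * ε ^ 2 := by
      change -c * n * (ε / (2 * C2)) ^ 2 = _
      field_simp; ring
    rw [this]; ring

/-- Penalised training objective on the rows `f`. -/
def trainObj {R S : Type*} [Fintype S] {N : ℕ} (σ n L : ℝ) (θ : Fin N → ℝ) (f : S → R)
    (G : R × Option (Fin N) → ℝ) (w : Fin N → ℝ) : ℝ :=
  nrm (fun i => resid σ n G w (f i)) ^ 2 / 2 + L * pen θ w

theorem resid_segment {R : Type*} {N : ℕ} (σ n s : ℝ) (G : R × Option (Fin N) → ℝ)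
    (u w : Fin N → ℝ) (r : R) :
    resid σ n G (fun j => u j + s * (w j - u j)) r
      = resid σ n G u r + s * (resid σ n G w r - resid σ n G u r) := by
  unfold resid
  have : ∑ j, (u j + s * (w j - u j)) * G (r, some j)
      = ∑ j, u j * G (r, some j) + s * (∑ j, w j * G (r, some j) - ∑ j, u j * G (r, some j)) := by
    rw [← Finset.sum_sub_distrib, Finset.mul_sum, ← Finset.sum_add_distrib]
    exact Finset.sum_congr rfl fun j _ => by ring
  rw [this]; ring

theorem pen_segment {N : ℕ} (θ u w : Fin N → ℝ) {s : ℝ} (hs : 0 ≤ s) (hs1 : s ≤ 1) :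
    pen θ (fun j => u j + s * (w j - u j)) ≤ pen θ u + s * (pen θ w - pen θ u) := by
  unfold pen
  rw [← Finset.sum_sub_distrib, Finset.mul_sum, ← Finset.sum_add_distrib]
  refine Finset.sum_le_sum fun j _ => ?_
  have h1 : θ j + (u j + s * (w j - u j)) = (1 - s) * (θ j + u j) + s * (θ j + w j) := by ring
  have h2 := abs_add_le ((1 - s) * (θ j + u j)) (s * (θ j + w j))
  rw [abs_mul, abs_mul, abs_of_nonneg hs, abs_of_nonneg (show 0 ≤ 1 - s by linarith)] at h2
  rw [h1]
  linarith

theorem trainObj_segment {R S : Type*} [Fintype S] {N : ℕ} {σ n L s : ℝ} (hL : 0 ≤ L)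
    (θ : Fin N → ℝ) (f : S → R) (G : R × Option (Fin N) → ℝ) (u w : Fin N → ℝ)
    (hs : 0 ≤ s) (hs1 : s ≤ 1) :
    trainObj σ n L θ f G (fun j => u j + s * (w j - u j)) ≤ trainObj σ n L θ f G u
      + s * (∑ i, resid σ n G u (f i) * (resid σ n G w (f i) - resid σ n G u (f i))
        + L * (pen θ w - pen θ u))
      + s ^ 2 * (∑ i, (resid σ n G w (f i) - resid σ n G u (f i)) ^ 2 / 2) := by
  unfold trainObj
  have h1 := mul_le_mul_of_nonneg_left (pen_segment θ u w hs hs1) hL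
  have h2 : nrm (fun i => resid σ n G (fun j => u j + s * (w j - u j)) (f i)) ^ 2 / 2
      = nrm (fun i => resid σ n G u (f i)) ^ 2 / 2
        + s * ∑ i, resid σ n G u (f i) * (resid σ n G w (f i) - resid σ n G u (f i))
        + s ^ 2 * (∑ i, (resid σ n G w (f i) - resid σ n G u (f i)) ^ 2 / 2) := by
    rw [nrm_sq, nrm_sq, Finset.sum_div, Finset.sum_div, Finset.mul_sum, Finset.mul_sum,
      ← Finset.sum_add_distrib, ← Finset.sum_add_distrib]
    refine Finset.sum_congr rfl fun i _ => ?_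
    rw [resid_segment]; ring
  rw [h2]
  linarith

theorem trainObj_convex {R S : Type*} [Fintype S] {N : ℕ} {σ n L s : ℝ} (hL : 0 ≤ L)
    (θ : Fin N → ℝ) (f : S → R) (G : R × Option (Fin N) → ℝ) (u w : Fin N → ℝ)
    (hs : 0 ≤ s) (hs1 : s ≤ 1) :
    trainObj σ n L θ f G (fun j => u j + s * (w j - u j)) ≤
      (1 - s) * trainObj σ n L θ f G u + s * trainObj σ n L θ f G w := by
  refine (trainObj_segment hL θ f G u w hs hs1).trans ?_
  have h1 : s ^ 2 * (∑ i, (resid σ n G w (f i) - resid σ n G u (f i)) ^ 2 / 2)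
      ≤ s * (∑ i, (resid σ n G w (f i) - resid σ n G u (f i)) ^ 2 / 2) := by
    refine mul_le_mul_of_nonneg_right (by nlinarith)
      (Finset.sum_nonneg fun _ _ => div_nonneg (sq_nonneg _) (by norm_num))
  have h2 : ∑ i, (resid σ n G w (f i) - resid σ n G u (f i)) ^ 2 / 2
      = nrm (fun i => resid σ n G w (f i)) ^ 2 / 2 - nrm (fun i => resid σ n G u (f i)) ^ 2 / 2
        - ∑ i, resid σ n G u (f i) * (resid σ n G w (f i) - resid σ n G u (f i)) := by
    rw [nrm_sq, nrm_sq, Finset.sum_div, Finset.sum_div, ← Finset.sum_sub_distrib,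
      ← Finset.sum_sub_distrib]
    exact Finset.sum_congr rfl fun i _ => by ring
  rw [h2] at h1
  rw [h2]
  unfold trainObj
  nlinarith

/-- At a minimiser the residual is a dual certificate. -/
theorem trainObj_dual {R S : Type*} [Fintype S] {N : ℕ} {σ n L : ℝ} (hL : 0 ≤ L)
    (θ : Fin N → ℝ) (f : S → R) (G : R × Option (Fin N) → ℝ) (u : Fin N → ℝ)
    (hu : ∀ w, trainObj σ n L θ f G u ≤ trainObj σ n L θ f G w) (w : Fin N → ℝ) :
    trainObj σ n L θ f G u + nrm (fun i => resid σ n G u (f i)) ^ 2 / 2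
      ≤ ∑ i, resid σ n G u (f i) * resid σ n G w (f i) + L * pen θ w := by
  set A := ∑ i, resid σ n G u (f i) * (resid σ n G w (f i) - resid σ n G u (f i))
        + L * (pen θ w - pen θ u) with hA
  set B := ∑ i, (resid σ n G w (f i) - resid σ n G u (f i)) ^ 2 / 2 with hB
  have hB0 : 0 ≤ B := Finset.sum_nonneg fun _ _ => div_nonneg (sq_nonneg _) (by norm_num)
  have h1 : ∀ s, 0 < s → s ≤ 1 → 0 ≤ A + s * B := fun s hs hs1 => by
    have := (hu _).trans (trainObj_segment hL θ f G u w hs.le hs1)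
    have h2 : 0 ≤ s * (A + s * B) := by
      have : s * (A + s * B) = s * A + s ^ 2 * B := by ring
      linarith
    exact nonneg_of_mul_nonneg_right h2 hs
  have hA0 : 0 ≤ A := by
    by_contra hneg
    push Not at hneg
    have h2 := h1 (min 1 (-A / (2 * (B + 1)))) (lt_min one_pos (div_pos (by linarith) (by linarith)))
      (min_le_left _ _)
    have h3 : min 1 (-A / (2 * (B + 1))) * B ≤ -A / (2 * (B + 1)) * (B + 1) :=
      mul_le_mul (min_le_right _ _) (by linarith) hB0 (div_nonneg (by linarith) (by linarith))
    have h4 : -A / (2 * (B + 1)) * (B + 1) = -A / 2 := by field_simp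
    linarith
  have h5 : A = ∑ i, resid σ n G u (f i) * resid σ n G w (f i) + L * pen θ w
      - nrm (fun i => resid σ n G u (f i)) ^ 2 - L * pen θ u := by
    rw [hA, nrm_sq]
    have : ∑ i, resid σ n G u (f i) * (resid σ n G w (f i) - resid σ n G u (f i))
      = ∑ i, resid σ n G u (f i) * resid σ n G w (f i) - ∑ i, resid σ n G u (f i) ^ 2 := by
      rw [← Finset.sum_sub_distrib]
      exact Finset.sum_congr rfl fun i _ => by ring
    rw [this]; ring
  unfold trainObj
  linarith

theorem compactSpace_tau_le {N : ℕ} {σ n τ1 : ℝ} (hn : 0 < n) :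
    CompactSpace {w : Fin N → ℝ // tau σ n w ≤ τ1} := by
  suffices h : IsCompact {w : Fin N → ℝ | tau σ n w ≤ τ1} from isCompact_iff_compactSpace.1 h
  refine Metric.isCompact_of_isClosed_isBounded
    (isClosed_le (continuous_tau σ n) continuous_const) ?_
  refine (Metric.isBounded_closedBall (x := (0 : Fin N → ℝ)) (r := √n * τ1)).subset fun w hw => ?_
  have hw' : tau σ n w ≤ τ1 := hw
  have h0 : 0 ≤ √n * τ1 := mul_nonneg (Real.sqrt_nonneg _) ((tau_nonneg _ _ _).trans hw')
  rw [mem_closedBall_zero_iff, pi_norm_le_iff_of_nonneg h0]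
  intro j
  refine le_trans ?_ (nrm_le_of_tau_le hn hw')
  rw [Real.norm_eq_abs, nrm]
  refine Real.abs_le_sqrt ?_
  exact Finset.single_le_sum (f := fun j => w j ^ 2) (fun _ _ => sq_nonneg _) (Finset.mem_univ j)

set_option maxHeartbeats 1000000 in
theorem GoodDraw.upper {R1 R2 : Type} [Fintype R1] [Fintype R2] {N : ℕ}
    {σ n ν a L b r ε b1 r0 r1 Lmax : ℝ} {θ : Fin N → ℝ} {g : (R1 ⊕ R2) ⊕ Option (Fin N) → ℝ}
    (hg : GoodDraw n ν a L b r ε θ g) (hn0 : 0 < n) (hσ : 0 < σ)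
    (hν : 1 / 2 ≤ ν) (hν1 : ν ≤ 1) (hL : 0 ≤ L) (hL1 : L ≤ Lmax) (hb : 0 < b) (hb1 : b ≤ b1)
    (hr0 : 0 < r0) (hr : r0 ≤ r) (hr1 : r ≤ r1)
    (hε : 0 < ε) (hε1 : ε ≤ 1) (hs : IsSaddle σ ν L n θ b r) :
    ∃ w : Fin N → ℝ, tau σ n w ≤ r1 + 2 / r0 ∧ ∀ v : ℝ, 0 ≤ v →
      -(n * v ^ 2 / 2) + v * (√n * tau σ n w * nrm (fun i : R1 => g (Sum.inl (Sum.inl i)))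
        + (∑ j, w j * g (Sum.inr (some j)) - σ * √n * g (Sum.inr none))) + L * pen θ w
      ≤ n * (Phi σ ν L n θ b r + (b1 * (2 * r1 + 6 / r0 + 1 + σ)
        + (2 * r1 + 6 / r0 + 1 + σ) ^ 2 / 2 + Lmax) * ε) := by
  have hrp : 0 < r := hr0.trans_le hr
  have hν0 : 0 < ν := by linarith
  have hsν : 0 < √ν := Real.sqrt_pos.2 hν0
  have hsν2 : √ν ^ 2 = ν := Real.sq_sqrt hν0.le
  have hsν1 : √ν ≤ 1 := Real.sqrt_le_one.2 hν1
  have hsν' : 1 / 2 ≤ √ν := by nlinarith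
  have hsn : 0 < √n := Real.sqrt_pos.2 hn0
  have hs2 : √n * √n = n := Real.mul_self_sqrt hn0.le
  set D := 2 * r1 + 6 / r0 + 1 + σ with hD
  have hr1p : 0 < r1 := hrp.trans_le hr1
  have hDp : 0 < D := by positivity
  let w : Fin N → ℝ := fun j => optW (L / b) r (θ j) (g (Sum.inr (some j)))
  have hτ : tau σ n w ≤ r * √ν + 2 / r0 * ε := by
    refine le_of_sq_le_sq ?_ (by positivity)
    rw [tau_sq hn0]
    have h1 : (∑ j, w j ^ 2) / n ≤ rho2 L n θ b r + ε := by
      rw [div_le_iff₀ hn0]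
      have := (abs_le.1 hg.radius).2
      linarith
    have h2 : ε ≤ 2 * (r * √ν) * (2 / r0 * ε) := by
      have h3 : 1 ≤ r / r0 := by rwa [one_le_div hr0]
      have h4 : 2 * (r * √ν) * (2 / r0 * ε) = 4 * ε * (r / r0 * √ν) := by ring
      have h5 : 1 / 2 ≤ r / r0 * √ν := by nlinarith
      rw [h4]; nlinarith
    have h3 : (r * √ν + 2 / r0 * ε) ^ 2 = r ^ 2 * √ν ^ 2 + 2 * (r * √ν) * (2 / r0 * ε)
      + (2 / r0 * ε) ^ 2 := by ring
    rw [h3, hsν2]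
    have := hs.radius
    linarith [sq_nonneg (2 / r0 * ε)]
  have hτ0 : 0 ≤ tau σ n w := tau_nonneg _ _ _
  refine ⟨w, hτ.trans ?_, fun v hv => ?_⟩
  · have h1 : r * √ν ≤ r1 * 1 := by gcongr
    have h2 : 2 / r0 * ε ≤ 2 / r0 * 1 := by gcongr
    linarith
  set A1 := nrm (fun i : R1 => g (Sum.inl (Sum.inl i))) / √n with hA1
  have e1 : nrm (fun i : R1 => g (Sum.inl (Sum.inl i))) = A1 * √n := by rw [hA1]; field_simp
  have h1 : |A1 - √ν| ≤ ε / √ν := abs_sub_sqrt_le hn0 (nrm_nonneg _) hsν (by rw [hsν2]; exact hg.train)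
  have h1' : A1 ≤ √ν + 2 * ε := by
    have h3 : ε / √ν ≤ 2 * ε := by rw [div_le_iff₀ hsν]; nlinarith
    linarith [(abs_le.1 h1).2]
  have hA10 : 0 ≤ A1 := div_nonneg (nrm_nonneg _) hsn.le
  have hprod : tau σ n w * A1 ≤ ν * r + (2 * r1 + 6 / r0) * ε := by
    have h2 : tau σ n w * A1 ≤ (r * √ν + 2 / r0 * ε) * (√ν + 2 * ε) :=
      mul_le_mul hτ h1' hA10 (by positivity)
    have h3 : (r * √ν + 2 / r0 * ε) * (√ν + 2 * ε) = r * √ν ^ 2 + 2 * ε * (r * √ν)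
      + 2 / r0 * ε * √ν + 4 / r0 * ε * ε := by ring
    rw [h3, hsν2] at h2
    have h4 : 2 * ε * (r * √ν) ≤ 2 * ε * (r1 * 1) := by gcongr
    have h5 : 2 / r0 * ε * √ν ≤ 2 / r0 * ε * 1 := by gcongr
    have h6 : 4 / r0 * ε * ε ≤ 4 / r0 * ε * 1 := by gcongr
    have h7 : (2 * r1 + 6 / r0) * ε = 2 * ε * (r1 * 1) + 2 / r0 * ε * 1 + 4 / r0 * ε * 1 := by ring
    linarith
  have hcorr : ∑ j, w j * g (Sum.inr (some j)) ≤ n * (kap L n θ b r + ε) := by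
    have h2 := (abs_le.1 hg.corr).2
    have h3 : ∑ j, w j * g (Sum.inr (some j)) = ∑ j, g (Sum.inr (some j)) *
      optW (L / b) r (θ j) (g (Sum.inr (some j))) := Finset.sum_congr rfl fun j _ => mul_comm _ _
    rw [h3]; linarith
  have hnoise : -(σ * √n * g (Sum.inr none)) ≤ n * (σ * ε) := by
    have h2 : -g (Sum.inr none) ≤ ε * √n := (neg_le_abs _).trans hg.noise
    have h3 := mul_le_mul_of_nonneg_left h2 (mul_nonneg hσ.le hsn.le)
    have h4 : σ * √n * (ε * √n) = (√n * √n) * (σ * ε) := by ring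
    rw [h4, hs2] at h3
    linarith
  have hpen : L * pen θ w ≤ n * (L * penE L n θ b r + Lmax * ε) := by
    have h2 := (abs_le.1 hg.penalty).2
    have h3 : pen θ w ≤ n * (penE L n θ b r + ε) := by
      unfold pen; linarith
    have h4 := mul_le_mul_of_nonneg_left h3 hL
    have h5 : n * (L * ε) ≤ n * (Lmax * ε) := by gcongr
    linarith
  have hX : √n * tau σ n w * (A1 * √n) + (∑ j, w j * g (Sum.inr (some j))
      - σ * √n * g (Sum.inr none)) ≤ n * (b + D * ε) := by
    have h2 : √n * tau σ n w * (A1 * √n) = (√n * √n) * (tau σ n w * A1) := by ring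
    rw [h2, hs2]
    have h3 := mul_le_mul_of_nonneg_left hprod hn0.le
    have h4 := hs.slope
    have h5 : n * (b + D * ε) = n * (ν * r + (2 * r1 + 6 / r0) * ε) + n * (kap L n θ b r + ε)
      + n * (σ * ε) := by rw [hD]; nth_rewrite 1 [h4]; ring
    rw [h5]; linarith
  rw [e1]
  have hvX := mul_le_mul_of_nonneg_left hX hv
  rw [hs.value hL hb hrp]
  have h2 : v * (n * (b + D * ε)) ≤ n * v ^ 2 / 2 + n * (b + D * ε) ^ 2 / 2 := by
    have h3 := mul_nonneg hn0.le (sq_nonneg (v - (b + D * ε)))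
    have h4 : n * (v - (b + D * ε)) ^ 2 = n * v ^ 2 - 2 * (v * (n * (b + D * ε)))
      + n * (b + D * ε) ^ 2 := by ring
    rw [h4] at h3
    linarith
  have h3 : (b + D * ε) ^ 2 ≤ b ^ 2 + 2 * (b1 * D * ε) + D ^ 2 * ε := by
    have h4 : (b + D * ε) ^ 2 = b ^ 2 + 2 * (b * D * ε) + D ^ 2 * (ε * ε) := by ring
    have h5 : b * D * ε ≤ b1 * D * ε := by gcongr
    have h6 : D ^ 2 * (ε * ε) ≤ D ^ 2 * (ε * 1) := by gcongr
    rw [h4]; linarith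
  have h4 := mul_le_mul_of_nonneg_left h3 hn0.le
  linarith

/-- Any minimiser of the training objective has value close to the saddle value. -/
theorem base_upper {δ σ b0 b1 r0 r1 Lmax : ℝ} (hδ : 0 < δ) (hσ : 0 < σ) (hb0 : 0 < b0)
    (hb01 : b0 ≤ b1) (hr0 : 0 < r0) (hr01 : r0 ≤ r1) (hLmax : 0 ≤ Lmax) :
    ∃ c : ℝ, 0 < c ∧ ∀ (R1 R2 : Type) [Fintype R1] [Fintype R2]
      (N : ℕ) (n ν a L b r ε : ℝ)
      (θ : Fin N → ℝ), 0 < N → n = δ * N → 1 / 2 ≤ ν → ν ≤ 1 → 0 < a → a ≤ 1 →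
      (Fintype.card R1 : ℝ) = ν * n → (Fintype.card R2 : ℝ) = a ^ 2 * n → 0 ≤ L → L ≤ Lmax →
      b0 ≤ b → b ≤ b1 → r0 ≤ r → r ≤ r1 → 0 < ε → ε ≤ 1 → IsSaddle σ ν L n θ b r →
      gaussPi ((R1 ⊕ R2) × Option (Fin N)) {G | ∃ u, (∀ w, trainObj σ n L θ Sum.inl G u
          ≤ trainObj σ n L θ Sum.inl G w) ∧
          n * (Phi σ ν L n θ b r + ε) < trainObj σ n L θ Sum.inl G u}
        ≤ ENNReal.ofReal (32 * Real.exp (- c * n * ε ^ 2)) := by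
  obtain ⟨c, hc, H⟩ := prob_not_goodDraw hδ hb0 hb01 hr0 hr01 hLmax
  have hr1 : 0 < r1 := hr0.trans_le hr01
  have hb1 : 0 < b1 := hb0.trans_le hb01
  set C2 := 1 + (b1 * (2 * r1 + 6 / r0 + 1 + σ) + (2 * r1 + 6 / r0 + 1 + σ) ^ 2 / 2 + Lmax) with hC2
  have hC2pos : 1 ≤ C2 := by
    have : 0 ≤ b1 * (2 * r1 + 6 / r0 + 1 + σ) + (2 * r1 + 6 / r0 + 1 + σ) ^ 2 / 2 + Lmax := by
      positivity
    linarith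
  refine ⟨c / (4 * C2 ^ 2), by positivity, ?_⟩
  intro R1 R2 _ _ N n ν a L b r ε θ hN hn hν hν1 ha ha1 hR1 hR2 hL hL1 hb hb' hr hr' hε hε1 hsad
  have hN' : (0 : ℝ) < N := by exact_mod_cast hN
  have hn0 : 0 < n := by rw [hn]; positivity
  have hs : 0 < √n := Real.sqrt_pos.2 hn0
  have hs2 : √n * √n = n := Real.mul_self_sqrt hn0.le
  have hbp : 0 < b := hb0.trans_le hb
  let ε' := ε / (2 * C2)
  have hε' : 0 < ε' := by positivity
  have hε'1 : ε' ≤ 1 := by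
    change ε / (2 * C2) ≤ 1
    rw [div_le_one (by positivity)]; linarith
  set V := Phi σ ν L n θ b r with hV
  let τ1 := r1 + 2 / r0 + σ
  have := compactSpace_tau_le (N := N) (σ := σ) (τ1 := τ1) hn0
  have hne : Nonempty {w : Fin N → ℝ // tau σ n w ≤ τ1} := by
    refine ⟨⟨0, ?_⟩⟩
    have h1 : tau σ n (0 : Fin N → ℝ) = σ := by
      unfold tau; simp [Real.sqrt_sq hσ.le]
    rw [h1]
    have : 0 ≤ r1 + 2 / r0 := by positivity
    change σ ≤ r1 + 2 / r0 + σ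
    linarith
  let p : (R1 → ℝ) × {w : Fin N → ℝ // tau σ n w ≤ τ1} → R1 ⊕ R2 → ℝ :=
    fun x => Sum.elim (fun i => -(x.1 i)) (fun _ => 0)
  let q : (R1 → ℝ) × {w : Fin N → ℝ // tau σ n w ≤ τ1} → Option (Fin N) → ℝ :=
    fun x => aug σ n x.2.1
  let ψ : (R1 → ℝ) × {w : Fin N → ℝ // tau σ n w ≤ τ1} → ℝ :=
    fun x => n * (V + ε) + n * (∑ i, x.1 i ^ 2) / 2 - L * pen θ x.2.1
  have hp : Continuous p := by
    refine continuous_pi fun r => ?_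
    rcases r with i | i
    · simp only [p, Sum.elim_inl]; fun_prop
    · simp only [p, Sum.elim_inr]; fun_prop
  have hwc : Continuous fun x : (R1 → ℝ) × {w : Fin N → ℝ // tau σ n w ≤ τ1} => x.2.1 :=
    continuous_subtype_val.comp continuous_snd
  have hq : Continuous q := by
    refine continuous_pi fun r => ?_
    rcases r with _ | j
    · simp only [q, aug, Option.elim]; fun_prop
    · simp only [q, aug, Option.elim]
      exact (continuous_apply j).comp hwc
  have hψ : Continuous ψ := by
    have h1 : Continuous fun x : (R1 → ℝ) × {w : Fin N → ℝ // tau σ n w ≤ τ1} =>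
      n * (V + ε) + n * (∑ i, x.1 i ^ 2) / 2 := by fun_prop
    exact h1.sub (continuous_const.mul ((continuous_pen θ).comp hwc))
  have hpsum : ∀ x (F : R1 ⊕ R2 → ℝ), ∑ r, p x r * F r = -∑ i, x.1 i * F (Sum.inl i) := fun x F => by
    rw [Fintype.sum_sum_type]
    simp [p]
  have hpn : ∀ x, nrm (p x) = nrm x.1 := fun x => by
    unfold nrm
    rw [Fintype.sum_sum_type]
    simp [p]
  have hG := gordon_compact p q ψ hp hq hψ
    (fun a b hab => Or.inl (by simp only [p, hab])) (-1) (by norm_num)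
  refine (measure_mono ?_).trans (hG.trans ?_)
  · rintro G ⟨u, hmin, hlt⟩
    refine ⟨fun i => resid σ n G u (Sum.inl i) / √n, fun w => ?_⟩
    have h1 : ∑ rc : (R1 ⊕ R2) × Option (Fin N),
        p (fun i => resid σ n G u (Sum.inl i) / √n, w) rc.1
        * q (fun i => resid σ n G u (Sum.inl i) / √n, w) rc.2 * G rc
        = √n * ∑ r, p (fun i => resid σ n G u (Sum.inl i) / √n, w) r * resid σ n G w.1 r :=
      sum_bilin hn0 _ G w.1
    rw [h1, hpsum]
    have h2 := trainObj_dual hL θ Sum.inl G u hmin w.1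
    have h3 : √n * -∑ i, resid σ n G u (Sum.inl i) / √n * resid σ n G w.1 (Sum.inl i)
      = -∑ i, resid σ n G u (Sum.inl i) * resid σ n G w.1 (Sum.inl i) := by
      rw [mul_neg, Finset.mul_sum]
      congr 1
      exact Finset.sum_congr rfl fun i _ => by field_simp
    have h4 : n * (∑ i : R1, (resid σ n G u (Sum.inl i) / √n) ^ 2) / 2
        = nrm (fun i : R1 => resid σ n G u (Sum.inl i)) ^ 2 / 2 := by
      rw [nrm_sq]
      simp only [div_pow, ← Finset.sum_div]
      rw [Real.sq_sqrt hn0.le]; field_simp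
    simp only
    rw [h3]
    change n * (V + ε) + n * (∑ i : R1, (resid σ n G u (Sum.inl i) / √n) ^ 2) / 2 - L * pen θ w.1
      + _ < 0
    rw [h4]
    linarith
  · have hsub : {g : (R1 ⊕ R2) ⊕ Option (Fin N) → ℝ | ∃ v, ∀ w, ψ (v, w) + (nrm (q (v, w))
        * ∑ r, p (v, w) r * g (Sum.inl r)
        + (-1) * nrm (p (v, w)) * ∑ c, q (v, w) c * g (Sum.inr c)) ≤ 0} ⊆
        {g | ¬ GoodDraw n ν a L b r ε' θ g} := by
      rintro g ⟨v, hle⟩ hgood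
      obtain ⟨w, hw, hv⟩ := hgood.upper hn0 hσ hν hν1 hL hL1 hbp hb' hr0 hr hr' hε' hε'1 hsad
      have h1 := hle ⟨w, hw.trans (by change _ ≤ r1 + 2 / r0 + σ; linarith)⟩
      have h2 := hv (nrm v) (nrm_nonneg v)
      rw [hpn, hpsum] at h1
      have hqa : ∀ hw', nrm (q (v, ⟨w, hw'⟩)) = √n * tau σ n w := fun _ => nrm_aug hn0 _
      have hqs : ∀ hw', ∑ c, q (v, ⟨w, hw'⟩) c * g (Sum.inr c)
        = ∑ j, w j * g (Sum.inr (some j)) - σ * √n * g (Sum.inr none) :=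
        fun _ => sum_aug (fun c => g (Sum.inr c)) w
      rw [hqa, hqs] at h1
      simp only at h1
      have h3 := sum_mul_le_nrm v (fun i => g (Sum.inl (Sum.inl i)))
      have h4 := mul_le_mul_of_nonneg_left h3 (mul_nonneg hs.le (tau_nonneg σ n w))
      have h5 : ψ (v, ⟨w, hw.trans (by change _ ≤ r1 + 2 / r0 + σ; linarith)⟩)
        = n * (V + ε) + n * nrm v ^ 2 / 2 - L * pen θ w := by
        simp only [ψ]; rw [nrm_sq]
      rw [h5] at h1
      have h6 : (b1 * (2 * r1 + 6 / r0 + 1 + σ) + (2 * r1 + 6 / r0 + 1 + σ) ^ 2 / 2 + Lmax) * ε'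
          ≤ ε / 2 := by
        calc _ ≤ C2 * (ε / (2 * C2)) := by gcongr; linarith
          _ = ε / 2 := by field_simp
      have h7 := mul_le_mul_of_nonneg_left h6 hn0.le
      have h8 : 0 < n * (ε / 2) := by positivity
      linarith
    refine (mul_le_mul_right (measure_mono hsub) 2).trans ((mul_le_mul_right (H R1 R2 N n ν a L b r ε' θ hN hn
      (by linarith) hν1 ha.le ha1 hR1 hR2 hL hL1 hb hb' hr hr' hε' hε'1) 2).trans (le_of_eq ?_))
    rw [show (2 : ℝ≥0∞) = ENNReal.ofReal 2 by simp, ← ENNReal.ofReal_mul (by norm_num)]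
    congr 1
    have : -c * n * ε' ^ 2 = -(c / (4 * C2 ^ 2)) * n * ε ^ 2 := by
      change -c * n * (ε / (2 * C2)) ^ 2 = _
      field_simp; ring
    rw [this]; ring

theorem gphi_eq (x : ℝ) : gphi x = gaussianPDFReal 0 1 x := by
  rw [gaussianPDFReal_def, gphi]
  simp [div_eq_mul_inv, mul_comm]

theorem hasDerivAt_gphi (x : ℝ) : HasDerivAt gphi (-x * gphi x) x := by
  have h : HasDerivAt (fun x : ℝ => Real.exp (-x ^ 2 / 2) / Real.sqrt (2 * Real.pi))
      ((Real.exp (-x ^ 2 / 2) * (-x)) / Real.sqrt (2 * Real.pi)) x := by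
    refine HasDerivAt.div_const (HasDerivAt.exp ?_) _
    refine ((hasDerivAt_pow 2 x).neg.div_const 2).congr_deriv ?_
    ring
  refine h.congr_deriv ?_
  rw [gphi]; ring

theorem integrable_mul_gphi_iff (g : ℝ → ℝ) :
    Integrable g (gaussianReal 0 1) ↔ Integrable (fun x => g x * gphi x) := by
  rw [gaussianReal_of_var_ne_zero _ one_ne_zero]
  unfold gaussianPDF
  rw [integrable_withDensity_iff_integrable_smul' (by fun_prop) (by simp)]
  refine integrable_congr (Filter.Eventually.of_forall fun x => ?_)
  simp [ENNReal.toReal_ofReal (gaussianPDFReal_nonneg 0 1 x), mul_comm, gphi_eq]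

theorem gPhi_neg (α : ℝ) : gPhi (-α) = ∫ x in Set.Ioi α, gphi x := by
  unfold gPhi
  rw [← integral_comp_neg_Ioi]
  refine integral_congr_ae (Filter.Eventually.of_forall fun x => ?_)
  simp [gphi]

theorem softMoment_eq {α : ℝ} (hα : 0 ≤ α) :
    softMoment α = 2 * ((1 + α ^ 2) * gPhi (-α) - α * gphi α) := by
  have i0 : Integrable (fun x : ℝ => gphi x) := by
    simpa using (integrable_mul_gphi_iff (fun _ => 1)).1 (integrable_const _)
  have i1 : Integrable (fun x : ℝ => x * gphi x) :=
    (integrable_mul_gphi_iff (fun x => x)).1 integrable_id_stdGaussian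
  have i2 : Integrable (fun x : ℝ => x ^ 2 * gphi x) :=
    (integrable_mul_gphi_iff (fun x => x ^ 2)).1 integrable_sq_stdGaussian
  let F : ℝ → ℝ := fun x => (x - 2 * α) * gphi x
  let F' : ℝ → ℝ := fun x => (1 + α ^ 2) * gphi x - (x - α) ^ 2 * gphi x
  have hF : ∀ x, HasDerivAt F (F' x) x := by
    intro x
    refine (((hasDerivAt_id x).sub_const (2 * α)).mul (hasDerivAt_gphi x)).congr_deriv ?_
    simp only [F', id]; ring
  have iF : Integrable F := by
    have : Integrable (fun x => x * gphi x - 2 * α * gphi x) := i1.sub (i0.const_mul _)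
    exact this.congr (Filter.Eventually.of_forall fun x => by simp only [F]; ring)
  have iq : Integrable (fun x => (x - α) ^ 2 * gphi x) := by
    have : Integrable (fun x => x ^ 2 * gphi x - 2 * α * (x * gphi x) + α ^ 2 * gphi x) :=
      (i2.sub (i1.const_mul _)).add (i0.const_mul _)
    exact this.congr (Filter.Eventually.of_forall fun x => by ring)
  have iF' : Integrable F' := (i0.const_mul _).sub iq
  have hlim : Filter.Tendsto F Filter.atTop (nhds 0) :=
    tendsto_zero_of_hasDerivAt_of_integrableOn_Ioi (a := α) (fun x _ => hF x) iF'.integrableOn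
      iF.integrableOn
  have hintg := integral_Ioi_of_hasDerivAt_of_tendsto' (a := α) (fun x _ => hF x) iF'.integrableOn hlim
  have hsplit : ∫ x in Set.Ioi α, F' x
      = (1 + α ^ 2) * (∫ x in Set.Ioi α, gphi x) - ∫ x in Set.Ioi α, (x - α) ^ 2 * gphi x := by
    simp only [F']
    rw [integral_sub (i0.const_mul _).integrableOn iq.integrableOn, integral_const_mul]
  have hq : ∫ x in Set.Ioi α, (x - α) ^ 2 * gphi x = (1 + α ^ 2) * gPhi (-α) - α * gphi α := by
    rw [gPhi_neg]
    have hFa : F α = - α * gphi α := by simp only [F]; ring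
    rw [hsplit, hFa] at hintg
    linarith
  rw [← hq]
  unfold softMoment
  rw [integral_gaussianReal_eq_integral_smul one_ne_zero]
  have e1 : ∫ x, gaussianPDFReal 0 1 x • (max (|x| - α) 0) ^ 2
      = ∫ x, (fun y => (max (y - α) 0) ^ 2 * gphi y) |x| := by
    refine integral_congr_ae (Filter.Eventually.of_forall fun x => ?_)
    have : gphi |x| = gphi x := by simp [gphi]
    simp only [smul_eq_mul, this, ← gphi_eq]
    ring
  rw [e1, integral_comp_abs (f := fun y => (max (y - α) 0) ^ 2 * gphi y)]
  congr 1
  have e2 : ∫ x in Set.Ioi α, (x - α) ^ 2 * gphi x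
      = ∫ x in Set.Ioi α, (max (x - α) 0) ^ 2 * gphi x := by
    refine setIntegral_congr_fun measurableSet_Ioi fun x hx => ?_
    have : α < x := hx
    rw [max_eq_left (by linarith)]
  rw [e2]
  refine (setIntegral_eq_of_subset_of_forall_sdiff_eq_zero measurableSet_Ioi
    (Set.Ioi_subset_Ioi hα) fun x hx => ?_)
  have : x ≤ α := not_lt.1 hx.2
  rw [max_eq_right (by linarith)]
  ring

theorem softMoment_zero : softMoment 0 = 1 := by
  unfold softMoment
  rw [← integral_sq_stdGaussian]
  refine integral_congr_ae (Filter.Eventually.of_forall fun x => ?_)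
  simp [abs_nonneg]

theorem smax_eq (δ : ℝ) : smax δ = δ * sSup ((fun α : ℝ =>
    (1 - (1 / δ) * softMoment α) / (1 + α ^ 2 - softMoment α)) '' Set.Ici 0) := by
  unfold smax
  congr 2
  refine Set.image_congr fun α hα => ?_
  rw [softMoment_eq hα]
  ring

theorem exists_softMoment_gap {s δ : ℝ} (hδ : 0 < δ) (hs : 0 ≤ s) (h : s < smax δ) :
    ∃ α : ℝ, 0 < α ∧ s * (1 + α ^ 2) + (1 - s) * softMoment α < δ := by
  rw [smax_eq] at h
  have h' : s / δ < sSup ((fun α : ℝ =>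
    (1 - (1 / δ) * softMoment α) / (1 + α ^ 2 - softMoment α)) '' Set.Ici 0) := by
    rw [div_lt_iff₀ hδ]; linarith
  obtain ⟨_, ⟨α, hα, rfl⟩, hlt⟩ := exists_lt_of_lt_csSup (Set.image_nonempty.2 ⟨0, Set.mem_Ici.2 le_rfl⟩) h'
  simp only at hlt
  have hα0 : 0 ≤ α := hα
  have hsd : 0 ≤ s / δ := by positivity
  rcases hα0.eq_or_lt with h0 | h0
  · rw [← h0, softMoment_zero] at hlt
    norm_num at hlt
    linarith
  · refine ⟨α, h0, ?_⟩
    have h1 := softMoment_le_one hα0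
    have hden : 0 < 1 + α ^ 2 - softMoment α := by nlinarith [sq_pos_of_pos h0]
    rw [lt_div_iff₀ hden, div_mul_eq_mul_div, div_lt_iff₀ hδ] at hlt
    have : (1 - 1 / δ * softMoment α) * δ = δ - softMoment α := by field_simp
    rw [this] at hlt
    linarith

theorem exists_softMoment_le {ε : ℝ} (hε : 0 < ε) : ∃ α : ℝ, 0 < α ∧ softMoment α ≤ ε := by
  have i4 : Integrable (fun x : ℝ => x ^ 4) (gaussianReal 0 1) := by
    have := (memLp_id_gaussianReal (μ := 0) (v := 1) 4).integrable_norm_pow (by norm_num)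
    refine this.congr (Filter.Eventually.of_forall fun x => ?_)
    have : |x| ^ 4 = x ^ 4 := by
      rw [show (4:ℕ) = 2 * 2 from rfl, pow_mul, pow_mul, sq_abs]
    simpa using this
  set M := ∫ x : ℝ, x ^ 4 ∂(gaussianReal 0 1) with hM
  have hM0 : 0 ≤ M := integral_nonneg fun x => by positivity
  refine ⟨1 + M / ε, by positivity, ?_⟩
  set α := 1 + M / ε with hαd
  have hα1 : 1 ≤ α := by rw [hαd]; linarith [div_nonneg hM0 hε.le]
  have hαM : M ≤ ε * α := by
    rw [hαd, mul_add, mul_div_cancel₀ _ hε.ne']; linarith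
  have hb : softMoment α ≤ ∫ x : ℝ, (1 / α) * x ^ 4 ∂(gaussianReal 0 1) := by
    refine integral_mono (softMoment_integrable (by linarith)) (i4.const_mul _) fun x => ?_
    have hα0 : 0 < α := by linarith
    simp only
    rw [one_div, inv_mul_eq_div, le_div_iff₀ hα0]
    rcases le_or_gt (|x|) α with h | h
    · rw [max_eq_right (by linarith)]
      have : 0 ≤ x ^ 4 := by positivity
      linarith
    · rw [max_eq_left (by linarith)]
      have e : x ^ 4 = |x| ^ 4 := by
        rw [show (4:ℕ) = 2 * 2 from rfl, pow_mul, pow_mul, sq_abs]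
      rw [e]
      have h1 : (|x| - α) ^ 2 ≤ |x| ^ 2 := by nlinarith
      have h2 : α ≤ |x| ^ 2 := by nlinarith
      calc (|x| - α) ^ 2 * α ≤ |x| ^ 2 * |x| ^ 2 := mul_le_mul h1 h2 (by linarith) (by positivity)
        _ = |x| ^ 4 := by ring
  rw [integral_const_mul, ← hM] at hb
  refine hb.trans ?_
  rw [one_div, inv_mul_le_iff₀ (by linarith)]
  linarith

theorem Fball_card_le {N : ℕ} (hN : 0 < N) {p ξ s : ℝ} (hp : 0 < p) (hξ : 0 < ξ) (hs : 0 < s)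
    {θ : Fin N → ℝ} (hθ : θ ∈ Fball N p ξ) :
    ((Finset.univ.filter (fun j => ξ * s ^ (-(1 / p)) < |θ j|)).card : ℝ) ≤ s * N := by
  have hN' : (0:ℝ) < N := by exact_mod_cast hN
  have hθ' : (1 / (N : ℝ)) * ∑ i, |θ i| ^ p ≤ ξ ^ p := hθ
  rw [one_div, inv_mul_le_iff₀ hN'] at hθ'
  set K := ξ * s ^ (-(1 / p)) with hK
  have hK0 : 0 < K := by positivity
  have hKp : K ^ p = ξ ^ p / s := by
    rw [hK, Real.mul_rpow hξ.le (by positivity), ← Real.rpow_mul hs.le]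
    have : -(1 / p) * p = -1 := by field_simp
    rw [this, Real.rpow_neg_one, div_eq_mul_inv]
  have h1 : ((Finset.univ.filter (fun j => K < |θ j|)).card : ℝ) * K ^ p ≤ ∑ i, |θ i| ^ p := by
    rw [← nsmul_eq_mul]
    refine (Finset.card_nsmul_le_sum _ (fun i => |θ i| ^ p) _ fun i hi => ?_).trans
      (Finset.sum_le_sum_of_subset_of_nonneg (Finset.filter_subset _ _) fun i _ _ => by positivity)
    exact Real.rpow_le_rpow hK0.le (Finset.mem_filter.1 hi).2.le hp.le
  have hξp : 0 < ξ ^ p := Real.rpow_pos_of_pos hξ p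
  rw [hKp] at h1
  have h2 : ((Finset.univ.filter (fun j => K < |θ j|)).card : ℝ) * (ξ ^ p / s) ≤ N * ξ ^ p := h1.trans hθ'
  rw [mul_div_assoc', div_le_iff₀ hs] at h2
  have h3 : ξ ^ p * ((Finset.univ.filter (fun j => K < |θ j|)).card : ℝ) ≤ ξ ^ p * (s * N) := by linarith
  exact le_of_mul_le_mul_left h3 hξp

theorem half_le_fold {k : ℕ} (hk : 2 ≤ k) : (1:ℝ) / 2 ≤ ((k : ℝ) - 1) / k := by
  have : (2:ℝ) ≤ k := by exact_mod_cast hk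
  rw [div_le_div_iff₀ (by norm_num) (by linarith)]; linarith

open Classical in
theorem DFamSpec.exists_belowThreshold {δ q : ℝ} (hδ : 0 < δ) {Dfam : (M : ℕ) → Set (Fin M → ℝ)}
    (hD : DFamSpec δ Dfam q) :
    0 ≤ q ∧ ∃ K s α κ : ℝ, 0 ≤ K ∧ 0 < α ∧ 0 < κ ∧ ∀ N k : ℕ, 0 < N → 2 ≤ k →
      (∀ s : ℝ, (∀ M, Dfam M = F0ball M s) → s < smax (((k : ℝ) - 1) * δ / k)) →
      ∀ θ ∈ Dfam N, BelowThreshold δ (((k : ℝ) - 1) / k) K s α κ θ := by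
  rcases hD with ⟨p, ξ, hp, hξ, hF, rfl⟩ | ⟨s, hs, -, hF, rfl⟩
  · refine ⟨le_max_right _ _, ?_⟩
    obtain ⟨α, hα, hsm⟩ := exists_softMoment_le (show 0 < δ / 8 by linarith)
    set s := δ / (8 * (1 + α ^ 2)) with hs
    have hs0 : 0 < s := by positivity
    refine ⟨ξ * s ^ (-(1 / p)), s, α, δ / 4, by positivity, hα, by positivity, ?_⟩
    intro N k hN hk _ θ hθ
    rw [hF] at hθ
    refine ⟨by simpa using Fball_card_le hN hp hξ hs0 hθ, ?_⟩
    have h1 := half_le_fold hk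
    have h2 : s * (1 + α ^ 2) = δ / 8 := by rw [hs]; field_simp
    have h3 : (1:ℝ) / 2 * δ ≤ ((k : ℝ) - 1) / k * δ := mul_le_mul_of_nonneg_right h1 hδ.le
    have h4 : 0 ≤ s * softMoment α := mul_nonneg hs0.le (softMoment_nonneg α)
    linarith
  · refine ⟨le_rfl, ?_⟩
    by_cases hex : ∃ k : ℕ, 2 ≤ k ∧ s < smax (((k : ℝ) - 1) * δ / k)
    · set k0 := Nat.find hex with hk0
      obtain ⟨h2, hlt⟩ := Nat.find_spec hex
      rw [← hk0] at h2 hlt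
      have hh := half_le_fold h2
      have hδ' : 0 < ((k0 : ℝ) - 1) * δ / k0 := by
        rw [mul_div_right_comm]; exact mul_pos (by linarith) hδ
      obtain ⟨α, hα, hg⟩ := exists_softMoment_gap hδ' hs hlt
      refine ⟨0, s, α, ((k0 : ℝ) - 1) * δ / k0 - (s * (1 + α ^ 2) + (1 - s) * softMoment α),
        le_rfl, hα, by linarith, ?_⟩
      intro N k hN hk hall θ hθ
      have hle : k0 ≤ k := Nat.find_min' hex ⟨hk, hall s hF⟩
      rw [hF] at hθ
      refine ⟨?_, ?_⟩
      · have : (l0 θ : ℝ) ≤ s * N := hθ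
        simpa [l0, abs_pos] using this
      · have h2' : (2:ℝ) ≤ k0 := by exact_mod_cast h2
        have hle' : (k0:ℝ) ≤ k := by exact_mod_cast hle
        have : ((k0 : ℝ) - 1) / k0 ≤ ((k : ℝ) - 1) / k := by
          rw [div_le_div_iff₀ (by linarith) (by linarith)]; linarith
        have h5 := mul_le_mul_of_nonneg_right this hδ.le
        rw [mul_div_right_comm ((k0:ℝ) - 1)]
        linarith
    · refine ⟨0, 0, 1, 1, le_rfl, one_pos, one_pos, ?_⟩
      intro N k hN hk hall
      exact absurd ⟨k, hk, hall s hF⟩ hex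

theorem measure_not_forall_le {Ω I : Type*} [MeasurableSpace Ω] (μ : Measure Ω) (s : Finset I)
    (P : I → Ω → Prop) {B : ℝ} (h : ∀ i ∈ s, μ {ω | ¬ P i ω} ≤ ENNReal.ofReal B) :
    μ {ω | ¬ ∀ i ∈ s, P i ω} ≤ ENNReal.ofReal (s.card * B) := by
  have h1 : {ω | ¬ ∀ i ∈ s, P i ω} ⊆ ⋃ i ∈ s, {ω | ¬ P i ω} := by
    intro ω hω
    have hω' : ¬ ∀ i ∈ s, P i ω := hω
    push Not at hω'
    obtain ⟨i, hi, hi'⟩ := hω'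
    exact Set.mem_biUnion hi hi'
  refine (measure_mono h1).trans ((measure_biUnion_finset_le _ _).trans ?_)
  refine (Finset.sum_le_sum h).trans (le_of_eq ?_)
  rw [Finset.sum_const, nsmul_eq_mul, ENNReal.ofReal_mul (by positivity), ENNReal.ofReal_natCast]

theorem measure_not_and_le {Ω : Type*} [MeasurableSpace Ω] (μ : Measure Ω)
    (P Q : Ω → Prop) {A B : ℝ} (hA0 : 0 ≤ A) (hB0 : 0 ≤ B) (hA : μ {ω | ¬ P ω} ≤ ENNReal.ofReal A)
    (hB : μ {ω | ¬ Q ω} ≤ ENNReal.ofReal B) :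
    μ {ω | ¬ (P ω ∧ Q ω)} ≤ ENNReal.ofReal (A + B) := by
  have h1 : {ω | ¬ (P ω ∧ Q ω)} ⊆ {ω | ¬ P ω} ∪ {ω | ¬ Q ω} := by
    intro ω hω
    have hω' : ¬ (P ω ∧ Q ω) := hω
    by_cases h : P ω
    · exact Or.inr fun hq => hω' ⟨h, hq⟩
    · exact Or.inl h
  refine (measure_mono h1).trans ((measure_union_le _ _).trans ?_)
  rw [ENNReal.ofReal_add hA0 hB0]
  exact add_le_add hA hB

/-- Norm of the residuals on a fold. -/
def foldRes {k m N : ℕ} (σ n : ℝ) (i : Fin k) (G : (Fin k × Fin m) × Option (Fin N) → ℝ)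
    (w : Fin N → ℝ) : ℝ :=
  nrm (fun r : {r : Fin k × Fin m // r.1 = i} => resid σ n G w r.1)

/-- Penalized residual sum of squares with one fold removed. -/
def foldObj {k m N : ℕ} (σ n L : ℝ) (θ : Fin N → ℝ) (i : Fin k)
    (G : (Fin k × Fin m) × Option (Fin N) → ℝ) (w : Fin N → ℝ) : ℝ :=
  trainObj σ n L θ (fun r : {r : Fin k × Fin m // r.1 ≠ i} => r.1) G w

/-- Uniform lower bound for the perturbed objective with one fold removed. -/
def FoldLower {k m N : ℕ} (σ n L τ1 C1 : ℝ) (θ : Fin N → ℝ) (i : Fin k) (b r ε y e : ℝ)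
    (G : (Fin k × Fin m) × Option (Fin N) → ℝ) : Prop :=
  ∀ w, tau σ n w ≤ τ1 →
    n * (Phi σ (((k : ℝ) - 1) / k) L n θ b r - C1 * (tau σ n w - r * √(((k : ℝ) - 1) / k)) ^ 2
      + e * y * (1 / √(k : ℝ)) * tau σ n w - C1 * y ^ 2 - ε)
      ≤ foldObj σ n L θ i G w + e * y * √n * foldRes σ n i G w

/-- Upper bound for the minimal value of the objective with one fold removed. -/
def FoldUpper {k m N : ℕ} (σ n L : ℝ) (θ : Fin N → ℝ) (i : Fin k) (b r ε : ℝ)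
    (G : (Fin k × Fin m) × Option (Fin N) → ℝ) : Prop :=
  ∀ u, (∀ w, foldObj σ n L θ i G u ≤ foldObj σ n L θ i G w) →
    foldObj σ n L θ i G u ≤ n * (Phi σ (((k : ℝ) - 1) / k) L n θ b r + ε)

/-- Splitting the rows into a training part and a fold. -/
def foldSplit {k m N : ℕ} (i : Fin k)
    (p : ({r : Fin k × Fin m // r.1 ≠ i} ⊕ {r : Fin k × Fin m // r.1 = i}) × Option (Fin N)) :
    (Fin k × Fin m) × Option (Fin N) :=
  (Sum.elim (fun r => r.1) (fun r => r.1) p.1, p.2)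

theorem foldSplit_injective {k m N : ℕ} (i : Fin k) :
    Function.Injective (foldSplit (m := m) (N := N) i) := by
  rintro ⟨⟨r, hr⟩ | ⟨r, hr⟩, c⟩ ⟨⟨r', hr'⟩ | ⟨r', hr'⟩, c'⟩ h
  all_goals
    simp only [foldSplit, Sum.elim_inl, Sum.elim_inr, Prod.mk.injEq] at h
    obtain ⟨h1, h2⟩ := h
    subst h1
    subst h2
  · rfl
  · exact absurd hr' hr
  · exact absurd hr hr'
  · rfl

theorem card_fold {k m : ℕ} (i : Fin k) :
    Fintype.card {r : Fin k × Fin m // r.1 = i} = m := by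
  rw [Fintype.card_subtype]
  have : (Finset.univ.filter fun r : Fin k × Fin m => r.1 = i) = {i} ×ˢ Finset.univ := by
    ext ⟨a, b⟩; simp [eq_comm]
  rw [this, Finset.card_product]; simp

theorem card_train {k m : ℕ} (i : Fin k) :
    (Fintype.card {r : Fin k × Fin m // r.1 ≠ i} : ℝ) = ((k : ℝ) - 1) * m := by
  have h := Fintype.card_subtype_compl (fun r : Fin k × Fin m => r.1 = i)
  rw [card_fold] at h
  have hk : 0 < k := i.pos
  have hle : m ≤ k * m := Nat.le_mul_of_pos_left m hk
  have h2 : Fintype.card {r : Fin k × Fin m // r.1 ≠ i} = k * m - m := by simpa using h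
  rw [h2, Nat.cast_sub hle]; push_cast; ring

theorem foldLower_prob {δ σ b0 b1 r0 r1 Lmax τ1 : ℝ} (hδ : 0 < δ) (hσ : 0 < σ) (hb0 : 0 < b0)
    (hb01 : b0 ≤ b1) (hr0 : 0 < r0) (hr01 : r0 ≤ r1) (hLmax : 0 ≤ Lmax) (hτ1 : 0 ≤ τ1) :
    ∃ c C1 : ℝ, 0 < c ∧ 0 < C1 ∧ ∀ (k m N : ℕ) (i : Fin k) (n L b r ε y e : ℝ) (θ : Fin N → ℝ),
      0 < N → 2 ≤ k → 0 < m → n = ((k * m : ℕ) : ℝ) → n = δ * N → 0 ≤ L → L ≤ Lmax →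
      b0 ≤ b → b ≤ b1 → r0 ≤ r → r ≤ r1 → 0 < ε → ε ≤ 1 → 0 ≤ y → y ≤ 1 / √(k : ℝ) →
      (e = 1 ∨ e = -1) →
      gaussPi ((Fin k × Fin m) × Option (Fin N)) {G | ¬ FoldLower σ n L τ1 C1 θ i b r ε y e G}
        ≤ ENNReal.ofReal (32 * Real.exp (- c * n * ε ^ 2)) := by
  obtain ⟨c, C1, hc, hC1, H⟩ := base_lower hδ hσ hb0 hb01 hr0 hr01 hLmax hτ1
  refine ⟨c, C1, hc, hC1, ?_⟩
  intro k m N i n L b r ε y e θ hN hk hm hnk hn hL hL1 hb hb' hr hr' hε hε1 hy hy1 he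
  have hk2 : (2:ℝ) ≤ k := by exact_mod_cast hk
  have hk0 : (0:ℝ) < k := by linarith
  have : Nonempty {r : Fin k × Fin m // r.1 = i} := ⟨⟨(i, ⟨0, hm⟩), rfl⟩⟩
  have : Nonempty {r : Fin k × Fin m // r.1 ≠ i} := by
    have : Nontrivial (Fin k) := Fin.nontrivial_iff_two_le.2 hk
    obtain ⟨j, hj⟩ := exists_ne i
    exact ⟨⟨(j, ⟨0, hm⟩), hj⟩⟩
  have ha1 : 1 / √(k : ℝ) ≤ 1 := by
    rw [div_le_one (Real.sqrt_pos.2 hk0)]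
    exact Real.one_le_sqrt.2 (by linarith)
  have hν1 : ((k : ℝ) - 1) / k ≤ 1 := by rw [div_le_one hk0]; linarith
  have hR1 : (Fintype.card {r : Fin k × Fin m // r.1 ≠ i} : ℝ) = ((k : ℝ) - 1) / k * n := by
    rw [card_train, hnk]; push_cast; field_simp
  have hR2 : (Fintype.card {r : Fin k × Fin m // r.1 = i} : ℝ) = (1 / √(k : ℝ)) ^ 2 * n := by
    rw [card_fold, hnk, div_pow, Real.sq_sqrt hk0.le]; push_cast; field_simp
  refine le_trans ?_ (H {r : Fin k × Fin m // r.1 ≠ i} {r : Fin k × Fin m // r.1 = i} N n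
    (((k : ℝ) - 1) / k) (1 / √(k : ℝ)) L b r ε y e θ hN hn (half_le_fold hk) hν1
    (by positivity) ha1 hR1 hR2 hL hL1 hb hb' hr hr' hε hε1 hy hy1 he)
  have hp := gaussPi_reindex (foldSplit (m := m) (N := N) i) (foldSplit_injective i)
  rw [← hp.map_eq]
  refine le_trans (measure_mono ?_) (Measure.le_map_apply hp.measurable.aemeasurable _)
  intro G hG
  have hG' : ¬ FoldLower σ n L τ1 C1 θ i b r ε y e G := hG
  unfold FoldLower at hG'
  push Not at hG'
  obtain ⟨w, hw, hlt⟩ := hG'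
  exact ⟨w, hw, hlt⟩

theorem foldUpper_prob {δ σ b0 b1 r0 r1 Lmax : ℝ} (hδ : 0 < δ) (hσ : 0 < σ) (hb0 : 0 < b0)
    (hb01 : b0 ≤ b1) (hr0 : 0 < r0) (hr01 : r0 ≤ r1) (hLmax : 0 ≤ Lmax) :
    ∃ c : ℝ, 0 < c ∧ ∀ (k m N : ℕ) (i : Fin k) (n L b r ε : ℝ) (θ : Fin N → ℝ),
      0 < N → 2 ≤ k → n = ((k * m : ℕ) : ℝ) → n = δ * N → 0 ≤ L → L ≤ Lmax →
      b0 ≤ b → b ≤ b1 → r0 ≤ r → r ≤ r1 → 0 < ε → ε ≤ 1 →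
      IsSaddle σ (((k : ℝ) - 1) / k) L n θ b r →
      gaussPi ((Fin k × Fin m) × Option (Fin N)) {G | ¬ FoldUpper σ n L θ i b r ε G}
        ≤ ENNReal.ofReal (32 * Real.exp (- c * n * ε ^ 2)) := by
  obtain ⟨c, hc, H⟩ := base_upper hδ hσ hb0 hb01 hr0 hr01 hLmax
  refine ⟨c, hc, ?_⟩
  intro k m N i n L b r ε θ hN hk hnk hn hL hL1 hb hb' hr hr' hε hε1 hs
  have hk2 : (2:ℝ) ≤ k := by exact_mod_cast hk
  have hk0 : (0:ℝ) < k := by linarith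
  have ha1 : 1 / √(k : ℝ) ≤ 1 := by
    rw [div_le_one (Real.sqrt_pos.2 hk0)]
    exact Real.one_le_sqrt.2 (by linarith)
  have hν1 : ((k : ℝ) - 1) / k ≤ 1 := by rw [div_le_one hk0]; linarith
  have hR1 : (Fintype.card {r : Fin k × Fin m // r.1 ≠ i} : ℝ) = ((k : ℝ) - 1) / k * n := by
    rw [card_train, hnk]; push_cast; field_simp
  have hR2 : (Fintype.card {r : Fin k × Fin m // r.1 = i} : ℝ) = (1 / √(k : ℝ)) ^ 2 * n := by
    rw [card_fold, hnk, div_pow, Real.sq_sqrt hk0.le]; push_cast; field_simp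
  refine le_trans ?_ (H {r : Fin k × Fin m // r.1 ≠ i} {r : Fin k × Fin m // r.1 = i} N n
    (((k : ℝ) - 1) / k) (1 / √(k : ℝ)) L b r ε θ hN hn (half_le_fold hk) hν1
    (by positivity) ha1 hR1 hR2 hL hL1 hb hb' hr hr' hε hε1 hs)
  have hp := gaussPi_reindex (foldSplit (m := m) (N := N) i) (foldSplit_injective i)
  rw [← hp.map_eq]
  refine le_trans (measure_mono ?_) (Measure.le_map_apply hp.measurable.aemeasurable _)
  intro G hG
  have hG' : ¬ FoldUpper σ n L θ i b r ε G := hG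
  unfold FoldUpper at hG'
  push Not at hG'
  obtain ⟨u, hu, hlt⟩ := hG'
  exact ⟨u, hu, hlt⟩

theorem noise_prob : ∃ c : ℝ, 0 < c ∧ ∀ (k m N : ℕ) (n : ℝ), n = ((k * m : ℕ) : ℝ) →
    gaussPi ((Fin k × Fin m) × Option (Fin N))
      {G | ¬ ∑ r : Fin k × Fin m, G (r, none) ^ 2 ≤ 2 * n} ≤ ENNReal.ofReal (32 * Real.exp (- c * n)) := by
  obtain ⟨c, hc, H⟩ := gaussPi_concentration 1 one_pos
  refine ⟨c, hc, ?_⟩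
  intro k m N n hn
  have hp := gaussPi_reindex (fun r : Fin k × Fin m => (r, (none : Option (Fin N))))
    (fun a b h => (Prod.mk.inj h).1)
  have h := H (Fin k × Fin m) (fun _ x => x ^ 2) n 1 (fun _ => by fun_prop)
    (fun _ x => by rw [abs_of_nonneg (sq_nonneg x)]; linarith) (by rw [hn]; simp) zero_le_one le_rfl
  rw [one_pow, mul_one] at h
  refine le_trans ?_ (h.trans (ENNReal.ofReal_le_ofReal (by
    linarith [Real.exp_pos (-c * n)])))
  rw [← hp.map_eq]
  refine le_trans (measure_mono ?_) (Measure.le_map_apply hp.measurable.aemeasurable _)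
  intro G hG
  have hG' : ¬ ∑ r : Fin k × Fin m, G (r, none) ^ 2 ≤ 2 * n := hG
  push Not at hG'
  have : 1 * n ≤ ∑ r : Fin k × Fin m, (G (r, none) ^ 2 - ∫ y : ℝ, y ^ 2 ∂(gaussianReal 0 1)) := by
    rw [Finset.sum_sub_distrib, integral_sq_stdGaussian]
    have : ∑ _r : Fin k × Fin m, (1:ℝ) = n := by rw [hn]; simp
    rw [this]; linarith
  exact this

/-- Regularity of the draw for one fold and one penalty level. -/
structure FoldGood {k m N : ℕ} (σ n L α τ1 C1 : ℝ) (J : ℕ) (θ : Fin N → ℝ) (i : Fin k) (b r : ℝ)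
    (G : (Fin k × Fin m) × Option (Fin N) → ℝ) : Prop where
  coercive : FoldLower σ n L τ1 C1 θ i (L / α) (τ1 / √(((k : ℝ) - 1) / k)) 1 0 1 G
  grid : ∀ g ∈ Finset.range (J * k + 1),
    FoldLower σ n L τ1 C1 θ i b (σ + (g : ℝ) / k) (1 / (k : ℝ) ^ 2) 0 1 G
  plus : FoldLower σ n L τ1 C1 θ i b r (1 / (k : ℝ) ^ 2) (1 / k) 1 G
  minus : FoldLower σ n L τ1 C1 θ i b r (1 / (k : ℝ) ^ 2) (1 / k) (-1) G
  upper : FoldUpper σ n L θ i b r (1 / (k : ℝ) ^ 2) G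

/-- Regularity of the draw for all folds and all penalty levels of a grid. -/
structure CVGood {k m N : ℕ} (σ n α τ1 C1 : ℝ) (J A : ℕ) (θ : Fin N → ℝ) (Λ B Rs : ℕ → ℝ)
    (G : (Fin k × Fin m) × Option (Fin N) → ℝ) : Prop where
  fold : ∀ l ∈ Finset.range (A * k ^ 2 + 1), ∀ i ∈ Finset.univ,
    FoldGood σ n (Λ l) α τ1 C1 J θ i (B l) (Rs l) G
  noise : ∑ r : Fin k × Fin m, G (r, none) ^ 2 ≤ 2 * n

set_option maxHeartbeats 1000000 in
theorem cvGood_prob {δ σ α b0 b1 R Lmin Lmax τ1 : ℝ} (J A : ℕ) (hδ : 0 < δ) (hσ : 0 < σ)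
    (hα : 0 < α) (hb0 : 0 < b0) (hR : σ ≤ R) (hL0 : 0 < Lmin) (hL01 : Lmin ≤ Lmax)
    (hτ1 : σ ≤ τ1) :
    ∃ c C1 C : ℝ, 0 < c ∧ 0 < C1 ∧ 0 < C ∧ ∀ (k m N : ℕ) (n : ℝ) (θ : Fin N → ℝ) (Λ B Rs : ℕ → ℝ),
      0 < N → 2 ≤ k → 0 < m → n = ((k * m : ℕ) : ℝ) → n = δ * N →
      (∀ l, l ≤ A * k ^ 2 → Lmin ≤ Λ l ∧ Λ l ≤ Lmax ∧ b0 ≤ B l ∧ B l ≤ b1 ∧ σ ≤ Rs l ∧ Rs l ≤ R ∧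
        IsSaddle σ (((k : ℝ) - 1) / k) (Λ l) n θ (B l) (Rs l)) →
      gaussPi ((Fin k × Fin m) × Option (Fin N)) {G | ¬ CVGood σ n α τ1 C1 J A θ Λ B Rs G}
        ≤ ENNReal.ofReal (C * (k : ℝ) ^ 4 * Real.exp (- c * n / (k : ℝ) ^ 4)) := by
  have hτ0 : 0 < τ1 := hσ.trans_le hτ1
  have hLmax : 0 < Lmax := hL0.trans_le hL01
  set b0' := min b0 (Lmin / α) with hb0'
  set b1' := max b1 (Lmax / α) with hb1'
  set r1 := σ + J + R + 2 * τ1 with hr1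
  have hb0p : 0 < b0' := lt_min hb0 (by positivity)
  have hb01' : b0' ≤ b1' := (min_le_right _ _).trans
    ((div_le_div_of_nonneg_right hL01 hα.le).trans (le_max_right _ _))
  have hJ : (0:ℝ) ≤ J := Nat.cast_nonneg J
  have hr01 : σ ≤ r1 := by rw [hr1]; linarith
  obtain ⟨c1, C1, hc1, hC1, Hlow⟩ := foldLower_prob hδ hσ hb0p hb01' hσ hr01 hLmax.le hτ0.le
  obtain ⟨c2, hc2, Hup⟩ := foldUpper_prob hδ hσ hb0p hb01' hσ hr01 hLmax.le
  obtain ⟨c3, hc3, Hz⟩ := noise_prob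
  set c := min c1 (min c2 c3) with hc
  have hcc1 : c ≤ c1 := min_le_left _ _
  have hcc2 : c ≤ c2 := (min_le_right _ _).trans (min_le_left _ _)
  have hcc3 : c ≤ c3 := (min_le_right _ _).trans (min_le_right _ _)
  have hc0 : 0 < c := lt_min hc1 (lt_min hc2 hc3)
  refine ⟨c, C1, 32 * ((A + 1) * (J + 5) + 1), hc0, hC1, by positivity, ?_⟩
  intro k m N n θ Λ B Rs hN hk hm hnk hn hsad
  have hN' : (0:ℝ) < N := by exact_mod_cast hN
  have hn0 : 0 < n := by rw [hn]; positivity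
  have hk2 : (2:ℝ) ≤ k := by exact_mod_cast hk
  have hk0 : (0:ℝ) < k := by linarith
  set E := 32 * Real.exp (- c * n / (k : ℝ) ^ 4) with hE
  have hE0 : 0 < E := by positivity
  have hk1 : 1 / (k : ℝ) ^ 2 ≤ 1 := by
    rw [div_le_one (by positivity)]; nlinarith
  have hexp : ∀ c' ε : ℝ, c ≤ c' → 1 / (k : ℝ) ^ 2 ≤ ε →
      ENNReal.ofReal (32 * Real.exp (- c' * n * ε ^ 2)) ≤ ENNReal.ofReal E := by
    intro c' ε hc' hε
    refine ENNReal.ofReal_le_ofReal ?_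
    rw [hE]
    refine mul_le_mul_of_nonneg_left (Real.exp_le_exp.2 ?_) (by norm_num)
    have h1 : (1 / (k : ℝ) ^ 2) ^ 2 ≤ ε ^ 2 := pow_le_pow_left₀ (by positivity) hε 2
    have h2 : c * n * (1 / (k : ℝ) ^ 2) ^ 2 ≤ c' * n * ε ^ 2 :=
      mul_le_mul (mul_le_mul_of_nonneg_right hc' hn0.le) h1 (by positivity)
        (mul_nonneg (hc0.le.trans hc') hn0.le)
    have h3 : c * n * (1 / (k : ℝ) ^ 2) ^ 2 = c * n / (k : ℝ) ^ 4 := by field_simp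
    rw [h3] at h2
    have h4 : - c * n / (k : ℝ) ^ 4 = - (c * n / (k : ℝ) ^ 4) := by ring
    rw [h4]; linarith
  have hν := half_le_fold hk
  have hsν : 1 / 2 ≤ √(((k : ℝ) - 1) / k) := by
    refine Real.le_sqrt_of_sq_le ?_; linarith
  have hν1 : ((k : ℝ) - 1) / k ≤ 1 := by rw [div_le_one hk0]; linarith
  have hsν1 : √(((k : ℝ) - 1) / k) ≤ 1 := Real.sqrt_le_one.2 hν1
  have hsν0 : 0 < √(((k : ℝ) - 1) / k) := by linarith
  have hsk : 1 / (k : ℝ) ≤ 1 / √(k : ℝ) := by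
    refine one_div_le_one_div_of_le (Real.sqrt_pos.2 hk0) ?_
    rw [Real.sqrt_le_left hk0.le]; nlinarith
  have hsk0 : 0 ≤ 1 / √(k : ℝ) := by positivity
  have hfold : ∀ l ∈ Finset.range (A * k ^ 2 + 1), ∀ i ∈ (Finset.univ : Finset (Fin k)),
      gaussPi ((Fin k × Fin m) × Option (Fin N))
        {G | ¬ FoldGood σ n (Λ l) α τ1 C1 J θ i (B l) (Rs l) G}
        ≤ ENNReal.ofReal ((J * k + 5) * E) := by
    intro l hl i _
    obtain ⟨h1, h2, h3, h4, h5, h6, h7⟩ := hsad l (Nat.lt_succ_iff.1 (Finset.mem_range.1 hl))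
    have hΛ0 : 0 ≤ Λ l := hL0.le.trans h1
    have p1 : gaussPi ((Fin k × Fin m) × Option (Fin N))
        {G | ¬ FoldLower σ n (Λ l) τ1 C1 θ i (Λ l / α) (τ1 / √(((k : ℝ) - 1) / k)) 1 0 1 G}
        ≤ ENNReal.ofReal E := by
      refine (Hlow k m N i n (Λ l) (Λ l / α) (τ1 / √(((k : ℝ) - 1) / k)) 1 0 1 θ hN hk hm hnk hn hΛ0 h2
        ((min_le_right _ _).trans (div_le_div_of_nonneg_right h1 hα.le))
        ((div_le_div_of_nonneg_right h2 hα.le).trans (le_max_right _ _)) ?_ ?_ one_pos le_rfl le_rfl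
        hsk0 (Or.inl rfl)).trans (hexp c1 1 hcc1 hk1)
      · rw [le_div_iff₀ hsν0]; nlinarith
      · rw [div_le_iff₀ hsν0, hr1]
        have : τ1 ≤ (2 * τ1) * √(((k : ℝ) - 1) / k) := by nlinarith
        refine this.trans (mul_le_mul_of_nonneg_right ?_ hsν0.le); linarith
    have hBl : b0' ≤ B l := (min_le_left _ _).trans h3
    have hBl1 : B l ≤ b1' := h4.trans (le_max_left _ _)
    have hRl : Rs l ≤ r1 := by rw [hr1]; linarith
    have hεk : 0 < 1 / (k : ℝ) ^ 2 := by positivity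
    have p2 : ∀ g ∈ Finset.range (J * k + 1), gaussPi ((Fin k × Fin m) × Option (Fin N))
        {G | ¬ FoldLower σ n (Λ l) τ1 C1 θ i (B l) (σ + (g : ℝ) / k) (1 / (k : ℝ) ^ 2) 0 1 G}
        ≤ ENNReal.ofReal E := by
      intro g hg
      have hg1 : (g : ℝ) ≤ J * k := by exact_mod_cast Nat.lt_succ_iff.1 (Finset.mem_range.1 hg)
      have hg2 : (g : ℝ) / k ≤ J := by rw [div_le_iff₀ hk0]; exact hg1
      have hg0 : 0 ≤ (g : ℝ) / k := by positivity
      exact (Hlow k m N i n (Λ l) (B l) _ _ 0 1 θ hN hk hm hnk hn hΛ0 h2 hBl hBl1 (by linarith)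
        (by rw [hr1]; linarith) hεk hk1 le_rfl hsk0 (Or.inl rfl)).trans (hexp c1 _ hcc1 le_rfl)
    have p3 : ∀ e : ℝ, (e = 1 ∨ e = -1) → gaussPi ((Fin k × Fin m) × Option (Fin N))
        {G | ¬ FoldLower σ n (Λ l) τ1 C1 θ i (B l) (Rs l) (1 / (k : ℝ) ^ 2) (1 / k) e G}
        ≤ ENNReal.ofReal E := fun e he =>
      (Hlow k m N i n (Λ l) (B l) _ _ _ e θ hN hk hm hnk hn hΛ0 h2 hBl hBl1 h5
        hRl hεk hk1 (by positivity) hsk he).trans (hexp c1 _ hcc1 le_rfl)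
    have p4 : gaussPi ((Fin k × Fin m) × Option (Fin N))
        {G | ¬ FoldUpper σ n (Λ l) θ i (B l) (Rs l) (1 / (k : ℝ) ^ 2) G}
        ≤ ENNReal.ofReal E :=
      (Hup k m N i n (Λ l) (B l) _ _ θ hN hk hnk hn hΛ0 h2 hBl hBl1 h5
        hRl hεk hk1 h7).trans (hexp c2 _ hcc2 le_rfl)
    have q2 := measure_not_forall_le (gaussPi ((Fin k × Fin m) × Option (Fin N)))
      (Finset.range (J * k + 1)) _ p2
    rw [Finset.card_range] at q2
    have q3 := measure_not_and_le _ _ _ hE0.le hE0.le (p3 (-1) (Or.inr rfl)) p4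
    have q4 := measure_not_and_le _ _ _ hE0.le (by positivity) (p3 1 (Or.inl rfl)) q3
    have q5 := measure_not_and_le _ _ _ (by positivity) (by positivity) q2 q4
    have q6 := measure_not_and_le _ _ _ hE0.le (by positivity) p1 q5
    refine le_trans (measure_mono ?_) (q6.trans (ENNReal.ofReal_le_ofReal ?_))
    · intro G hG hgood
      exact hG ⟨hgood.1, hgood.2.1, hgood.2.2.1, hgood.2.2.2.1, hgood.2.2.2.2⟩
    · push_cast
      linarith
  have hall := measure_not_forall_le (gaussPi ((Fin k × Fin m) × Option (Fin N)))
    (Finset.range (A * k ^ 2 + 1))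
    (fun l G => ∀ i ∈ (Finset.univ : Finset (Fin k)), FoldGood σ n (Λ l) α τ1 C1 J θ i (B l) (Rs l) G)
    (fun l hl => measure_not_forall_le _ Finset.univ
      (fun i G => FoldGood σ n (Λ l) α τ1 C1 J θ i (B l) (Rs l) G) (hfold l hl))
  rw [Finset.card_range, Finset.card_univ, Fintype.card_fin] at hall
  have hz1 := hexp c3 1 hcc3 hk1
  rw [one_pow, mul_one] at hz1
  have hz := (Hz k m N n hnk).trans hz1
  have htot := measure_not_and_le _
    (fun G => ∀ l ∈ Finset.range (A * k ^ 2 + 1), ∀ i ∈ (Finset.univ : Finset (Fin k)),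
      FoldGood σ n (Λ l) α τ1 C1 J θ i (B l) (Rs l) G)
    (fun G => ∑ r : Fin k × Fin m, G (r, none) ^ 2 ≤ 2 * n) (by positivity) hE0.le hall hz
  refine le_trans (measure_mono ?_) (htot.trans (ENNReal.ofReal_le_ofReal ?_))
  · intro G hG hgood
    exact hG ⟨hgood.1, hgood.2⟩
  · push_cast
    have hA : (0:ℝ) ≤ A := Nat.cast_nonneg A
    have hkk : (1:ℝ) ≤ k := by linarith
    have hk2' : (1:ℝ) ≤ (k:ℝ) ^ 2 := one_le_pow₀ hkk
    have hk4 : (1:ℝ) ≤ (k:ℝ) ^ 4 := one_le_pow₀ hkk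
    have e1 : (A * (k:ℝ) ^ 2 + 1) ≤ (A + 1) * (k:ℝ) ^ 2 := by linarith
    have e2 : (J * (k:ℝ) + 5) ≤ (J + 5) * k := by linarith
    have e3 : (A * (k:ℝ) ^ 2 + 1) * (k * ((J * k + 5) * E)) ≤
        ((A + 1) * (k:ℝ) ^ 2) * (k * (((J + 5) * k) * E)) := by gcongr
    have e4 : E ≤ (k:ℝ) ^ 4 * E := le_mul_of_one_le_left hE0.le hk4
    have e5 : 32 * (((A:ℝ) + 1) * (J + 5) + 1) * (k:ℝ) ^ 4 * Real.exp (- c * n / (k : ℝ) ^ 4)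
        = ((A + 1) * (k:ℝ) ^ 2) * (k * (((J + 5) * k) * E)) + (k:ℝ) ^ 4 * E := by
      rw [hE]; ring
    rw [e5]; linarith

theorem abs_pen_le_of_tau_le {N : ℕ} {σ n δ τ1 : ℝ} (hδ : 0 < δ) (hN : 0 < N) (hn : n = δ * N)
    (θ : Fin N → ℝ) {w : Fin N → ℝ} (hw : tau σ n w ≤ τ1) : |pen θ w| ≤ n * (τ1 / √δ) := by
  have hN' : (0:ℝ) < N := by exact_mod_cast hN
  have hn0 : 0 < n := by rw [hn]; positivity
  have h1 : |pen θ w| ≤ ∑ j, |w j| * 1 := by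
    unfold pen
    refine (Finset.abs_sum_le_sum_abs _ _).trans (Finset.sum_le_sum fun j _ => ?_)
    have := abs_abs_sub_abs_le_abs_sub (θ j + w j) (θ j)
    simpa using this
  have h2 := sum_mul_le_nrm (fun j => |w j|) (fun _ : Fin N => (1:ℝ))
  have h3 : nrm (fun j => |w j|) = nrm w := by unfold nrm; simp
  have h4 : nrm (fun _ : Fin N => (1:ℝ)) = √N := by unfold nrm; simp
  rw [h3, h4] at h2
  have h5 := nrm_le_of_tau_le hn0 hw
  have hsd : √δ * √δ = δ := Real.mul_self_sqrt hδ.le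
  have hsN : √(N:ℝ) * √N = N := Real.mul_self_sqrt hN'.le
  have hsd0 : 0 < √δ := Real.sqrt_pos.2 hδ
  have h6 : √n = √δ * √N := by rw [hn, Real.sqrt_mul hδ.le]
  calc |pen θ w| ≤ nrm w * √N := h1.trans h2
    _ ≤ √n * τ1 * √N := mul_le_mul_of_nonneg_right h5 (Real.sqrt_nonneg _)
    _ = √δ * τ1 * (√N * √N) := by rw [h6]; ring
    _ = n * (τ1 / √δ) := by
      have e : δ * N * (τ1 / √δ) = δ / √δ * τ1 * N := by ring
      rw [hsN, hn, e, Real.div_sqrt]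

theorem foldObj_change {k m N : ℕ} (σ n L L' : ℝ) (θ : Fin N → ℝ) (i : Fin k)
    (G : (Fin k × Fin m) × Option (Fin N) → ℝ) (w : Fin N → ℝ) :
    foldObj σ n L θ i G w = foldObj σ n L' θ i G w + (L - L') * pen θ w := by
  unfold foldObj trainObj; ring

theorem foldObj_change_le {k m N : ℕ} {σ n δ τ1 L L' h : ℝ} (hδ : 0 < δ) (hN : 0 < N)
    (hn : n = δ * N) (hL : |L - L'| ≤ h) (θ : Fin N → ℝ) (i : Fin k)
    (G : (Fin k × Fin m) × Option (Fin N) → ℝ) {w : Fin N → ℝ} (hw : tau σ n w ≤ τ1) :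
    foldObj σ n L θ i G w ≤ foldObj σ n L' θ i G w + n * (h * τ1 / √δ) := by
  rw [foldObj_change σ n L L' θ i G w]
  have h1 := abs_pen_le_of_tau_le hδ hN hn θ hw
  have h2 : (L - L') * pen θ w ≤ h * (n * (τ1 / √δ)) := by
    refine (le_abs_self _).trans ?_
    rw [abs_mul]
    exact mul_le_mul hL h1 (abs_nonneg _) ((abs_nonneg _).trans hL)
  have h3 : h * (n * (τ1 / √δ)) = n * (h * τ1 / √δ) := by ring
  linarith

/-- Penalized residual sum of squares over all rows. -/
def fullObj {R : Type*} [Fintype R] {N : ℕ} (σ n L : ℝ) (θ : Fin N → ℝ)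
    (G : R × Option (Fin N) → ℝ) (w : Fin N → ℝ) : ℝ :=
  trainObj σ n L θ (fun r : R => r) G w

theorem fullObj_eq {k m N : ℕ} (σ n L : ℝ) (θ : Fin N → ℝ) (i : Fin k)
    (G : (Fin k × Fin m) × Option (Fin N) → ℝ) (w : Fin N → ℝ) :
    fullObj σ n L θ G w = foldObj σ n L θ i G w + foldRes σ n i G w ^ 2 / 2 := by
  unfold fullObj foldObj foldRes trainObj
  rw [nrm_sq, nrm_sq, nrm_sq]
  have := Fintype.sum_subtype_add_sum_subtype (fun r : Fin k × Fin m => r.1 = i)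
    (fun r => resid σ n G w r ^ 2)
  rw [← this]; ring

theorem sum_foldRes_sq {k m N : ℕ} (σ n : ℝ)
    (G : (Fin k × Fin m) × Option (Fin N) → ℝ) (w : Fin N → ℝ) :
    ∑ i, foldRes σ n i G w ^ 2 = nrm (fun r => resid σ n G w r) ^ 2 := by
  unfold foldRes
  simp only [nrm_sq]
  have := Fintype.sum_fiberwise (fun r : Fin k × Fin m => r.1) (fun r => resid σ n G w r ^ 2)
  exact this

theorem sum_foldObj {k m N : ℕ} (hk : 2 ≤ k) (σ n L : ℝ) (θ : Fin N → ℝ)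
    (G : (Fin k × Fin m) × Option (Fin N) → ℝ) (w : Fin N → ℝ) :
    ∑ i, foldObj σ n (L * (((k : ℝ) - 1) / k)) θ i G w = ((k : ℝ) - 1) * fullObj σ n L θ G w := by
  have hk2 : (2:ℝ) ≤ k := by exact_mod_cast hk
  have hk0 : (k:ℝ) ≠ 0 := by positivity
  have h1 : ∀ i : Fin k, foldObj σ n (L * (((k : ℝ) - 1) / k)) θ i G w
      = fullObj σ n (L * (((k : ℝ) - 1) / k)) θ G w - foldRes σ n i G w ^ 2 / 2 := fun i => by
    rw [fullObj_eq _ _ _ _ i]; ring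
  simp only [h1]
  rw [Finset.sum_sub_distrib, ← Finset.sum_div, sum_foldRes_sq, Finset.sum_const, Finset.card_univ,
    Fintype.card_fin, nsmul_eq_mul]
  unfold fullObj trainObj
  field_simp
  ring

theorem exists_foldObj_le {k m N : ℕ} (hk : 2 ≤ k) {σ n L : ℝ} {θ : Fin N → ℝ}
    {G : (Fin k × Fin m) × Option (Fin N) → ℝ} {u w : Fin N → ℝ}
    (h : fullObj σ n L θ G u ≤ fullObj σ n L θ G w) (j : Fin k) :
    ∃ i, foldObj σ n (L * (((k : ℝ) - 1) / k)) θ i G u ≤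
      foldObj σ n (L * (((k : ℝ) - 1) / k)) θ j G w + foldRes σ n j G w ^ 2 / 2 := by
  have hk2 : (2:ℝ) ≤ k := by exact_mod_cast hk
  have h1 := sum_foldObj hk σ n L θ G u
  have h2 := sum_foldObj hk σ n L θ G w
  have h3 : ((k : ℝ) - 1) * fullObj σ n L θ G u ≤ ((k : ℝ) - 1) * fullObj σ n L θ G w :=
    mul_le_mul_of_nonneg_left h (by linarith)
  have h4 : ∑ i, foldObj σ n (L * (((k : ℝ) - 1) / k)) θ i G u ≤
      ∑ _i : Fin k, (foldObj σ n (L * (((k : ℝ) - 1) / k)) θ j G w + foldRes σ n j G w ^ 2 / 2) := by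
    rw [h1]
    refine h3.trans ?_
    rw [← h2]
    refine Finset.sum_le_sum fun i _ => ?_
    rw [← fullObj_eq _ _ _ _ j, fullObj_eq _ _ _ _ i]
    have := sq_nonneg (foldRes σ n i G w)
    linarith
  obtain ⟨i, -, hi⟩ := Finset.exists_le_of_sum_le ⟨j, Finset.mem_univ j⟩ h4
  exact ⟨i, hi⟩

theorem tau_zero {N : ℕ} {σ n : ℝ} (hσ : 0 < σ) : tau σ n (fun _ : Fin N => 0) = σ := by
  unfold tau; simp [Real.sqrt_sq hσ.le]

theorem exists_scale_tau {N : ℕ} {σ n τ1 : ℝ} (hσ : 0 < σ) (hτ1 : σ ≤ τ1) {w : Fin N → ℝ}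
    (hw : τ1 ≤ tau σ n w) :
    ∃ s : ℝ, 0 ≤ s ∧ s ≤ 1 ∧ tau σ n (fun j => 0 + s * (w j - 0)) = τ1 := by
  have hc : Continuous fun s : ℝ => tau σ n (fun j => 0 + s * (w j - 0)) :=
    (continuous_tau σ n).comp (by fun_prop)
  have h := intermediate_value_Icc (zero_le_one' ℝ) hc.continuousOn
  have h0 : tau σ n (fun j => 0 + (0:ℝ) * (w j - 0)) = σ := by
    simpa using tau_zero (N := N) (n := n) hσ
  have h1 : tau σ n (fun j => 0 + (1:ℝ) * (w j - 0)) = tau σ n w := by simp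
  rw [h0, h1] at h
  obtain ⟨s, hs, he⟩ := h ⟨hτ1, hw⟩
  exact ⟨s, hs.1, hs.2, he⟩

theorem fullObj_zero_le {k m N : ℕ} {σ n L : ℝ} {θ : Fin N → ℝ}
    {G : (Fin k × Fin m) × Option (Fin N) → ℝ} (hz : ∑ r : Fin k × Fin m, G (r, none) ^ 2 ≤ 2 * n) :
    fullObj σ n L θ G (fun _ => 0) ≤ n * σ ^ 2 := by
  unfold fullObj trainObj
  rw [nrm_sq]
  have h1 : ∀ r : Fin k × Fin m, resid σ n G (fun _ => 0) r ^ 2 = σ ^ 2 * G (r, none) ^ 2 := by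
    intro r; unfold resid; simp; ring
  have h2 : pen θ (fun _ => 0) = 0 := by unfold pen; simp
  simp only [h1]
  rw [← Finset.mul_sum, h2]
  nlinarith [mul_le_mul_of_nonneg_left hz (sq_nonneg σ)]

theorem foldObj_le_fullObj {k m N : ℕ} (σ n L : ℝ) (θ : Fin N → ℝ) (i : Fin k)
    (G : (Fin k × Fin m) × Option (Fin N) → ℝ) (w : Fin N → ℝ) :
    foldObj σ n L θ i G w ≤ fullObj σ n L θ G w := by
  rw [fullObj_eq _ _ _ _ i]
  have := sq_nonneg (foldRes σ n i G w)
  linarith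

theorem FoldGood.obj_ge {k m N : ℕ} {σ δ n L α τ1 C1 K s κ κ1 Lmin Lmax : ℝ} {J : ℕ}
    {θ : Fin N → ℝ} {i : Fin k} {b r : ℝ} {G : (Fin k × Fin m) × Option (Fin N) → ℝ}
    (h : FoldGood σ n L α τ1 C1 J θ i b r G) (hN : 0 < N) (hk : 2 ≤ k) (hδ : 0 < δ)
    (hn : n = δ * N) (hα : 0 < α) (hK : 0 ≤ K) (hκ : 0 < κ) (hL0 : 0 < Lmin) (hL : Lmin ≤ L)
    (hL1 : L ≤ Lmax) (hτ1 : 0 < τ1)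
    (hθ : BelowThreshold δ (((k : ℝ) - 1) / k) K s α κ θ)
    (hκ1 : κ1 = Lmin / α * (κ / (2 * δ)))
    (hbig : σ ^ 2 + 2 + ((Lmax / α) ^ 2 / 2 + 2 * Lmax * K / δ) ≤ κ1 * τ1 / 2)
    {w : Fin N → ℝ} (hw : tau σ n w = τ1) :
    n * (σ ^ 2 + κ1 * τ1 / 2 + 1) ≤ foldObj σ n L θ i G w := by
  have hN' : (0:ℝ) < N := by exact_mod_cast hN
  have hn0 : 0 < n := by rw [hn]; positivity
  have hk2 : (2:ℝ) ≤ k := by exact_mod_cast hk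
  have hk0 : (0:ℝ) < k := by linarith
  have hν := half_le_fold hk
  have hν1 : ((k : ℝ) - 1) / k ≤ 1 := by rw [div_le_one hk0]; linarith
  have hsν1 : √(((k : ℝ) - 1) / k) ≤ 1 := Real.sqrt_le_one.2 hν1
  have hsν0 : 0 < √(((k : ℝ) - 1) / k) := Real.sqrt_pos.2 (by linarith)
  have hLp : 0 < L := hL0.trans_le hL
  have hrr : τ1 ≤ τ1 / √(((k : ℝ) - 1) / k) := by
    rw [le_div_iff₀ hsν0]; nlinarith
  have h1 := Phi_coercive (σ := σ) hN hδ hn hLp hα (hτ1.trans_le hrr) hK hθ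
  have h2 := h.coercive w hw.le
  have e1 : τ1 / √(((k : ℝ) - 1) / k) * √(((k : ℝ) - 1) / k) = τ1 := div_mul_cancel₀ _ hsν0.ne'
  rw [e1, hw] at h2
  simp only [mul_zero, zero_mul, sub_self, ne_eq, OfNat.ofNat_ne_zero, not_false_eq_true, zero_pow,
    add_zero, sub_zero] at h2
  refine le_trans (mul_le_mul_of_nonneg_left ?_ hn0.le) h2
  have a1 : κ1 * τ1 ≤ L / α * (κ / (2 * δ)) * (τ1 / √(((k : ℝ) - 1) / k)) := by
    rw [hκ1]
    refine mul_le_mul (mul_le_mul_of_nonneg_right (div_le_div_of_nonneg_right hL hα.le)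
      (by positivity)) hrr hτ1.le (by positivity)
  have a2 : (L / α) ^ 2 ≤ (Lmax / α) ^ 2 :=
    pow_le_pow_left₀ (by positivity) (div_le_div_of_nonneg_right hL1 hα.le) 2
  have a3 : 2 * L * K / δ ≤ 2 * Lmax * K / δ := by gcongr
  linarith

theorem FoldGood.tau_near {k m N : ℕ} {σ n L α τ1 C1 b0 R η : ℝ} {J : ℕ}
    {θ : Fin N → ℝ} {i : Fin k} {b r : ℝ} {G : (Fin k × Fin m) × Option (Fin N) → ℝ}
    (h : FoldGood σ n L α τ1 C1 J θ i b r G) (hk : 2 ≤ k) (hσ : 0 < σ) (hn : 0 < n) (hL : 0 ≤ L)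
    (hs : IsSaddle σ (((k : ℝ) - 1) / k) L n θ b r) (hb0 : 0 < b0) (hb : b0 ≤ b) (hr : σ ≤ r)
    (hrR : r ≤ R) (hJ : 2 * τ1 ≤ J) (hC1 : 0 ≤ C1) (hη : 0 ≤ η)
    {w : Fin N → ℝ} (hw : tau σ n w ≤ τ1)
    (hA : foldObj σ n L θ i G w ≤ n * (Phi σ (((k : ℝ) - 1) / k) L n θ b r + η)) :
    (tau σ n w - r * √(((k : ℝ) - 1) / k)) ^ 2 ≤
      (2 + 2 * (C1 + 1) / (b0 * σ ^ 2 / (2 * (σ + J) * R ^ 2))) * (η + 1 / (k : ℝ) ^ 2) := by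
  have hk2 : (2:ℝ) ≤ k := by exact_mod_cast hk
  have hk0 : (0:ℝ) < k := by linarith
  have hν := half_le_fold hk
  have hν1 : ((k : ℝ) - 1) / k ≤ 1 := by rw [div_le_one hk0]; linarith
  set s := √(((k : ℝ) - 1) / k) with hsdef
  have hs1 : s ≤ 1 := Real.sqrt_le_one.2 hν1
  have hsh : 1 / 2 ≤ s := Real.le_sqrt_of_sq_le (by linarith)
  have hs0 : 0 < s := by linarith
  have hτσ := le_tau (σ := σ) hn w
  set t := tau σ n w with ht
  set x := t / s with hx
  have hxs : x * s = t := div_mul_cancel₀ _ hs0.ne'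
  have ht0 : 0 < t := hσ.trans_le hτσ
  have hxt : t ≤ x := by rw [hx, le_div_iff₀ hs0]; nlinarith
  have hx2 : x ≤ 2 * t := by rw [hx, div_le_iff₀ hs0]; nlinarith
  have hx0 : 0 ≤ (x - σ) * k := mul_nonneg (by linarith) hk0.le
  set g := ⌊(x - σ) * k⌋₊ with hg
  have hg1 : (g : ℝ) ≤ (x - σ) * k := Nat.floor_le hx0
  have hg2 : (x - σ) * k < g + 1 := Nat.lt_floor_add_one _
  have hgJ : g ∈ Finset.range (J * k + 1) := by
    rw [Finset.mem_range, Nat.lt_succ_iff]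
    have : (g : ℝ) ≤ ((J * k : ℕ) : ℝ) := by
      push_cast
      refine hg1.trans (mul_le_mul_of_nonneg_right ?_ hk0.le)
      linarith
    exact_mod_cast this
  have hlow := h.grid g hgJ w hw
  rw [← ht, ← hsdef] at hlow
  simp only [mul_zero, zero_mul, ne_eq, OfNat.ofNat_ne_zero, not_false_eq_true, zero_pow,
    add_zero, sub_zero] at hlow
  set rg := σ + (g : ℝ) / k with hrg
  have hgk : (g : ℝ) / k ≤ J := by
    rw [div_le_iff₀ hk0]
    exact_mod_cast Nat.lt_succ_iff.1 (Finset.mem_range.1 hgJ)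
  have hgk0 : 0 ≤ (g : ℝ) / k := by positivity
  have hrg0 : 0 < rg := by rw [hrg]; linarith
  have hrgJ : rg ≤ σ + J := by rw [hrg]; linarith
  have hd1 : 0 ≤ x - rg := by
    have : (g : ℝ) / k ≤ x - σ := by rw [div_le_iff₀ hk0]; exact hg1
    rw [hrg]; linarith
  have hd2 : x - rg ≤ 1 / k := by
    have : x - σ ≤ (g + 1) / k := by rw [le_div_iff₀ hk0]; exact hg2.le
    rw [add_div] at this
    rw [hrg]; linarith
  have hd : (x - rg) ^ 2 ≤ 1 / (k : ℝ) ^ 2 := by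
    have := pow_le_pow_left₀ hd1 hd2 2
    rwa [div_pow, one_pow] at this
  have hsq1 : s ^ 2 ≤ 1 := pow_le_one₀ hs0.le hs1
  have hdt : (t - rg * s) ^ 2 ≤ 1 / (k : ℝ) ^ 2 := by
    have : (t - rg * s) ^ 2 = s ^ 2 * (x - rg) ^ 2 := by rw [← hxs]; ring
    rw [this]
    have := mul_le_mul_of_nonneg_right hsq1 (sq_nonneg (x - rg))
    linarith
  have hrpos : 0 < r := hσ.trans_le hr
  have hR : 0 < R := hrpos.trans_le hrR
  have hgrow := hs.growth hn hL (hb0.trans_le hb) hrpos hrg0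
  set c2 := b0 * σ ^ 2 / (2 * (σ + J) * R ^ 2) with hc2
  have hJ0 : (0:ℝ) ≤ J := Nat.cast_nonneg J
  have hσJ : 0 < σ + J := by linarith
  have hbp : 0 < b := hb0.trans_le hb
  have hc2p : 0 < c2 := by rw [hc2]; positivity
  have hc2le : c2 * (rg - r) ^ 2 ≤ b * σ ^ 2 * (rg - r) ^ 2 / (2 * rg * r ^ 2) := by
    rw [hc2, div_mul_eq_mul_div]
    refine div_le_div₀ (by positivity) ?_ (by positivity) ?_
    · gcongr
    · gcongr
  have hk2p : 0 < 1 / (k : ℝ) ^ 2 := by positivity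
  have hmain : c2 * (rg - r) ^ 2 ≤ (C1 + 1) * (η + 1 / (k : ℝ) ^ 2) := by
    have h1 := le_of_mul_le_mul_left (hlow.trans hA) hn
    have h2 : C1 * (t - rg * s) ^ 2 ≤ C1 * (1 / (k : ℝ) ^ 2) := mul_le_mul_of_nonneg_left hdt hC1
    have h3 : 0 ≤ C1 * η := mul_nonneg hC1 hη
    linarith
  have hD : (rg - r) ^ 2 ≤ (C1 + 1) / c2 * (η + 1 / (k : ℝ) ^ 2) := by
    rw [div_mul_eq_mul_div, le_div_iff₀ hc2p]; linarith
  have hfin : (t - r * s) ^ 2 ≤ 2 * (x - rg) ^ 2 + 2 * (rg - r) ^ 2 := by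
    have e : (t - r * s) ^ 2 = s ^ 2 * ((x - rg) + (rg - r)) ^ 2 := by rw [← hxs]; ring
    have h1 : ((x - rg) + (rg - r)) ^ 2 + ((x - rg) - (rg - r)) ^ 2
        = 2 * (x - rg) ^ 2 + 2 * (rg - r) ^ 2 := by ring
    have h2 := mul_le_mul_of_nonneg_right hsq1 (sq_nonneg ((x - rg) + (rg - r)))
    have h3 := sq_nonneg ((x - rg) - (rg - r))
    rw [e]
    linarith only [h1, h2, h3]
  have e2 : (2 + 2 * (C1 + 1) / c2) * (η + 1 / (k : ℝ) ^ 2)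
      = 2 * η + 2 * (1 / (k : ℝ) ^ 2) + 2 * ((C1 + 1) / c2 * (η + 1 / (k : ℝ) ^ 2)) := by ring
  rw [e2]
  linarith only [hfin, hd, hD, hη]

theorem FoldGood.foldRes_near {k m N : ℕ} {σ n L α τ1 C1 C2 η : ℝ} {J : ℕ}
    {θ : Fin N → ℝ} {i : Fin k} {b r : ℝ} {G : (Fin k × Fin m) × Option (Fin N) → ℝ}
    (h : FoldGood σ n L α τ1 C1 J θ i b r G) (hk : 2 ≤ k) (hn : 0 < n) (hC1 : 0 ≤ C1) (hη : 0 ≤ η)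
    {w : Fin N → ℝ} (hw : tau σ n w ≤ τ1)
    (hA : foldObj σ n L θ i G w ≤ n * (Phi σ (((k : ℝ) - 1) / k) L n θ b r + η))
    (hnear : (tau σ n w - r * √(((k : ℝ) - 1) / k)) ^ 2 ≤ C2 * (η + 1 / (k : ℝ) ^ 2)) :
    |foldRes σ n i G w / √n - tau σ n w / √(k : ℝ)| ≤
      k * ((C1 * C2 + C1 + 1) * (η + 1 / (k : ℝ) ^ 2)) := by
  have hk2 : (2:ℝ) ≤ k := by exact_mod_cast hk
  have hk0 : (0:ℝ) < k := by linarith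
  have hp := h.plus w hw
  have hm := h.minus w hw
  set D := tau σ n w - r * √(((k : ℝ) - 1) / k) with hD
  set t := tau σ n w with ht
  set F := foldRes σ n i G w with hF
  set V := Phi σ (((k : ℝ) - 1) / k) L n θ b r with hV
  have hsn : √n * √n = n := Real.mul_self_sqrt hn.le
  have hsn0 : 0 < √n := Real.sqrt_pos.2 hn
  have hFn : √n * F = n * (F / √n) := by
    nth_rw 2 [← hsn]; field_simp
  have hC : C1 * D ^ 2 ≤ C1 * (C2 * (η + 1 / (k : ℝ) ^ 2)) := mul_le_mul_of_nonneg_left hnear hC1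
  have hC1η : 0 ≤ C1 * η := mul_nonneg hC1 hη
  have hp1 : V - C1 * D ^ 2 + (1 / k) * (t / √(k:ℝ)) - C1 * (1 / (k:ℝ) ^ 2) - 1 / (k:ℝ) ^ 2
      ≤ V + η + (1 / k) * (F / √n) := by
    refine le_of_mul_le_mul_left ?_ hn
    have e1 : n * (V - C1 * D ^ 2 + (1 / k) * (t / √(k:ℝ)) - C1 * (1 / (k:ℝ) ^ 2) - 1 / (k:ℝ) ^ 2)
      = n * (V - C1 * D ^ 2 + 1 * (1 / k) * (1 / √(k : ℝ)) * t - C1 * (1 / (k:ℝ)) ^ 2 - 1 / (k:ℝ) ^ 2) := by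
      ring
    have e2 : 1 * (1 / (k:ℝ)) * √n * F = n * ((1 / k) * (F / √n)) := by
      have : 1 * (1 / (k:ℝ)) * √n * F = (1 / (k:ℝ)) * (√n * F) := by ring
      rw [this, hFn]; ring
    rw [e2] at hp
    rw [e1]; linarith
  have hm1 : V - C1 * D ^ 2 - (1 / k) * (t / √(k:ℝ)) - C1 * (1 / (k:ℝ) ^ 2) - 1 / (k:ℝ) ^ 2
      ≤ V + η - (1 / k) * (F / √n) := by
    refine le_of_mul_le_mul_left ?_ hn
    have e1 : n * (V - C1 * D ^ 2 - (1 / k) * (t / √(k:ℝ)) - C1 * (1 / (k:ℝ) ^ 2) - 1 / (k:ℝ) ^ 2)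
      = n * (V - C1 * D ^ 2 + (-1) * (1 / k) * (1 / √(k : ℝ)) * t - C1 * (1 / (k:ℝ)) ^ 2 - 1 / (k:ℝ) ^ 2) := by
      ring
    have e2 : (-1) * (1 / (k:ℝ)) * √n * F = - (n * ((1 / k) * (F / √n))) := by
      have : (-1) * (1 / (k:ℝ)) * √n * F = -((1 / (k:ℝ)) * (√n * F)) := by ring
      rw [this, hFn]; ring
    rw [e2] at hm
    rw [e1]; linarith
  set E := (C1 * C2 + C1 + 1) * (η + 1 / (k : ℝ) ^ 2) with hE
  have hE' : η + C1 * (C2 * (η + 1 / (k : ℝ) ^ 2)) + C1 * (1 / (k:ℝ) ^ 2) + 1 / (k:ℝ) ^ 2 ≤ E := by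
    rw [hE]; linarith
  have k1 : ∀ x : ℝ, (1 / (k:ℝ)) * x ≤ E → x ≤ k * E := by
    intro x hx
    have : x = k * ((1 / (k:ℝ)) * x) := by field_simp
    rw [this]
    exact mul_le_mul_of_nonneg_left hx hk0.le
  rw [abs_le]
  constructor
  · have := k1 (t / √(k:ℝ) - F / √n) (by rw [mul_sub]; linarith)
    linarith
  · refine k1 _ (by rw [mul_sub]; linarith)

theorem FoldGood.lt_foldObj {k m N : ℕ} {σ δ n L L' α τ1 C1 K s κ κ1 Lmin Lmax h : ℝ} {J : ℕ}
    {θ : Fin N → ℝ} {i : Fin k} {b r : ℝ} {G : (Fin k × Fin m) × Option (Fin N) → ℝ}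
    (hg : FoldGood σ n L α τ1 C1 J θ i b r G) (hN : 0 < N) (hk : 2 ≤ k) (hδ : 0 < δ)
    (hn : n = δ * N) (hα : 0 < α) (hK : 0 ≤ K) (hκ : 0 < κ) (hL0 : 0 < Lmin) (hL : Lmin ≤ L)
    (hL1 : L ≤ Lmax) (hτ1 : 0 < τ1)
    (hθ : BelowThreshold δ (((k : ℝ) - 1) / k) K s α κ θ)
    (hκ1 : κ1 = Lmin / α * (κ / (2 * δ)))
    (hbig : σ ^ 2 + 2 + ((Lmax / α) ^ 2 / 2 + 2 * Lmax * K / δ) ≤ κ1 * τ1 / 2)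
    (hh : h / √δ ≤ κ1 / 2) (hLL : |L - L'| ≤ h)
    {w : Fin N → ℝ} (hw : tau σ n w = τ1) :
    n * σ ^ 2 < foldObj σ n L' θ i G w := by
  have hN' : (0:ℝ) < N := by exact_mod_cast hN
  have hn0 : 0 < n := by rw [hn]; positivity
  have h1 := hg.obj_ge hN hk hδ hn hα hK hκ hL0 hL hL1 hτ1 hθ hκ1 hbig hw
  have h2 := foldObj_change_le hδ hN hn hLL θ i G hw.le
  have h3 : h * τ1 / √δ ≤ κ1 * τ1 / 2 := by
    have := mul_le_mul_of_nonneg_right hh hτ1.le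
    calc h * τ1 / √δ = h / √δ * τ1 := by ring
      _ ≤ κ1 / 2 * τ1 := this
      _ = _ := by ring
  have h4 := mul_le_mul_of_nonneg_left h3 hn0.le
  linarith only [h1, h2, h4, hn0]

/-- A point of small objective on a segment from the origin stays in the radius `τ1`. -/
theorem tau_le_of_trainObj_le {R S : Type*} [Fintype S] {N : ℕ} {σ n L τ1 : ℝ} (hσ : 0 < σ)
    (hστ : σ ≤ τ1) (hL : 0 ≤ L) {θ : Fin N → ℝ} {f : S → R} {G : R × Option (Fin N) → ℝ}
    {u : Fin N → ℝ} (hu : trainObj σ n L θ f G u ≤ trainObj σ n L θ f G (fun _ => 0))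
    (hlow : ∀ w, tau σ n w = τ1 →
      trainObj σ n L θ f G (fun _ => 0) < trainObj σ n L θ f G w) :
    tau σ n u ≤ τ1 := by
  by_contra hc
  obtain ⟨s, hs0, hs1, hs⟩ := exists_scale_tau hσ hστ (not_le.1 hc).le
  have h1 := hlow _ hs
  have h2 := trainObj_convex hL θ f G (fun _ => 0) u hs0 hs1 (σ := σ) (n := n)
  have h3 := mul_le_mul_of_nonneg_left hu hs0
  linarith only [h1, h2, h3]

theorem FoldGood.foldObj_le {k m N : ℕ} {σ δ n L L' α τ1 C1 h κ1 : ℝ} {J : ℕ}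
    {θ : Fin N → ℝ} {i : Fin k} {b r : ℝ} {G : (Fin k × Fin m) × Option (Fin N) → ℝ}
    (hg : FoldGood σ n L α τ1 C1 J θ i b r G) (hN : 0 < N) (hδ : 0 < δ)
    (hn : n = δ * N) (hτ1 : 0 < τ1)
    (hh : h / √δ ≤ κ1 / 2) (hLL : |L - L'| ≤ h / (k : ℝ) ^ 2) {u v : Fin N → ℝ}
    (hu : ∀ w, foldObj σ n L' θ i G u ≤ foldObj σ n L' θ i G w)
    (hv : ∀ w, foldObj σ n L θ i G v ≤ foldObj σ n L θ i G w)
    (hτu : tau σ n u ≤ τ1) (hτv : tau σ n v ≤ τ1) :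
    foldObj σ n L θ i G u ≤
      n * (Phi σ (((k : ℝ) - 1) / k) L n θ b r + (1 + κ1 * τ1) * (1 / (k : ℝ) ^ 2)) := by
  have hN' : (0:ℝ) < N := by exact_mod_cast hN
  have hn0 : 0 < n := by rw [hn]; positivity
  have h1 := foldObj_change_le hδ hN hn hLL θ i G hτu
  have hLL' : |L' - L| ≤ h / (k : ℝ) ^ 2 := by rwa [abs_sub_comm]
  have h2 := foldObj_change_le hδ hN hn hLL' θ i G hτv
  have h3 := hg.upper v hv
  have h4 : h / (k : ℝ) ^ 2 * τ1 / √δ ≤ κ1 * τ1 / 2 * (1 / (k : ℝ) ^ 2) := by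
    have := mul_le_mul_of_nonneg_right hh (show 0 ≤ τ1 * (1 / (k : ℝ) ^ 2) by positivity)
    calc h / (k : ℝ) ^ 2 * τ1 / √δ = h / √δ * (τ1 * (1 / (k : ℝ) ^ 2)) := by ring
      _ ≤ κ1 / 2 * (τ1 * (1 / (k : ℝ) ^ 2)) := this
      _ = _ := by ring
  have h5 := mul_le_mul_of_nonneg_left h4 hn0.le
  have h6 := hu v
  linarith only [h1, h2, h3, h5, h6]

/-- Elementary combination of the error bounds for one fold. -/
theorem abs_sq_sub_sq_div_le {k f t τw ρ τ1 A B D : ℝ} (hk : 1 ≤ k) (hA : 0 ≤ A) (hB : 0 ≤ B)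
    (hD : 0 ≤ D) (hf : 0 ≤ f) (ht1 : t ≤ τ1) (hτw0 : 0 ≤ τw)
    (hτw1 : τw ≤ τ1) (h1 : |f - t / √k| ≤ A / k) (h2 : (t - ρ) ^ 2 ≤ B / k)
    (h3 : (τw - ρ) ^ 2 ≤ D / k) :
    |f ^ 2 - τw ^ 2 / k| ≤ (A + √B + √D) * (A + 2 * τ1) / √k * (1 / k) := by
  have hk0 : 0 < k := by linarith
  have hs : √k * √k = k := Real.mul_self_sqrt hk0.le
  have hs1 : 1 ≤ √k := Real.one_le_sqrt.2 hk
  have hs0 : 0 < √k := by linarith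
  have k2 : |t - ρ| ≤ √B / √k := by
    rw [← Real.sqrt_div hB]; exact Real.abs_le_sqrt h2
  have k3 : |τw - ρ| ≤ √D / √k := by
    rw [← Real.sqrt_div hD]; exact Real.abs_le_sqrt h3
  have key : ∀ x, x / √k / √k = x / k := fun x => by rw [div_div, hs]
  have k4 : |f - τw / √k| ≤ (A + √B + √D) / k := by
    have e : f - τw / √k = (f - t / √k) + ((t - ρ) / √k - (τw - ρ) / √k) := by ring
    rw [e]
    refine (abs_add_le _ _).trans ?_
    have a1 := abs_sub ((t - ρ) / √k) ((τw - ρ) / √k)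
    rw [abs_div, abs_div, abs_of_pos hs0] at a1
    have a2 : |t - ρ| / √k ≤ √B / k := by
      rw [← key]; exact div_le_div_of_nonneg_right k2 hs0.le
    have a3 : |τw - ρ| / √k ≤ √D / k := by
      rw [← key]; exact div_le_div_of_nonneg_right k3 hs0.le
    have a4 : (A + √B + √D) / k = A / k + √B / k + √D / k := by ring
    rw [a4]; linarith only [h1, a1, a2, a3]
  have k5 : A / k ≤ A / √k := by
    refine div_le_div_of_nonneg_left hA hs0 ?_
    calc √k = √k * 1 := (mul_one _).symm
      _ ≤ √k * √k := mul_le_mul_of_nonneg_left hs1 hs0.le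
      _ = k := hs
  have k6 : f + τw / √k ≤ (A + 2 * τ1) / √k := by
    have a1 := (abs_le.1 h1).2
    have a2 : t / √k ≤ τ1 / √k := div_le_div_of_nonneg_right ht1 hs0.le
    have a3 : τw / √k ≤ τ1 / √k := div_le_div_of_nonneg_right hτw1 hs0.le
    have a4 : (A + 2 * τ1) / √k = A / √k + 2 * (τ1 / √k) := by ring
    rw [a4]; linarith only [a1, a2, a3, k5]
  have k7 : 0 ≤ f + τw / √k := by positivity
  have e : f ^ 2 - τw ^ 2 / k = (f - τw / √k) * (f + τw / √k) := by
    rw [← key]; ring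
  rw [e, abs_mul, abs_of_nonneg k7]
  refine (mul_le_mul k4 k6 k7 (by positivity)).trans (le_of_eq (by ring))

theorem foldRes_nonneg {k m N : ℕ} (σ n : ℝ) (i : Fin k)
    (G : (Fin k × Fin m) × Option (Fin N) → ℝ) (w : Fin N → ℝ) : 0 ≤ foldRes σ n i G w :=
  nrm_nonneg _

set_option maxHeartbeats 1000000 in
/-- On the good event the cross-validation error is close to the squared effective noise level of
the full estimator, with an explicit rate in the number of folds. -/
theorem cv_error_le {σ δ α τ1 C1 K s κ κ1 Lmin Lmax h b0 R : ℝ} {J : ℕ} (hδ : 0 < δ) (hσ : 0 < σ)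
    (hα : 0 < α) (hK : 0 ≤ K) (hκ : 0 < κ) (hL0 : 0 < Lmin) (hτ1 : σ ≤ τ1)
    (hκ1 : κ1 = Lmin / α * (κ / (2 * δ)))
    (hbig : σ ^ 2 + 2 + ((Lmax / α) ^ 2 / 2 + 2 * Lmax * K / δ) ≤ κ1 * τ1 / 2)
    (hh : h / √δ ≤ κ1 / 2) (hh0 : 0 ≤ h) (hb0 : 0 < b0) (hR : σ ≤ R) (hJ : 2 * τ1 ≤ J)
    (hC1 : 0 < C1) :
    ∃ C : ℝ, 0 < C ∧ ∀ (k m N : ℕ) (n lam L b r : ℝ) (θ : Fin N → ℝ)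
      (G : (Fin k × Fin m) × Option (Fin N) → ℝ),
      0 < N → 2 ≤ k → n = δ * N → 0 ≤ lam → Lmin ≤ L → L ≤ Lmax → b0 ≤ b → σ ≤ r → r ≤ R →
      IsSaddle σ (((k : ℝ) - 1) / k) L n θ b r →
      BelowThreshold δ (((k : ℝ) - 1) / k) K s α κ θ →
      |L - lam * (((k : ℝ) - 1) / k)| ≤ h / (k : ℝ) ^ 2 →
      (∀ i, FoldGood σ n L α τ1 C1 J θ i b r G) →
      ∑ r : Fin k × Fin m, G (r, none) ^ 2 ≤ 2 * n →
      (∀ i, ∃ v, ∀ w, foldObj σ n L θ i G v ≤ foldObj σ n L θ i G w) →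
      ∀ (u : Fin k → Fin N → ℝ) (w : Fin N → ℝ),
      (∀ i v, foldObj σ n (lam * (((k : ℝ) - 1) / k)) θ i G (u i)
        ≤ foldObj σ n (lam * (((k : ℝ) - 1) / k)) θ i G v) →
      (∀ v, fullObj σ n lam θ G w ≤ fullObj σ n lam θ G v) →
      |∑ i, foldRes σ n i G (u i) ^ 2 / n - tau σ n w ^ 2| ≤ C / √(k : ℝ) := by
  have hτ0 : 0 < τ1 := hσ.trans_le hτ1
  have hR0 : 0 < R := hσ.trans_le hR
  have hJ0 : (0:ℝ) ≤ J := Nat.cast_nonneg J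
  have hσJ : 0 < σ + J := by linarith
  have hκ10 : 0 < κ1 := by rw [hκ1]; positivity
  set C2 := 2 + 2 * (C1 + 1) / (b0 * σ ^ 2 / (2 * (σ + J) * R ^ 2)) with hC2
  have hC20 : 0 < C2 := by rw [hC2]; positivity
  set Cη := 1 + κ1 * τ1 with hCη
  have hCη0 : 0 < Cη := by rw [hCη]; positivity
  set C3 := (C1 * C2 + C1 + 1) * (Cη + 1) with hC3
  have hC30 : 0 < C3 := by rw [hC3]; positivity
  set C5 := (C3 + τ1) ^ 2 with hC5
  have hC50 : 0 < C5 := by rw [hC5]; positivity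
  set C6 := Cη + κ1 * τ1 + C5 with hC6
  have hC60 : 0 < C6 := by rw [hC6]; positivity
  refine ⟨(C3 + √(C2 * (Cη + 1)) + √(C2 * (C6 + 1))) * (C3 + 2 * τ1), by positivity, ?_⟩
  intro k m N n lam L b r θ G hN hk hn hlam hL hL1 hb hr hrR hsad hθ hLL hg hz hmin u w hu hw
  have hN' : (0:ℝ) < N := by exact_mod_cast hN
  have hn0 : 0 < n := by rw [hn]; positivity
  have hk2 : (2:ℝ) ≤ k := by exact_mod_cast hk
  have hk0 : (0:ℝ) < k := by linarith
  have hk1 : (1:ℝ) ≤ k := by linarith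
  have hLp : 0 ≤ L := hL0.le.trans hL
  have hνp : 0 ≤ ((k : ℝ) - 1) / k := le_trans (by norm_num) (half_le_fold hk)
  set L' := lam * (((k : ℝ) - 1) / k) with hL'
  have hL'0 : 0 ≤ L' := mul_nonneg hlam hνp
  have hsq : 1 / (k : ℝ) ^ 2 ≤ 1 / k := by
    refine one_div_le_one_div_of_le hk0 ?_
    calc (k:ℝ) = k * 1 := (mul_one _).symm
      _ ≤ k * k := mul_le_mul_of_nonneg_left hk1 hk0.le
      _ = _ := by ring
  have hsq1 : 1 / (k : ℝ) ^ 2 ≤ 1 := hsq.trans (by rw [div_le_one hk0]; exact hk1)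
  have hsqp : 0 < 1 / (k : ℝ) ^ 2 := by positivity
  have hLLh : |L - L'| ≤ h := by
    refine hLL.trans ?_
    have := mul_le_mul_of_nonneg_left hsq1 hh0
    calc h / (k:ℝ) ^ 2 = h * (1 / (k:ℝ) ^ 2) := by ring
      _ ≤ h := by linarith
  -- lower bounds on the sphere of radius `τ1`
  have hlow' : ∀ i v, tau σ n v = τ1 → n * σ ^ 2 < foldObj σ n L' θ i G v := fun i v hv =>
    (hg i).lt_foldObj hN hk hδ hn hα hK hκ hL0 hL hL1 hτ0 hθ hκ1 hbig hh hLLh hv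
  have hlow : ∀ i v, tau σ n v = τ1 → n * σ ^ 2 < foldObj σ n L θ i G v := fun i v hv =>
    (hg i).lt_foldObj hN hk hδ hn hα hK hκ hL0 hL hL1 hτ0 hθ hκ1 hbig hh (by simpa using hh0) hv
  have hzero : ∀ M i, foldObj σ n M θ i G (fun _ => 0) ≤ n * σ ^ 2 := fun M i =>
    (foldObj_le_fullObj _ _ _ _ _ _ _).trans (fullObj_zero_le hz)
  -- boundedness of the estimators
  have hτu : ∀ i, tau σ n (u i) ≤ τ1 := fun i =>
    tau_le_of_trainObj_le hσ hτ1 hL'0 (hu i _) fun v hv => (hzero L' i).trans_lt (hlow' i v hv)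
  have hi0 : Nonempty (Fin k) := ⟨⟨0, by omega⟩⟩
  obtain ⟨j⟩ := hi0
  have hτw : tau σ n w ≤ τ1 := by
    refine tau_le_of_trainObj_le hσ hτ1 hlam (hw _) fun v hv => ?_
    by_contra hc
    obtain ⟨i, hi⟩ := exists_foldObj_le hk (L := lam) (not_lt.1 hc) j
    rw [← fullObj_eq] at hi
    exact absurd (hlow' i v hv) (not_lt.2 (hi.trans (fullObj_zero_le hz)))
  -- near-optimality of the fold estimators
  have hAu : ∀ i, foldObj σ n L θ i G (u i) ≤
      n * (Phi σ (((k : ℝ) - 1) / k) L n θ b r + Cη * (1 / (k : ℝ) ^ 2)) := fun i => by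
    obtain ⟨v, hv⟩ := hmin i
    refine (hg i).foldObj_le hN hδ hn hτ0 hh hLL (hu i) hv (hτu i) ?_
    exact tau_le_of_trainObj_le hσ hτ1 hLp (hv _) fun v' hv' => (hzero L i).trans_lt (hlow i v' hv')
  have hη0 : 0 ≤ Cη * (1 / (k : ℝ) ^ 2) := by positivity
  have hnear : ∀ i, (tau σ n (u i) - r * √(((k : ℝ) - 1) / k)) ^ 2 ≤
      C2 * (Cη * (1 / (k : ℝ) ^ 2) + 1 / (k : ℝ) ^ 2) := fun i =>
    (hg i).tau_near hk hσ hn0 hLp hsad hb0 hb hr hrR hJ hC1.le hη0 (hτu i) (hAu i)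
  have hres : ∀ i, |foldRes σ n i G (u i) / √n - tau σ n (u i) / √(k : ℝ)| ≤ C3 / k := fun i => by
    refine ((hg i).foldRes_near hk hn0 hC1.le hη0 (hτu i) (hAu i) (hnear i)).trans (le_of_eq ?_)
    rw [hC3]; field_simp
  have hnear' : ∀ i, (tau σ n (u i) - r * √(((k : ℝ) - 1) / k)) ^ 2 ≤ C2 * (Cη + 1) / k :=
      fun i => by
    refine (hnear i).trans ?_
    have := mul_le_mul_of_nonneg_left hsq (show 0 ≤ C2 * (Cη + 1) by positivity)
    calc C2 * (Cη * (1 / (k : ℝ) ^ 2) + 1 / (k : ℝ) ^ 2)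
        = C2 * (Cη + 1) * (1 / (k : ℝ) ^ 2) := by ring
      _ ≤ C2 * (Cη + 1) * (1 / k) := this
      _ = _ := by ring
  have hs1 : 1 ≤ √(k:ℝ) := Real.one_le_sqrt.2 hk1
  have hs0 : 0 < √(k:ℝ) := by linarith
  have hss : √(k:ℝ) * √(k:ℝ) = k := Real.mul_self_sqrt hk0.le
  have hsn : √n ^ 2 = n := Real.sq_sqrt hn0.le
  have hsn0 : 0 < √n := Real.sqrt_pos.2 hn0
  have hf0 : ∀ i, 0 ≤ foldRes σ n i G (u i) / √n := fun i =>
    div_nonneg (foldRes_nonneg _ _ _ _ _) hsn0.le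
  have hFsq : foldRes σ n j G (u j) ^ 2 ≤ n * (C5 / k) := by
    have a1 := (abs_le.1 (hres j)).2
    have a2 : tau σ n (u j) / √(k:ℝ) ≤ τ1 / √(k:ℝ) :=
      div_le_div_of_nonneg_right (hτu j) hs0.le
    have a3 : C3 / k ≤ C3 / √(k:ℝ) := by
      refine div_le_div_of_nonneg_left hC30.le hs0 ?_
      calc √(k:ℝ) = √(k:ℝ) * 1 := (mul_one _).symm
        _ ≤ √(k:ℝ) * √(k:ℝ) := mul_le_mul_of_nonneg_left hs1 hs0.le
        _ = k := hss
    have a4 : foldRes σ n j G (u j) / √n ≤ (C3 + τ1) / √(k:ℝ) := by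
      rw [add_div]; linarith only [a1, a2, a3]
    have a5 := pow_le_pow_left₀ (hf0 j) a4 2
    rw [div_pow, div_pow, hsn, Real.sq_sqrt hk0.le, div_le_iff₀ hn0] at a5
    linarith only [a5]
  -- near-optimality of the full estimator
  obtain ⟨i, hi⟩ := exists_foldObj_le hk (L := lam) (hw (u j)) j
  have hAw : foldObj σ n L θ i G w ≤
      n * (Phi σ (((k : ℝ) - 1) / k) L n θ b r + C6 * (1 / k)) := by
    have h1 := foldObj_change_le hδ hN hn hLL θ i G hτw
    have hLL' : |L' - L| ≤ h / (k : ℝ) ^ 2 := by rwa [abs_sub_comm]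
    have h2 := foldObj_change_le hδ hN hn hLL' θ j G (hτu j)
    have h3 := hAu j
    have h4 : h / (k : ℝ) ^ 2 * τ1 / √δ ≤ κ1 * τ1 / 2 * (1 / k) := by
      have := mul_le_mul_of_nonneg_right hh (show 0 ≤ τ1 * (1 / (k : ℝ) ^ 2) by positivity)
      calc h / (k : ℝ) ^ 2 * τ1 / √δ = h / √δ * (τ1 * (1 / (k : ℝ) ^ 2)) := by ring
        _ ≤ κ1 / 2 * (τ1 * (1 / (k : ℝ) ^ 2)) := this
        _ = κ1 * τ1 / 2 * (1 / (k : ℝ) ^ 2) := by ring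
        _ ≤ _ := mul_le_mul_of_nonneg_left hsq (by positivity)
    have h5 := mul_le_mul_of_nonneg_left h4 hn0.le
    have h6 : n * (Cη * (1 / (k:ℝ) ^ 2)) ≤ n * (Cη * (1 / k)) :=
      mul_le_mul_of_nonneg_left (mul_le_mul_of_nonneg_left hsq hCη0.le) hn0.le
    have h7 : 0 ≤ n * (C5 / k) := by positivity
    have e : n * (Phi σ (((k : ℝ) - 1) / k) L n θ b r + C6 * (1 / k))
        = n * Phi σ (((k : ℝ) - 1) / k) L n θ b r + n * (Cη * (1 / k))
          + 2 * (n * (κ1 * τ1 / 2 * (1 / k))) + n * (C5 / k) := by rw [hC6]; ring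
    rw [e]
    linarith only [h1, h2, h3, h5, h6, h7, hFsq, hi]
  have hwnear : (tau σ n w - r * √(((k : ℝ) - 1) / k)) ^ 2 ≤ C2 * (C6 + 1) / k := by
    refine ((hg i).tau_near hk hσ hn0 hLp hsad hb0 hb hr hrR hJ hC1.le
      (show 0 ≤ C6 * (1 / (k:ℝ)) by positivity) hτw hAw).trans ?_
    rw [← hC2]
    have := mul_le_mul_of_nonneg_left hsq hC20.le
    have e : C2 * (C6 + 1) / k = C2 * (C6 * (1 / k)) + C2 * (1 / k) := by ring
    rw [e, mul_add]
    linarith only [this]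
  -- conclusion
  have hterm : ∀ i, |foldRes σ n i G (u i) ^ 2 / n - tau σ n w ^ 2 / k| ≤
      (C3 + √(C2 * (Cη + 1)) + √(C2 * (C6 + 1))) * (C3 + 2 * τ1) / √(k:ℝ) * (1 / k) := fun i => by
    have := abs_sq_sub_sq_div_le hk1 hC30.le (by positivity) (by positivity) (hf0 i) (hτu i)
      (tau_nonneg σ n w) hτw (hres i) (hnear' i) hwnear
    rwa [div_pow, hsn] at this
  have hsum : ∑ i, foldRes σ n i G (u i) ^ 2 / n - tau σ n w ^ 2
      = ∑ i, (foldRes σ n i G (u i) ^ 2 / n - tau σ n w ^ 2 / k) := by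
    rw [Finset.sum_sub_distrib, Finset.sum_const, Finset.card_univ, Fintype.card_fin, nsmul_eq_mul,
      mul_div_cancel₀ _ hk0.ne']
  rw [hsum]
  refine (Finset.abs_sum_le_sum_abs _ _).trans ((Finset.sum_le_sum fun i _ => hterm i).trans ?_)
  rw [Finset.sum_const, Finset.card_univ, Fintype.card_fin, nsmul_eq_mul]
  refine le_of_eq ?_
  field_simp

section Translation

variable {k m N : ℕ} {σ : ℝ} {θ : Fin N → ℝ}
  {ω : ((Fin k × Fin m) → Fin N → ℝ) × ((Fin k × Fin m) → ℝ)}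

theorem resid_modelArray (hn : (0:ℝ) < ((k * m : ℕ) : ℝ)) (t : Fin N → ℝ) (r : Fin k × Fin m) :
    resid σ ((k * m : ℕ) : ℝ) (modelArray k m N ω) (fun j => t j - θ j) r =
      -(yvecI σ θ ω.1 ω.2 r - ∑ j, ω.1 r j * t j) := by
  have hs : √((k * m : ℕ) : ℝ) ≠ 0 := (Real.sqrt_pos.2 hn).ne'
  have h1 : ∑ j, (t j - θ j) * modelArray k m N ω (r, some j)
      = √((k * m : ℕ) : ℝ) * (∑ j, ω.1 r j * t j - ∑ j, ω.1 r j * θ j) := by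
    rw [← Finset.sum_sub_distrib, Finset.mul_sum]
    refine Finset.sum_congr rfl fun j _ => ?_
    simp only [modelArray, Option.elim]
    ring
  unfold resid yvecI
  rw [h1, mul_div_cancel_left₀ _ hs]
  simp only [modelArray, Option.elim]
  ring

theorem foldRes_modelArray (hn : (0:ℝ) < ((k * m : ℕ) : ℝ)) (t : Fin N → ℝ) (i : Fin k) :
    foldRes σ ((k * m : ℕ) : ℝ) i (modelArray k m N ω) (fun j => t j - θ j) ^ 2 =
      ∑ l : Fin m, (yvecI σ θ ω.1 ω.2 (i, l) - ∑ j, ω.1 (i, l) j * t j) ^ 2 := by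
  unfold foldRes
  rw [nrm_sq]
  let e : {r : Fin k × Fin m // r.1 = i} ≃ Fin m :=
    { toFun := fun r => r.1.2
      invFun := fun l => ⟨(i, l), rfl⟩
      left_inv := by rintro ⟨⟨a, b⟩, h⟩; cases h; rfl
      right_inv := fun _ => rfl }
  refine Fintype.sum_equiv e _ _ ?_
  rintro ⟨⟨a, b⟩, h⟩
  cases h
  rw [resid_modelArray hn, neg_sq]
  rfl

theorem foldObj_modelArray (hk : 2 ≤ k) (hm : 0 < m) (lam : ℝ) (t : Fin N → ℝ) (i : Fin k) :
    foldObj σ ((k * m : ℕ) : ℝ) (lam * (((k : ℝ) - 1) / k)) θ i (modelArray k m N ω)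
      (fun j => t j - θ j) =
      (((k : ℝ) - 1) * m) * lassoCostFold i ω.1 (yvecI σ θ ω.1 ω.2) lam t
        - lam * (((k : ℝ) - 1) / k) * ∑ j, |θ j| := by
  have hk2 : (2:ℝ) ≤ k := by exact_mod_cast hk
  have hk0 : (0:ℝ) < k := by linarith
  have hm0 : (0:ℝ) < m := by exact_mod_cast hm
  have hk1 : (0:ℝ) < (k:ℝ) - 1 := by linarith
  have hn : (0:ℝ) < ((k * m : ℕ) : ℝ) := by push_cast; positivity
  have hc : ((((k - 1) * m : ℕ)) : ℝ) = ((k : ℝ) - 1) * m := by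
    rw [Nat.cast_mul, Nat.cast_sub (by omega)]; simp
  unfold foldObj trainObj lassoCostFold
  rw [nrm_sq, hc]
  have h1 : ∑ r : {r : Fin k × Fin m // r.1 ≠ i},
      resid σ ((k * m : ℕ) : ℝ) (modelArray k m N ω) (fun j => t j - θ j) r.1 ^ 2
      = ∑ r ∈ Finset.univ.filter (fun r : Fin k × Fin m => r.1 ≠ i),
        (yvecI σ θ ω.1 ω.2 r - ∑ j, ω.1 r j * t j) ^ 2 := by
    rw [Finset.sum_subtype (Finset.univ.filter (fun r : Fin k × Fin m => r.1 ≠ i))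
      (p := fun r => r.1 ≠ i) (by simp)]
    refine Finset.sum_congr rfl fun r _ => ?_
    rw [resid_modelArray hn, neg_sq]
  rw [h1]
  have h2 : pen θ (fun j => t j - θ j) = ∑ j, |t j| - ∑ j, |θ j| := by
    unfold pen
    rw [← Finset.sum_sub_distrib]
    refine Finset.sum_congr rfl fun j _ => ?_
    rw [add_sub_cancel]
  rw [h2]
  push_cast
  field_simp
  ring

theorem fullObj_modelArray (hn : (0:ℝ) < ((k * m : ℕ) : ℝ)) (lam : ℝ) (t : Fin N → ℝ) :
    fullObj σ ((k * m : ℕ) : ℝ) lam θ (modelArray k m N ω) (fun j => t j - θ j) =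
      ((k * m : ℕ) : ℝ) * lassoCostCV ω.1 (yvecI σ θ ω.1 ω.2) lam t - lam * ∑ j, |θ j| := by
  unfold fullObj trainObj lassoCostCV
  rw [nrm_sq]
  have h1 : ∀ r, resid σ ((k * m : ℕ) : ℝ) (modelArray k m N ω) (fun j => t j - θ j) r ^ 2
      = (yvecI σ θ ω.1 ω.2 r - ∑ j, ω.1 r j * t j) ^ 2 := fun r => by
    rw [resid_modelArray hn, neg_sq]
  simp only [h1]
  have h2 : pen θ (fun j => t j - θ j) = ∑ j, |t j| - ∑ j, |θ j| := by
    unfold pen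
    rw [← Finset.sum_sub_distrib]
    refine Finset.sum_congr rfl fun j _ => ?_
    rw [add_sub_cancel]
  rw [h2]
  generalize ((k * m : ℕ) : ℝ) = n at hn
  field_simp
  ring

theorem foldObj_le_of_isMinOn (hk : 2 ≤ k) (hm : 0 < m) {lam : ℝ} {t : Fin N → ℝ} {i : Fin k}
    (h : IsMinOn (lassoCostFold i ω.1 (yvecI σ θ ω.1 ω.2) lam) Set.univ t) (v : Fin N → ℝ) :
    foldObj σ ((k * m : ℕ) : ℝ) (lam * (((k : ℝ) - 1) / k)) θ i (modelArray k m N ω)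
      (fun j => t j - θ j) ≤
    foldObj σ ((k * m : ℕ) : ℝ) (lam * (((k : ℝ) - 1) / k)) θ i (modelArray k m N ω) v := by
  have hk2 : (2:ℝ) ≤ k := by exact_mod_cast hk
  have e : v = fun j => (v j + θ j) - θ j := by funext j; ring
  rw [e, foldObj_modelArray hk hm, foldObj_modelArray hk hm]
  have h1 := mul_le_mul_of_nonneg_left (h (Set.mem_univ fun j => v j + θ j))
    (show 0 ≤ ((k : ℝ) - 1) * m from mul_nonneg (by linarith) (Nat.cast_nonneg m))
  linarith

theorem fullObj_le_of_isMinOn (hn : (0:ℝ) < ((k * m : ℕ) : ℝ)) {lam : ℝ} {t : Fin N → ℝ}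
    (h : IsMinOn (lassoCostCV ω.1 (yvecI σ θ ω.1 ω.2) lam) Set.univ t) (v : Fin N → ℝ) :
    fullObj σ ((k * m : ℕ) : ℝ) lam θ (modelArray k m N ω) (fun j => t j - θ j) ≤
    fullObj σ ((k * m : ℕ) : ℝ) lam θ (modelArray k m N ω) v := by
  have e : v = fun j => (v j + θ j) - θ j := by funext j; ring
  rw [e, fullObj_modelArray hn, fullObj_modelArray hn]
  have h1 := mul_le_mul_of_nonneg_left (h (Set.mem_univ fun j => v j + θ j)) hn.le
  linarith

end Translation

theorem exists_grid_near {a b x : ℝ} {M : ℕ} (hM : 0 < M) (hx : x ∈ Set.Icc a b) :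
    ∃ l ≤ M, |a + (b - a) * l / M - x| ≤ (b - a) / M := by
  have hM0 : (0:ℝ) < M := by exact_mod_cast hM
  have hab : 0 ≤ b - a := by linarith [hx.1, hx.2]
  rcases hab.eq_or_lt with h | h
  · refine ⟨0, Nat.zero_le _, ?_⟩
    have : x = a := le_antisymm (by linarith [hx.2]) hx.1
    rw [← h, this]; simp
  · set y := (x - a) / (b - a) * M with hy
    have hy0 : 0 ≤ y := mul_nonneg (div_nonneg (by linarith [hx.1]) h.le) hM0.le
    have hyM : y ≤ M := by
      have : (x - a) / (b - a) ≤ 1 := by rw [div_le_one h]; linarith [hx.2]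
      have := mul_le_mul_of_nonneg_right this hM0.le
      linarith
    have h1 := Nat.floor_le hy0
    have h2 := Nat.lt_floor_add_one y
    refine ⟨⌊y⌋₊, by exact_mod_cast h1.trans hyM, ?_⟩
    have e : a + (b - a) * ⌊y⌋₊ / M - x = (b - a) / M * (⌊y⌋₊ - y) := by
      rw [hy]; field_simp; ring
    rw [e, abs_mul, abs_of_nonneg (by positivity)]
    have : |(⌊y⌋₊ : ℝ) - y| ≤ 1 := by rw [abs_le]; constructor <;> linarith
    have h3 := mul_le_mul_of_nonneg_left this (show 0 ≤ (b - a) / M by positivity)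
    linarith

theorem rate_le {C C' c δ k N q n : ℝ} (hC : 0 ≤ C) (hCC : C ≤ C') (hc : 0 ≤ c) (hδ : 0 ≤ δ)
    (hk : 1 ≤ k) (hN : 1 ≤ N) (hq : 0 ≤ q) (hn : n = δ * N) :
    C * k ^ 4 * Real.exp (-c * n / k ^ 4) ≤ C' * k ^ 6 * N ^ q * Real.exp (-(c * δ) * N / k ^ 6) := by
  have hk0 : 0 < k := by linarith
  have h46 : k ^ 4 ≤ k ^ 6 := pow_le_pow_right₀ hk (by norm_num)
  have h1 : C * k ^ 4 ≤ C' * k ^ 6 := mul_le_mul hCC h46 (by positivity) (hC.trans hCC)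
  have h2 : 1 ≤ N ^ q := Real.one_le_rpow hN hq
  have h3 : -c * n / k ^ 4 ≤ -(c * δ) * N / k ^ 6 := by
    have : c * δ * N / k ^ 6 ≤ c * δ * N / k ^ 4 :=
      div_le_div_of_nonneg_left (by positivity) (by positivity) h46
    have e1 : -c * n / k ^ 4 = -(c * δ * N / k ^ 4) := by rw [hn]; ring
    have e2 : -(c * δ) * N / k ^ 6 = -(c * δ * N / k ^ 6) := by ring
    rw [e1, e2]; linarith
  have h4 : C' * k ^ 6 ≤ C' * k ^ 6 * N ^ q := le_mul_of_one_le_right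
    (mul_nonneg (hC.trans hCC) (by positivity)) h2
  exact mul_le_mul (h1.trans h4) (Real.exp_le_exp.2 h3) (Real.exp_pos _).le
    (le_trans (mul_nonneg hC (by positivity)) (h1.trans h4))

/-- Proposition (k-fold cross-validation estimates the risk up to O(k^{-1/2})). -/
theorem stmt7 (δ σ lmin lmax q : ℝ)
    (hδ : 0 < δ) (hσ : 0 < σ) (hl : 0 < lmin) (hll : lmin ≤ lmax)
    (Dfam : (M : ℕ) → Set (Fin M → ℝ))
    (hD : DFamSpec δ Dfam q) :
    ∃ c C : ℝ, 0 < c ∧ 0 < C ∧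
      ∀ (N k m : ℕ), 0 < N → 2 ≤ k → 0 < m → ((k * m : ℕ) : ℝ) = δ * N →
      (∀ s : ℝ, (∀ M, Dfam M = F0ball M s) → s < smax (((k : ℝ) - 1) * δ / k)) →
      ∀ θstar ∈ Dfam N,
      ∀ θhat : ℝ → ((Fin k × Fin m) → Fin N → ℝ) → ((Fin k × Fin m) → ℝ) →
        (Fin N → ℝ),
      (∀ lam ∈ Set.Icc lmin lmax,
        ∀ (X : (Fin k × Fin m) → Fin N → ℝ) (z : (Fin k × Fin m) → ℝ),
        IsMinOn (lassoCostCV X (yvecI σ θstar X z) lam) Set.univ (θhat lam X z)) →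
      ∀ θhatCV : ℝ → Fin k → ((Fin k × Fin m) → Fin N → ℝ) →
        ((Fin k × Fin m) → ℝ) → (Fin N → ℝ),
      (∀ lam ∈ Set.Icc lmin lmax, ∀ (i : Fin k)
        (X : (Fin k × Fin m) → Fin N → ℝ) (z : (Fin k × Fin m) → ℝ),
        IsMinOn (lassoCostFold i X (yvecI σ θstar X z) lam) Set.univ
          (θhatCV lam i X z)) →
      PmodelCV k m N
        {ω | ∃ lam ∈ Set.Icc lmin lmax,
          C / Real.sqrt (k : ℝ) ≤
            |(1 / (N : ℝ)) * ∑ i : Fin k, ∑ l : Fin m,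
                (yvecI σ θstar ω.1 ω.2 (i, l)
                  - ∑ j, ω.1 (i, l) j * θhatCV lam i ω.1 ω.2 j) ^ 2
              - (1 / (N : ℝ)) * ∑ j, (θhat lam ω.1 ω.2 j - θstar j) ^ 2
              - δ * σ ^ 2|}
      ≤ ENNReal.ofReal (C * (k : ℝ) ^ 6 * (N : ℝ) ^ q
          * Real.exp (-c * N / (k : ℝ) ^ 6)) := by
  obtain ⟨hq0, K, s, α, κ, hK, hα, hκ, hbelow⟩ := hD.exists_belowThreshold hδ
  have hL0 : 0 < lmin / 2 := by linarith
  have hL01 : lmin / 2 ≤ lmax := by linarith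
  obtain ⟨R, b0, b1, hσR, hb0, hb01, hsaddle⟩ :=
    exists_isSaddle (s := s) hσ hδ hK hα hκ hL0 hL01
  set κ1 := lmin / 2 / α * (κ / (2 * δ)) with hκ1
  have hκ10 : 0 < κ1 := by rw [hκ1]; positivity
  set T0 := σ ^ 2 + 2 + ((lmax / α) ^ 2 / 2 + 2 * lmax * K / δ) with hT0
  set τ1 := max σ (2 * T0 / κ1) with hτ1
  have hστ : σ ≤ τ1 := le_max_left _ _
  have hbig : T0 ≤ κ1 * τ1 / 2 := by
    have h1 : 2 * T0 / κ1 ≤ τ1 := le_max_right _ _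
    rw [div_le_iff₀ hκ10] at h1
    linarith
  set J := ⌈2 * τ1⌉₊ with hJ
  have hJ1 : 2 * τ1 ≤ J := Nat.le_ceil _
  have hsδ : 0 < √δ := Real.sqrt_pos.2 hδ
  set A := ⌈(lmax - lmin) / (√δ * (κ1 / 2))⌉₊ + 1 with hA
  have hA1 : 0 < A := Nat.succ_pos _
  have hA0 : (0:ℝ) < A := by exact_mod_cast hA1
  set h := (lmax - lmin) / A with hh
  have hh0 : 0 ≤ h := div_nonneg (by linarith) hA0.le
  have hhκ : h / √δ ≤ κ1 / 2 := by
    have h1 : (lmax - lmin) / (√δ * (κ1 / 2)) ≤ A := by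
      rw [hA]; push_cast
      exact (Nat.le_ceil _).trans (by linarith)
    rw [div_le_iff₀ (by positivity)] at h1
    rw [hh, div_div, div_le_iff₀ (by positivity)]
    linarith
  obtain ⟨c, C1, C, hc, hC1, hC, hprob⟩ :=
    cvGood_prob (b1 := b1) J A hδ hσ hα hb0 hσR.le hL0 hL01 hστ
  obtain ⟨C', hC', hdet⟩ := cv_error_le (s := s) hδ hσ hα hK hκ hL0 hστ hκ1 hbig hhκ hh0 hb0
    hσR.le hJ1 hC1
  refine ⟨c * δ, C + δ * C' + 1, by positivity, by positivity, ?_⟩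
  intro N k m hN hk hm hkm hspars θ hθ θhat hθhat θCV hθCV
  have hk2 : (2:ℝ) ≤ k := by exact_mod_cast hk
  have hk0 : (0:ℝ) < k := by linarith
  have hm0 : (0:ℝ) < m := by exact_mod_cast hm
  have hN0 : (0:ℝ) < N := by exact_mod_cast hN
  have hn : (0:ℝ) < ((k * m : ℕ) : ℝ) := by rw [hkm]; positivity
  have hbt := hbelow N k hN hk hspars θ hθ
  have hν := half_le_fold hk
  have hν1 : ((k : ℝ) - 1) / k ≤ 1 := by rw [div_le_one hk0]; linarith
  set M := A * k ^ 2 with hM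
  have hM1 : 0 < M := Nat.mul_pos hA1 (pow_pos (by omega) 2)
  have hM0 : (0:ℝ) < M := by exact_mod_cast hM1
  set lam : ℕ → ℝ := fun l => lmin + (lmax - lmin) * l / M with hlam
  have hlamI : ∀ l, l ≤ M → lam l ∈ Set.Icc lmin lmax := fun l hl' => by
    have h1 : (l : ℝ) / M ≤ 1 := by rw [div_le_one hM0]; exact_mod_cast hl'
    have h2 : 0 ≤ (l : ℝ) / M := by positivity
    have e : lam l = lmin + (lmax - lmin) * (l / M) := by simp only [hlam]; ring
    have h3 := mul_le_mul_of_nonneg_left h1 (sub_nonneg.2 hll)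
    have h4 := mul_nonneg (sub_nonneg.2 hll) h2
    rw [e]
    constructor <;> linarith
  set Λ : ℕ → ℝ := fun l => lam l * (((k : ℝ) - 1) / k) with hΛ
  have hΛI : ∀ l, l ≤ M → lmin / 2 ≤ Λ l ∧ Λ l ≤ lmax := fun l hl' => by
    obtain ⟨h1, h2⟩ := hlamI l hl'
    have h3 : 0 < lam l := hl.trans_le h1
    have h4 := mul_le_mul_of_nonneg_left hν h3.le
    have h5 := mul_le_mul_of_nonneg_left hν1 h3.le
    simp only [hΛ]
    constructor <;> linarith
  have hex : ∀ l, ∃ br : ℝ × ℝ, l ≤ M → b0 ≤ br.1 ∧ br.1 ≤ b1 ∧ σ ≤ br.2 ∧ br.2 ≤ R ∧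
      IsSaddle σ (((k : ℝ) - 1) / k) (Λ l) ((k * m : ℕ) : ℝ) θ br.1 br.2 := fun l => by
    by_cases hl' : l ≤ M
    · obtain ⟨b, r, H⟩ := hsaddle N _ _ (Λ l) θ hN hkm hν hν1 (hΛI l hl').1 (hΛI l hl').2 hbt
      exact ⟨(b, r), fun _ => H⟩
    · exact ⟨(0, 0), fun h => absurd h hl'⟩
  choose br hbr using hex
  have hP := hprob k m N _ θ Λ (fun l => (br l).1) (fun l => (br l).2) hN hk hm rfl hkm
    (fun l hl' => ⟨(hΛI l hl').1, (hΛI l hl').2, hbr l hl'⟩)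
  refine (PmodelCV_le k m N (Nat.mul_pos (by omega) hm) _ _ ?_).trans (hP.trans
    (ENNReal.ofReal_le_ofReal (rate_le hC.le ?_ hc.le hδ.le (by linarith)
      (by exact_mod_cast hN) hq0 hkm)))
  · rintro ω ⟨x, hx, hω⟩ hgood
    obtain ⟨l, hl', hlx⟩ := exists_grid_near hM1 hx
    have hlr : l ∈ Finset.range (A * k ^ 2 + 1) := Finset.mem_range.2 (Nat.lt_succ_of_le hl')
    obtain ⟨hb, hb', hr, hr', hsad⟩ := hbr l hl'
    have hclose : |Λ l - x * (((k : ℝ) - 1) / k)| ≤ h / (k : ℝ) ^ 2 := by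
      have e : Λ l - x * (((k : ℝ) - 1) / k) = (lam l - x) * (((k : ℝ) - 1) / k) := by
        simp only [hΛ]; ring
      rw [e, abs_mul, abs_of_nonneg (show 0 ≤ ((k : ℝ) - 1) / k by linarith)]
      refine (mul_le_of_le_one_right (abs_nonneg _) hν1).trans (hlx.trans (le_of_eq ?_))
      rw [hh, hM]; push_cast; rw [div_div]
    have key := hdet k m N _ x (Λ l) (br l).1 (br l).2 θ (modelArray k m N ω) hN hk hkm
      (hl.le.trans hx.1) (hΛI l hl').1 (hΛI l hl').2 hb hr hr' hsad hbt hclose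
      (fun i => hgood.fold l hlr i (Finset.mem_univ i)) hgood.noise
      (fun i => ⟨_, foldObj_le_of_isMinOn hk hm (hθCV (lam l) (hlamI l hl') i ω.1 ω.2)⟩)
      (fun i j => θCV x i ω.1 ω.2 j - θ j) (fun j => θhat x ω.1 ω.2 j - θ j)
      (fun i => foldObj_le_of_isMinOn hk hm (hθCV x hx i ω.1 ω.2))
      (fullObj_le_of_isMinOn hn (hθhat x hx ω.1 ω.2))
    rw [tau_sq hn] at key
    simp only [foldRes_modelArray hn] at key
    have e : (1 / (N : ℝ)) * ∑ i : Fin k, ∑ l : Fin m,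
                (yvecI σ θ ω.1 ω.2 (i, l) - ∑ j, ω.1 (i, l) j * θCV x i ω.1 ω.2 j) ^ 2
              - (1 / (N : ℝ)) * ∑ j, (θhat x ω.1 ω.2 j - θ j) ^ 2 - δ * σ ^ 2
        = δ * (∑ i : Fin k, (∑ l : Fin m,
                (yvecI σ θ ω.1 ω.2 (i, l) - ∑ j, ω.1 (i, l) j * θCV x i ω.1 ω.2 j) ^ 2)
                  / ((k * m : ℕ) : ℝ)
              - (σ ^ 2 + (∑ j, (θhat x ω.1 ω.2 j - θ j) ^ 2) / ((k * m : ℕ) : ℝ))) := by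
      rw [← Finset.sum_div, hkm]
      field_simp
      ring
    rw [e, abs_mul, abs_of_pos hδ] at hω
    have h1 := mul_le_mul_of_nonneg_left key hδ.le
    have hs0 : 0 < √(k:ℝ) := Real.sqrt_pos.2 hk0
    have h2 : δ * (C' / √(k:ℝ)) < (C + δ * C' + 1) / √(k:ℝ) := by
      rw [← mul_div_assoc]
      exact div_lt_div_of_pos_right (by linarith) hs0
    linarith
  · have : 0 ≤ δ * C' := by positivity
    linarith
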